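/- Let α, β > -1, s ∈ ℕ, 1 ≤ p ≤ ∞, and fix an admissible function η. Suppose either (a) θ = -1 with (i) β = 0 (any s ∈ ℕ, 1 ≤ p ≤ ∞) or (ii) s = 1 and β < p/2 - 1 for 1 < p ≤ ∞, β ≤ p/2 - 1 for p = 1; or (b) θ = 1 with (i) α = 0 (any s ∈ ℕ, 1 ≤ p ≤ ∞) or (ii) s = 1 and α < p/2 - 1 for 1 < p ≤ ∞, α ≤ p/2 - 1 for p = 1. Then there is a constant c > 0 independent of f and n such that for every f ∈ W_p^s(w_{α,β}) (f ∈ C^s[-1,1] when p = ∞), every n ≥ 1 and every 0 ≤ k ≤ s, ‖f^{(k)} - (𝒱_{n,θ}^{α-s,β-s} f)^{(k)}‖_{L^p(w_{α,β})} ≤ c · n^{-s+k} · E_n(f^{(s)})_{L^p(w_{α,β})}. -/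

import Mathlib

open MeasureTheory Set ENNReal NNReal

noncomputable section

namespace JacobiApprox

/-- The Jacobi weight `w_{α,β}(x) = (1-x)^α (1+x)^β` on `(-1,1)`. -/
def w (α β x : ℝ) : ℝ := (1 - x) ^ α * (1 + x) ^ β

/-- The weighted `L^p` norm `‖f‖_{L^p(w_{α,β})}`; for `p = ∞` it is the uniform
norm on `[-1,1]`. -/
def LpW (α β : ℝ) (p : ℝ≥0∞) (f : ℝ → ℝ) : ℝ :=
  if p = ⊤ then sSup ((fun x => |f x|) '' Icc (-1 : ℝ) 1)
  else (∫ x in Ioo (-1 : ℝ) 1, |f x| ^ p.toReal * w α β x) ^ (1 / p.toReal)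

/-- Membership in `L^p(w_{α,β})` (`f ∈ C[-1,1]` when `p = ∞`). -/
def MemLpW (α β : ℝ) (p : ℝ≥0∞) (f : ℝ → ℝ) : Prop :=
  Measurable f ∧
    (p ≠ ⊤ → IntegrableOn (fun x => |f x| ^ p.toReal * w α β x) (Ioo (-1 : ℝ) 1)) ∧
    (p = ⊤ → ContinuousOn f (Icc (-1 : ℝ) 1))

/-- `E_n(f)_{L^p(w_{α,β})}`: the error of best approximation of `f` by polynomials
of degree at most `n` in `L^p(w_{α,β})`. -/
def E (α β : ℝ) (p : ℝ≥0∞) (n : ℕ) (f : ℝ → ℝ) : ℝ :=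
  sInf {r : ℝ | ∃ q : Polynomial ℝ, q.natDegree ≤ n ∧
    r = LpW α β p (fun x => f x - q.eval x)}

/-- Membership in the Sobolev space `W_p^s(w_{α,β})`: `f` has `s` continuous
derivatives and `f^{(s)} ∈ L^p(w_{α,β})` (for `p = ∞` this is `f ∈ C^s[-1,1]`). -/
def MemW (α β : ℝ) (p : ℝ≥0∞) (s : ℕ) (f : ℝ → ℝ) : Prop :=
  ContDiff ℝ (s : ℕ∞) f ∧
    (p ≠ ⊤ → IntegrableOn (fun x => |iteratedDeriv s f x| ^ p.toReal * w α β x)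
      (Ioo (-1 : ℝ) 1))

/-- The Sobolev norm `‖f‖_{W_p^s(w_{α,β})}` (max over derivatives when `p = ∞`). -/
def WNorm (α β : ℝ) (p : ℝ≥0∞) (s : ℕ) (f : ℝ → ℝ) : ℝ :=
  if p = ⊤ then
    (Finset.range (s + 1)).sup' (Finset.nonempty_range_iff.mpr (Nat.succ_ne_zero s))
      (fun k => LpW α β ⊤ (iteratedDeriv k f))
  else (∑ k ∈ Finset.range (s + 1), (LpW α β p (iteratedDeriv k f)) ^ p.toReal) ^
    (1 / p.toReal)

/-- Pochhammer symbol (rising factorial) `(a)_k`. -/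
def poch (a : ℝ) (k : ℕ) : ℝ := ∏ i ∈ Finset.range k, (a + i)

/-- The Jacobi polynomial `P_n^{(α,β)}`. -/
def JP (α β : ℝ) (n : ℕ) (t : ℝ) : ℝ :=
  (poch (α + 1) n / n.factorial) *
    ∑ k ∈ Finset.range (n + 1),
      poch (-(n : ℝ)) k * poch ((n : ℝ) + α + β + 1) k /
        (poch (α + 1) k * k.factorial) * ((1 - t) / 2) ^ k

/-- The renormalized Jacobi polynomial `J_n^{α,β} = 2^n/(n+α+β+1)_n · P_n^{(α,β)}`. -/
def J (α β : ℝ) (n : ℕ) (t : ℝ) : ℝ :=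
  2 ^ n / poch ((n : ℝ) + α + β + 1) n * JP α β n t

/-- The inner product `⟨f,g⟩_{α,β} = ∫_{-1}^1 f g w_{α,β}`. -/
def ip (α β : ℝ) (f g : ℝ → ℝ) : ℝ := ∫ x in Ioo (-1 : ℝ) 1, f x * g x * w α β x

/-- `h_n^{α,β} = ⟨J_n^{α,β}, J_n^{α,β}⟩_{α,β}`. -/
def hJ (α β : ℝ) (n : ℕ) : ℝ := ip α β (J α β n) (J α β n)

/-- The Fourier–Jacobi coefficient `\hat f_n^{α,β}`. -/
def coeff (α β : ℝ) (n : ℕ) (f : ℝ → ℝ) : ℝ := ip α β f (J α β n) / hJ α β n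

/-- The `n`-th partial sum `S_n^{α,β} f` of the Fourier–Jacobi series. -/
def S (α β : ℝ) (n : ℕ) (f : ℝ → ℝ) (x : ℝ) : ℝ :=
  ∑ k ∈ Finset.range (n + 1), coeff α β k f * J α β k x

/-- An admissible cut-off function: `C^∞`, `η ≡ 1` on `[0,1]`, `η ≡ 0` on `[2,∞)`. -/
def Admissible (η : ℝ → ℝ) : Prop :=
  ContDiff ℝ (⊤ : ℕ∞) η ∧ (∀ t : ℝ, 0 ≤ t → t ≤ 1 → η t = 1) ∧ ∀ t : ℝ, 2 ≤ t → η t = 0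

/-- The de la Vallée Poussin type operator `V_n^{α,β} f`. -/
def V (η : ℝ → ℝ) (α β : ℝ) (n : ℕ) (f : ℝ → ℝ) (x : ℝ) : ℝ :=
  ∑ k ∈ Finset.range (2 * n + 1), η ((k : ℝ) / (n : ℝ)) * coeff α β k f * J α β k x

/-- The Sobolev orthogonal polynomial `𝒥_{n,θ}^{α-s,β-s}`. -/
def SJ (α β : ℝ) (s : ℕ) (θ : ℝ) (n : ℕ) (x : ℝ) : ℝ :=
  if n < s then (x - θ) ^ n / n.factorial
  else ∫ t in θ..x, (x - t) ^ (s - 1) / (s - 1).factorial * J α β (n - s) t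

/-- The Sobolev inner product `⟨f,g⟩_{α,β}^{-s}`. -/
def ipS (α β : ℝ) (s : ℕ) (θ : ℝ) (lam : ℕ → ℝ) (f g : ℝ → ℝ) : ℝ :=
  ip α β (iteratedDeriv s f) (iteratedDeriv s g) +
    ∑ k ∈ Finset.range s, lam k * iteratedDeriv k f θ * iteratedDeriv k g θ

/-- The Fourier coefficient `\hat{𝔣}_n^{α-s,β-s}` in the Sobolev orthogonal system. -/
def coeffS (α β : ℝ) (s : ℕ) (θ : ℝ) (lam : ℕ → ℝ) (n : ℕ) (f : ℝ → ℝ) : ℝ :=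
  ipS α β s θ lam f (SJ α β s θ n) / ipS α β s θ lam (SJ α β s θ n) (SJ α β s θ n)

/-- The `n`-th partial sum `𝒮_{n,θ}^{α-s,β-s} f` of the Sobolev orthogonal expansion. -/
def SS (α β : ℝ) (s : ℕ) (θ : ℝ) (lam : ℕ → ℝ) (n : ℕ) (f : ℝ → ℝ) (x : ℝ) : ℝ :=
  ∑ k ∈ Finset.range (n + 1), coeffS α β s θ lam k f * SJ α β s θ k x

/-- The operator `𝒱_{n,θ}^{α-s,β-s} f`. -/
def VS (η : ℝ → ℝ) (α β : ℝ) (s : ℕ) (θ : ℝ) (n : ℕ) (f : ℝ → ℝ) (x : ℝ) : ℝ :=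
  (∑ k ∈ Finset.range s, iteratedDeriv k f θ * (x - θ) ^ k / k.factorial) +
    ∫ t in θ..x, (x - t) ^ (s - 1) / (s - 1).factorial *
      V η α β n (iteratedDeriv s f) t

/-- `A_j^{α,β} = (α+β+2)_{2j}/(α+1)_j`. -/
def Acoef (α β : ℝ) (j : ℕ) : ℝ := poch (α + β + 2) (2 * j) / poch (α + 1) j

/-- `B_n^{α,β} = (α+1)_{n+1}/(α+β+2)_{2n+1}`. -/
def Bcoef (α β : ℝ) (n : ℕ) : ℝ := poch (α + 1) (n + 1) / poch (α + β + 2) (2 * n + 1)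

/-- `D_j^{α,β} = (j+β+1)/((2j+α+β+2)(2j+α+β+3))`. -/
def Dcoef (α β : ℝ) (j : ℕ) : ℝ :=
  ((j : ℝ) + β + 1) / ((2 * (j : ℝ) + α + β + 2) * (2 * (j : ℝ) + α + β + 3))

/-- The function `u_{g,k}` of the Aubin–Nitsche duality argument. -/
def u (α β : ℝ) (s k : ℕ) (g : ℝ → ℝ) (x : ℝ) : ℝ :=
  ∫ t in (-1 : ℝ)..x, (x - t) ^ (s - 1) / (s - 1).factorial * (1 / w α β t) *
    ∫ y in t..(1 : ℝ), (y - t) ^ (s - k - 1) / (s - k - 1).factorial * g y * w α β y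

/-- The `s`-th derivative of `u_{g,k}`, given by its explicit formula. -/
def uDs (α β : ℝ) (s k : ℕ) (g : ℝ → ℝ) (x : ℝ) : ℝ :=
  (1 / w α β x) *
    ∫ y in x..(1 : ℝ), (y - x) ^ (s - k - 1) / (s - k - 1).factorial * g y * w α β y

/-- The Jacobi weight in the variable `τ = arccos x`, including the Jacobian. -/
def wt (α β τ : ℝ) : ℝ := w α β (Real.cos τ) * Real.sin τ

lemma one_sub_cos_pos {τ : ℝ} (h : τ ∈ Ioo 0 Real.pi) : 0 < 1 - Real.cos τ := by
  have := Real.cos_lt_cos_of_nonneg_of_le_pi le_rfl h.2.le h.1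
  rw [Real.cos_zero] at this; linarith

lemma one_add_cos_pos {τ : ℝ} (h : τ ∈ Ioo 0 Real.pi) : 0 < 1 + Real.cos τ := by
  have := Real.cos_lt_cos_of_nonneg_of_le_pi h.1.le le_rfl h.2
  rw [Real.cos_pi] at this; linarith

lemma wt_eq (α β : ℝ) {τ : ℝ} (h : τ ∈ Ioo 0 Real.pi) :
    wt α β τ = (1 - Real.cos τ) ^ (α + 1/2) * (1 + Real.cos τ) ^ (β + 1/2) := by
  have h1 := one_sub_cos_pos h
  have h2 := one_add_cos_pos h
  have hs : Real.sin τ = (1 - Real.cos τ) ^ (1/2 : ℝ) * (1 + Real.cos τ) ^ (1/2 : ℝ) := by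
    rw [← Real.mul_rpow h1.le h2.le, ← Real.sqrt_eq_rpow, Real.sin_eq_sqrt_one_sub_cos_sq h.1.le h.2.le]
    congr 1; ring
  rw [wt, w, Real.rpow_add h1, Real.rpow_add h2, hs]; ring

lemma wt_pos (α β : ℝ) {τ : ℝ} (h : τ ∈ Ioo 0 Real.pi) : 0 < wt α β τ := by
  rw [wt_eq α β h]
  exact mul_pos (Real.rpow_pos_of_pos (one_sub_cos_pos h) _) (Real.rpow_pos_of_pos (one_add_cos_pos h) _)

lemma wt_nonneg (α β : ℝ) {τ : ℝ} (h : τ ∈ Ioo 0 Real.pi) : 0 ≤ wt α β τ := (wt_pos α β h).le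

lemma wt_measurable (α β : ℝ) : Measurable (wt α β) := by
  unfold wt w; fun_prop

/-- comparability of powers -/
lemma rpow_comp (r : ℝ) {m M : ℝ} (hm : 0 < m) (hM : 0 < M) : ∃ C : ℝ, 0 < C ∧
    ∀ X Y : ℝ, 0 < X → 0 < Y → m * Y ≤ X → X ≤ M * Y → X ^ r ≤ C * Y ^ r ∧ Y ^ r ≤ C * X ^ r := by
  refine ⟨m ^ r + M ^ r + m ^ (-r) + M ^ (-r), by positivity, ?_⟩
  intro X Y hX hY h1 h2
  have a1 := Real.rpow_pos_of_pos hm r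
  have a2 := Real.rpow_pos_of_pos hM r
  have a3 := Real.rpow_pos_of_pos hm (-r)
  have a4 := Real.rpow_pos_of_pos hM (-r)
  have b1 := Real.rpow_pos_of_pos hX r
  have b2 := Real.rpow_pos_of_pos hY r
  have key1 : X ^ r ≤ m ^ r * Y ^ r ∨ X ^ r ≤ M ^ r * Y ^ r := by
    rcases le_total 0 r with h | h
    · right; rw [← Real.mul_rpow hM.le hY.le]; exact Real.rpow_le_rpow hX.le h2 h
    · left; rw [← Real.mul_rpow hm.le hY.le]; exact Real.rpow_le_rpow_of_nonpos (by positivity) h1 h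
  have key2 : Y ^ r ≤ m ^ (-r) * X ^ r ∨ Y ^ r ≤ M ^ (-r) * X ^ r := by
    rcases le_total 0 r with h | h
    · left
      have : m ^ r * Y ^ r ≤ X ^ r := by
        rw [← Real.mul_rpow hm.le hY.le]; exact Real.rpow_le_rpow (by positivity) h1 h
      rw [Real.rpow_neg hm.le, ← div_eq_inv_mul, le_div_iff₀ a1]; linarith
    · right
      have : M ^ r * Y ^ r ≤ X ^ r := by
        rw [← Real.mul_rpow hM.le hY.le]; exact Real.rpow_le_rpow_of_nonpos (by positivity) h2 h
      rw [Real.rpow_neg hM.le, ← div_eq_inv_mul, le_div_iff₀ a2]; linarith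
  constructor
  · rcases key1 with h | h <;> refine h.trans ?_ <;> apply mul_le_mul_of_nonneg_right _ b2.le <;> linarith
  · rcases key2 with h | h <;> refine h.trans ?_ <;> apply mul_le_mul_of_nonneg_right _ b1.le <;> linarith

lemma one_sub_cos_comp {τ : ℝ} (h : τ ∈ Ioo 0 Real.pi) :
    (2 / Real.pi ^ 2) * τ ^ 2 ≤ 1 - Real.cos τ ∧ 1 - Real.cos τ ≤ (1/2) * τ ^ 2 := by
  constructor
  · have := Real.cos_le_one_sub_mul_cos_sq (x := τ) (by rw [abs_of_pos h.1]; exact h.2.le)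
    linarith
  · have := Real.one_sub_sq_div_two_le_cos (x := τ); linarith

/-- model weight -/
def mw (α β τ : ℝ) : ℝ := τ ^ (2 * α + 1) * (Real.pi - τ) ^ (2 * β + 1)

lemma mw_pos (α β : ℝ) {τ : ℝ} (h : τ ∈ Ioo 0 Real.pi) : 0 < mw α β τ :=
  mul_pos (Real.rpow_pos_of_pos h.1 _) (Real.rpow_pos_of_pos (by linarith [h.2]) _)

lemma wt_comp (α β : ℝ) : ∃ C : ℝ, 0 < C ∧ ∀ τ ∈ Ioo 0 Real.pi,
    wt α β τ ≤ C * mw α β τ ∧ mw α β τ ≤ C * wt α β τ := by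
  obtain ⟨C1, hC1, H1⟩ := rpow_comp (α + 1/2) (m := 2 / Real.pi ^ 2) (M := 1/2) (by positivity) (by norm_num)
  obtain ⟨C2, hC2, H2⟩ := rpow_comp (β + 1/2) (m := 2 / Real.pi ^ 2) (M := 1/2) (by positivity) (by norm_num)
  refine ⟨C1 * C2, by positivity, fun τ h => ?_⟩
  have h' : Real.pi - τ ∈ Ioo 0 Real.pi := ⟨by linarith [h.2], by linarith [h.1]⟩
  have e1 := one_sub_cos_comp h
  have e2 := one_sub_cos_comp h'
  rw [Real.cos_pi_sub, sub_neg_eq_add] at e2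
  have f1 := H1 _ (τ ^ 2) (one_sub_cos_pos h) (by have := h.1; positivity) e1.1 e1.2
  have f2 := H2 _ ((Real.pi - τ) ^ 2) (one_add_cos_pos h) (by have := h'.1; positivity) e2.1 e2.2
  have g1 : (τ ^ 2) ^ (α + 1/2) = τ ^ (2 * α + 1) := by
    rw [← Real.rpow_natCast, ← Real.rpow_mul h.1.le]; congr 1; push_cast; ring
  have g2 : ((Real.pi - τ) ^ 2) ^ (β + 1/2) = (Real.pi - τ) ^ (2 * β + 1) := by
    rw [← Real.rpow_natCast, ← Real.rpow_mul h'.1.le]; congr 1; push_cast; ring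
  rw [g1] at f1; rw [g2] at f2
  rw [wt_eq α β h, mw]
  have p1 := Real.rpow_pos_of_pos (one_sub_cos_pos h) (α + 1/2)
  have p2 := Real.rpow_pos_of_pos (one_add_cos_pos h) (β + 1/2)
  have p3 := Real.rpow_pos_of_pos h.1 (2 * α + 1)
  have p4 := Real.rpow_pos_of_pos h'.1 (2 * β + 1)
  constructor
  · calc _ ≤ (C1 * τ ^ (2 * α + 1)) * (C2 * (Real.pi - τ) ^ (2 * β + 1)) :=
        mul_le_mul f1.1 f2.1 p2.le (by positivity)
      _ = _ := by ring
  · calc _ ≤ (C1 * (1 - Real.cos τ) ^ (α + 1/2)) * (C2 * (1 + Real.cos τ) ^ (β + 1/2)) :=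
        mul_le_mul f1.2 f2.2 p4.le (by positivity)
      _ = _ := by ring

lemma peak (a : ℝ) {n τ θ : ℝ} (hn : 0 < n) (hτ : 0 ≤ τ) (hθ : 0 ≤ θ) :
    (τ + 1/n) ^ a ≤ (θ + 1/n) ^ a * (1 + n * |τ - θ|) ^ |a| := by
  have key : ∀ x y : ℝ, 0 ≤ x → 0 ≤ y → x + 1/n ≤ (y + 1/n) * (1 + n * |x - y|) := by
    intro x y hx hy
    have h1 : (y + 1/n) * (1 + n * |x - y|) = y + 1/n + |x-y| + n * y * |x-y| := by field_simp; ring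
    have h2 : x - y ≤ |x - y| := le_abs_self _
    have : 0 ≤ n * y * |x-y| := by positivity
    rw [h1]; linarith
  have hX : 0 < τ + 1/n := by positivity
  have hY : 0 < θ + 1/n := by positivity
  have hZ : 0 < 1 + n * |τ - θ| := by positivity
  rcases le_total 0 a with h | h
  · rw [abs_of_nonneg h, ← Real.mul_rpow hY.le hZ.le]
    exact Real.rpow_le_rpow hX.le (key τ θ hτ hθ) h
  · rw [abs_of_nonpos h]
    have k2 := key θ τ hθ hτ
    rw [abs_sub_comm] at k2
    have := Real.rpow_le_rpow_of_nonpos hY k2 h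
    rw [Real.mul_rpow hX.le hZ.le] at this
    have hz := Real.rpow_pos_of_pos hZ a
    rw [Real.rpow_neg hZ.le, ← div_eq_mul_inv, le_div_iff₀ hz]
    exact this

/-- regularized model weight -/
def mwn (α β n θ : ℝ) : ℝ := (θ + 1/n) ^ (2 * α + 1) * (Real.pi - θ + 1/n) ^ (2 * β + 1)

lemma mwn_pos (α β : ℝ) {n θ : ℝ} (hn : 0 < n) (h : θ ∈ Icc 0 Real.pi) : 0 < mwn α β n θ := by
  have h1 := h.1
  have h2 : 0 ≤ Real.pi - θ := by linarith [h.2]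
  unfold mwn; positivity

lemma rpow_intOn (a : ℝ) (ha : -1 < a) (b : ℝ) (hb : 0 ≤ b) :
    IntegrableOn (fun τ : ℝ => τ ^ a) (Ioo 0 b) := by
  have := (intervalIntegral.intervalIntegrable_rpow' (a := 0) (b := b) ha)
  rw [intervalIntegrable_iff_integrableOn_Ioo_of_le hb] at this
  exact this

lemma rpow_intOn' (a : ℝ) (ha : -1 < a) :
    IntegrableOn (fun τ : ℝ => (Real.pi - τ) ^ a) (Ioo 0 Real.pi) := by
  have := (intervalIntegral.intervalIntegrable_rpow' (a := 0) (b := Real.pi) ha).comp_sub_left Real.pi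
  simp only [sub_zero, sub_self] at this
  have := this.symm
  rw [intervalIntegrable_iff_integrableOn_Ioo_of_le Real.pi_pos.le] at this
  exact this

lemma mw_le (α β : ℝ) : ∃ C : ℝ, 0 < C ∧ ∀ τ ∈ Ioo 0 Real.pi,
    mw α β τ ≤ C * (τ ^ (2 * α + 1) + (Real.pi - τ) ^ (2 * β + 1)) := by
  obtain ⟨C1, hC1, H1⟩ := rpow_comp (2 * α + 1) (m := Real.pi/2) (M := Real.pi) (by positivity) (by positivity)
  obtain ⟨C2, hC2, H2⟩ := rpow_comp (2 * β + 1) (m := Real.pi/2) (M := Real.pi) (by positivity) (by positivity)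
  refine ⟨C1 + C2, by positivity, fun τ h => ?_⟩
  have h1 := h.1
  have h2 : 0 < Real.pi - τ := by linarith [h.2]
  have p3 := Real.rpow_pos_of_pos h1 (2 * α + 1)
  have p4 := Real.rpow_pos_of_pos h2 (2 * β + 1)
  unfold mw
  rcases le_total τ (Real.pi/2) with h3 | h3
  · have := (H2 (Real.pi - τ) 1 h2 one_pos (by linarith) (by linarith)).1
    rw [Real.one_rpow] at this
    nlinarith [mul_le_mul_of_nonneg_left this p3.le, mul_pos hC1 p3, mul_pos hC1 p4, mul_pos hC2 p4]
  · have := (H1 τ 1 h1 one_pos (by linarith) (by linarith)).1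
    rw [Real.one_rpow] at this
    nlinarith [mul_le_mul_of_nonneg_right this p4.le, mul_pos hC1 p3, mul_pos hC2 p3, mul_pos hC2 p4]

lemma wt_intOn (α β : ℝ) (hα : -1 < α) (hβ : -1 < β) : IntegrableOn (wt α β) (Ioo 0 Real.pi) := by
  obtain ⟨C1, hC1, H1⟩ := wt_comp α β
  obtain ⟨C2, hC2, H2⟩ := mw_le α β
  have : IntegrableOn (fun τ => C1 * (C2 * (τ ^ (2 * α + 1) + (Real.pi - τ) ^ (2 * β + 1)))) (Ioo 0 Real.pi) :=
    ((((rpow_intOn _ (by linarith) _ Real.pi_pos.le).add (rpow_intOn' _ (by linarith))).const_mul C2).const_mul C1)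
  refine Integrable.mono' this (wt_measurable α β).aestronglyMeasurable ?_
  filter_upwards [ae_restrict_mem measurableSet_Ioo] with τ hτ
  rw [Real.norm_of_nonneg (wt_nonneg α β hτ)]
  exact (H1 τ hτ).1.trans (mul_le_mul_of_nonneg_left (H2 τ hτ) hC1.le)

/-- decay function -/
def dk (N : ℕ) (n d : ℝ) : ℝ := ((1 + n * |d|) ^ N)⁻¹

lemma dk_pos (N : ℕ) {n d : ℝ} (hn : 0 < n) : 0 < dk N n d := by unfold dk; positivity
lemma dk_le_one (N : ℕ) {n d : ℝ} (hn : 0 < n) : dk N n d ≤ 1 := by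
  unfold dk; apply inv_le_one_of_one_le₀; apply one_le_pow₀
  have : 0 ≤ n * |d| := by positivity
  linarith
lemma dk_cont (N : ℕ) {n : ℝ} (hn : 0 < n) : Continuous (dk N n) := by
  unfold dk
  refine Continuous.inv₀ (by fun_prop) (fun x => by positivity)
lemma dk_cont' (N : ℕ) {n : ℝ} (θ : ℝ) (hn : 0 < n) : Continuous (fun τ => dk N n (τ - θ)) :=
  (dk_cont N hn).comp (by fun_prop)
lemma dk_anti {N M : ℕ} (h : N ≤ M) {n d : ℝ} (hn : 0 < n) : dk M n d ≤ dk N n d := by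
  unfold dk
  apply inv_anti₀ (by positivity)
  apply pow_le_pow_right₀ _ h
  have : 0 ≤ n * |d| := by positivity
  linarith
lemma dk_neg (N : ℕ) (n d : ℝ) : dk N n (-d) = dk N n d := by unfold dk; rw [abs_neg]
lemma dk_symm (N : ℕ) (n a b : ℝ) : dk N n (a - b) = dk N n (b - a) := by rw [← dk_neg, neg_sub]

lemma dk_split {N K D : ℕ} (h : K + D ≤ N) {a n d : ℝ} (ha : a ≤ D) (hn : 0 < n) :
    (1 + n * |d|) ^ a * dk N n d ≤ dk K n d := by
  have h1 : 1 ≤ 1 + n * |d| := by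
    have : 0 ≤ n * |d| := by positivity
    linarith
  have h0 : 0 < 1 + n * |d| := by linarith
  have e : (1 + n * |d|) ^ a ≤ (1 + n * |d|) ^ D := by
    rw [← Real.rpow_natCast]; exact Real.rpow_le_rpow_of_exponent_le h1 ha
  have e2 : dk N n d ≤ dk (K + D) n d := dk_anti h hn
  calc _ ≤ (1 + n * |d|) ^ D * dk (K + D) n d := mul_le_mul e e2 (dk_pos _ hn).le (by positivity)
    _ = dk K n d := by unfold dk; rw [pow_add]; field_simp

lemma dk_mul_le (N : ℕ) {n : ℝ} (hn : 0 < n) (a b c : ℝ) :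
    dk N n (a - b) * dk N n (b - c) ≤ dk N n (a - c) := by
  unfold dk
  rw [← mul_inv, ← mul_pow]
  apply inv_anti₀ (by positivity)
  apply pow_le_pow_left₀ (by positivity)
  have h := abs_sub_le a b c
  have h3 : 0 ≤ n * |a - b| := by positivity
  have h4 : 0 ≤ n * |b - c| := by positivity
  nlinarith [mul_le_mul_of_nonneg_left h hn.le, mul_nonneg h3 h4]

lemma integrable_dk2 {n : ℝ} (hn : 0 < n) (θ : ℝ) : Integrable (fun τ => dk 2 n (τ - θ)) ∧
    ∫ τ, dk 2 n (τ - θ) ≤ Real.pi / n := by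
  have i0 : Integrable (fun x : ℝ => (1 + x ^ 2)⁻¹) := integrable_inv_one_add_sq
  have i1 : Integrable (fun x : ℝ => (1 + (n * x) ^ 2)⁻¹) := i0.comp_mul_left' hn.ne'
  have i2 : Integrable (fun x : ℝ => (1 + (n * (x - θ)) ^ 2)⁻¹) := i1.comp_sub_right θ
  have hle : ∀ x, dk 2 n (x - θ) ≤ (1 + (n * (x - θ)) ^ 2)⁻¹ := by
    intro x
    unfold dk
    apply inv_anti₀ (by positivity)
    have : (n * (x-θ))^2 = (n * |x - θ|)^2 := by rw [mul_pow, mul_pow, sq_abs]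
    have h3 : 0 ≤ n * |x - θ| := by positivity
    nlinarith
  have i3 : Integrable (fun τ => dk 2 n (τ - θ)) := by
    refine i2.mono' (dk_cont' 2 θ hn).aestronglyMeasurable (Filter.Eventually.of_forall fun x => ?_)
    rw [Real.norm_of_nonneg (dk_pos _ hn).le]; exact hle x
  refine ⟨i3, (integral_mono i3 i2 hle).trans ?_⟩
  rw [integral_sub_right_eq_self (fun x : ℝ => (1 + (n * x) ^ 2)⁻¹) θ]
  rw [MeasureTheory.Measure.integral_comp_mul_left (fun x : ℝ => (1 + x ^ 2)⁻¹) n]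
  rw [integral_univ_inv_one_add_sq, abs_of_pos (by positivity)]
  simp only [smul_eq_mul]; apply le_of_eq; field_simp

lemma oneD (a : ℝ) (ha : -1 < a) (D : ℕ) (hD : |a| ≤ D) : ∃ C : ℝ, 0 < C ∧ ∀ n : ℝ, 1 ≤ n → ∀ θ ∈ Icc 0 Real.pi,
    ∫ τ in Ioo 0 Real.pi, τ ^ a * dk (D + 2) n (τ - θ) ≤ C / n * (θ + 1/n) ^ a := by
  obtain ⟨C1, hC1, H1⟩ := rpow_comp a (m := 1/2) (M := 1) (by norm_num) (by norm_num)
  have ha1 : 0 < a + 1 := by linarith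
  refine ⟨C1 * Real.pi + 2 ^ (D + 2) / (a + 1), by positivity, fun n hn θ hθ => ?_⟩
  have hn0 : 0 < n := by linarith
  have hθ0 := hθ.1
  have hY : 0 < (θ + 1/n) ^ a := by positivity
  have hpw : ∀ τ ∈ Ioo 0 Real.pi, τ ^ a * dk (D + 2) n (τ - θ) ≤
      C1 * (θ + 1/n) ^ a * dk 2 n (τ - θ) + 2 ^ (D+2) * (θ + 1/n) ^ a * n ^ a * (Ioo 0 (1/n)).indicator (fun τ => τ ^ a) τ := by
    intro τ hτ
    have hτ0 := hτ.1
    by_cases hc : τ < 1/n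
    · rw [indicator_of_mem (show τ ∈ Ioo 0 (1/n) from ⟨hτ0, hc⟩)]
      have h1 : dk (D+2) n (τ - θ) ≤ 2 ^ (D+2) * ((1 + n * θ) ^ (D+2))⁻¹ := by
        unfold dk
        have hnt : n * τ < 1 := by rwa [lt_div_iff₀' hn0] at hc
        have : (1 + n * θ)/2 ≤ 1 + n * |τ - θ| := by
          have h4 : θ - τ ≤ |τ - θ| := by rw [abs_sub_comm]; exact le_abs_self _
          have h3 : 0 ≤ n * |τ - θ| := by positivity
          nlinarith [mul_le_mul_of_nonneg_left h4 hn0.le]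
        calc ((1 + n * |τ - θ|) ^ (D + 2))⁻¹ ≤ (((1 + n * θ)/2) ^ (D+2))⁻¹ := by
              apply inv_anti₀ (by positivity); exact pow_le_pow_left₀ (by positivity) this _
          _ = _ := by rw [div_pow]; field_simp
      have h2 : ((1 + n * θ) ^ (D+2))⁻¹ ≤ (θ + 1/n) ^ a * n ^ a := by
        rw [← Real.mul_rpow (by positivity) hn0.le, ← Real.rpow_natCast, ← Real.rpow_neg (by positivity)]
        have : (θ + 1/n) * n = 1 + n * θ := by field_simp; ring
        rw [this]
        apply Real.rpow_le_rpow_of_exponent_le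
        · have : 0 ≤ n * θ := by positivity
          linarith
        · push_cast; linarith [neg_abs_le a]
      have p0 : 0 ≤ τ ^ a := by positivity
      calc _ ≤ τ ^ a * (2 ^ (D+2) * ((θ + 1/n) ^ a * n ^ a)) := by
            apply mul_le_mul_of_nonneg_left (h1.trans _) p0
            exact mul_le_mul_of_nonneg_left h2 (by positivity)
        _ = 2 ^ (D+2) * (θ + 1/n) ^ a * n ^ a * τ ^ a := by ring
        _ ≤ _ := by
          have := (dk_pos 2 hn0 (d := τ - θ))
          have : 0 ≤ C1 * (θ + 1/n) ^ a * dk 2 n (τ - θ) := by positivity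
          linarith
    · push Not at hc
      rw [indicator_of_notMem (by simp; intro _; linarith [hc, one_div n])]
      have h1 : τ ^ a ≤ C1 * (τ + 1/n) ^ a :=
        (H1 τ (τ + 1/n) hτ0 (by positivity) (by linarith) (by rw [one_mul]; have : 0 < 1/n := by positivity
                                                              linarith)).1
      have h2 := peak a hn0 hτ0.le hθ0
      have h3 := dk_split (K := 2) (D := D) (N := D+2) (by omega) (d := τ - θ) hD hn0
      have p := dk_pos (D+2) hn0 (d := τ - θ)
      calc _ ≤ C1 * ((θ + 1/n) ^ a * (1 + n * |τ - θ|) ^ |a|) * dk (D+2) n (τ - θ) := by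
            apply mul_le_mul_of_nonneg_right _ p.le
            exact h1.trans (mul_le_mul_of_nonneg_left h2 hC1.le)
        _ = C1 * (θ + 1/n) ^ a * ((1 + n * |τ - θ|) ^ |a| * dk (D+2) n (τ - θ)) := by ring
        _ ≤ C1 * (θ + 1/n) ^ a * dk 2 n (τ - θ) := mul_le_mul_of_nonneg_left h3 (by positivity)
        _ ≤ _ := by simp
  have ii := integrable_dk2 hn0 θ
  have i1 : Integrable (fun τ => C1 * (θ + 1/n) ^ a * dk 2 n (τ - θ)) := ii.1.const_mul _
  have i2 : Integrable (fun τ => 2 ^ (D+2) * (θ + 1/n) ^ a * n ^ a * (Ioo 0 (1/n)).indicator (fun τ : ℝ => τ ^ a) τ) :=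
    ((integrable_indicator_iff measurableSet_Ioo).2 (rpow_intOn a ha _ (by positivity))).const_mul _
  have hL : IntegrableOn (fun τ => τ ^ a * dk (D + 2) n (τ - θ)) (Ioo 0 Real.pi) := by
    refine (rpow_intOn a ha _ Real.pi_pos.le).mono' ?_ ?_
    · exact (Measurable.mul (by fun_prop) (dk_cont' _ _ hn0).measurable).aestronglyMeasurable
    · filter_upwards [ae_restrict_mem measurableSet_Ioo] with τ hτ
      have := hτ.1
      have p := dk_pos (D+2) hn0 (d := τ - θ)
      rw [Real.norm_of_nonneg (by positivity)]
      exact mul_le_of_le_one_right (by positivity) (dk_le_one _ hn0)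
  calc _ ≤ ∫ τ in Ioo 0 Real.pi, (C1 * (θ + 1/n) ^ a * dk 2 n (τ - θ) + 2 ^ (D+2) * (θ + 1/n) ^ a * n ^ a * (Ioo 0 (1/n)).indicator (fun τ => τ ^ a) τ) :=
        setIntegral_mono_on hL (i1.add i2).integrableOn measurableSet_Ioo hpw
    _ ≤ ∫ τ, (C1 * (θ + 1/n) ^ a * dk 2 n (τ - θ) + 2 ^ (D+2) * (θ + 1/n) ^ a * n ^ a * (Ioo 0 (1/n)).indicator (fun τ => τ ^ a) τ) := by
        apply setIntegral_le_integral (i1.add i2)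
        refine Filter.Eventually.of_forall fun τ => ?_
        have := (dk_pos 2 hn0 (d := τ - θ))
        have : 0 ≤ (Ioo 0 (1/n)).indicator (fun τ : ℝ => τ ^ a) τ :=
          indicator_nonneg (fun x hx => Real.rpow_nonneg hx.1.le _) _
        simp only [Pi.zero_apply]
        exact add_nonneg (by positivity) (mul_nonneg (by positivity) this)
    _ = C1 * (θ + 1/n) ^ a * (∫ τ, dk 2 n (τ - θ)) + 2 ^ (D+2) * (θ + 1/n) ^ a * n ^ a * ((1/n) ^ (a+1) / (a+1)) := by
        rw [integral_add i1 i2, integral_const_mul, integral_const_mul]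
        rw [integral_indicator measurableSet_Ioo, ← integral_Ioc_eq_integral_Ioo,
          ← intervalIntegral.integral_of_le (by positivity), integral_rpow (Or.inl ha),
          Real.zero_rpow ha1.ne', sub_zero]
    _ ≤ C1 * (θ + 1/n) ^ a * (Real.pi / n) + 2 ^ (D+2) * (θ + 1/n) ^ a * (1 / n / (a+1)) := by
        have e : n ^ a * ((1/n) ^ (a+1) / (a+1)) = 1/n/(a+1) := by
          rw [Real.rpow_add (by positivity), Real.rpow_one, ← mul_div_assoc, ← mul_assoc, ← Real.mul_rpow hn0.le (by positivity)]
          rw [mul_one_div_cancel hn0.ne', Real.one_rpow, one_mul]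
        rw [mul_assoc (2 ^ (D+2) * (θ + 1/n) ^ a), e]
        have := mul_le_mul_of_nonneg_left ii.2 (show 0 ≤ C1 * (θ + 1/n) ^ a by positivity)
        linarith
    _ = _ := by field_simp

lemma wt_dk_intOn (α β : ℝ) (hα : -1 < α) (hβ : -1 < β) (N : ℕ) {n : ℝ} (hn : 0 < n) (θ : ℝ) :
    IntegrableOn (fun τ => dk N n (τ - θ) * wt α β τ) (Ioo 0 Real.pi) := by
  refine (wt_intOn α β hα hβ).mono' ?_ ?_
  · exact ((dk_cont' _ _ hn).measurable.mul (wt_measurable α β)).aestronglyMeasurable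
  · filter_upwards [ae_restrict_mem measurableSet_Ioo] with τ hτ
    have p := dk_pos N hn (d := τ - θ)
    have q := wt_pos α β hτ
    rw [Real.norm_of_nonneg (by positivity)]
    exact mul_le_of_le_one_left q.le (dk_le_one _ hn)

/-- number of decay powers sufficient for given exponents -/
def DD (α β : ℝ) : ℕ := ⌈|2 * α + 1|⌉₊ + ⌈|2 * β + 1|⌉₊
lemma DD_a (α β : ℝ) : |2 * α + 1| ≤ DD α β := by
  unfold DD; push_cast; have := Nat.le_ceil |2 * α + 1|
  have h2 : (0:ℝ) ≤ ⌈|2 * β + 1|⌉₊ := by positivity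
  linarith
lemma DD_b (α β : ℝ) : |2 * β + 1| ≤ DD α β := by
  unfold DD; push_cast; have := Nat.le_ceil |2 * β + 1|
  have h2 : (0:ℝ) ≤ ⌈|2 * α + 1|⌉₊ := by positivity
  linarith
lemma DD_ab (α β : ℝ) : |2 * α + 1| + |2 * β + 1| ≤ DD α β := by
  unfold DD; push_cast; have := Nat.le_ceil |2 * β + 1|
  have := Nat.le_ceil |2 * α + 1|
  linarith

lemma wt_dk (α β : ℝ) (hα : -1 < α) (hβ : -1 < β) : ∃ C : ℝ, 0 < C ∧
    ∀ N : ℕ, 2 * DD α β + 2 ≤ N → ∀ n : ℝ, 1 ≤ n → ∀ θ ∈ Icc 0 Real.pi,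
    ∫ τ in Ioo 0 Real.pi, dk N n (τ - θ) * wt α β τ ≤ C / n * mwn α β n θ := by
  obtain ⟨C0, hC0, H0⟩ := wt_comp α β
  obtain ⟨Ca, hCa, Ha⟩ := oneD (2 * α + 1) (by linarith) (DD α β) (DD_a α β)
  obtain ⟨Cb, hCb, Hb⟩ := oneD (2 * β + 1) (by linarith) (DD α β) (DD_b α β)
  obtain ⟨C1, hC1, H1⟩ := rpow_comp (2 * α + 1) (m := 1/2) (M := 1) (by norm_num) (by norm_num)
  obtain ⟨C2, hC2, H2⟩ := rpow_comp (2 * β + 1) (m := 1/2) (M := 1) (by norm_num) (by norm_num)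
  have hpi := Real.pi_gt_three
  refine ⟨C0 * C2 * Ca + C0 * C1 * Cb, by positivity, fun N hN n hn θ hθ => ?_⟩
  set D := DD α β
  have hn0 : 0 < n := by linarith
  have hθ0 := hθ.1
  have hθ1 : 0 ≤ Real.pi - θ := by linarith [hθ.2]
  have hinv : 1/n ≤ 1 := by rw [div_le_one hn0]; exact hn
  have hinv0 : 0 < 1/n := by positivity
  have hpw : ∀ τ ∈ Ioo 0 Real.pi, dk N n (τ - θ) * wt α β τ ≤
     C0 * C2 * (Real.pi - θ + 1/n) ^ (2 * β + 1) * (τ ^ (2 * α + 1) * dk (D+2) n (τ - θ)) +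
     C0 * C1 * (θ + 1/n) ^ (2 * α + 1) * ((Real.pi - τ) ^ (2 * β + 1) * dk (D+2) n (τ - θ)) := by
    intro τ hτ
    have hτ0 := hτ.1
    have hτ1 : 0 < Real.pi - τ := by linarith [hτ.2]
    have p := dk_pos N hn0 (d := τ - θ)
    have p2 := dk_pos (D+2) hn0 (d := τ - θ)
    have t1 : 0 ≤ C0 * C2 * (Real.pi - θ + 1/n) ^ (2 * β + 1) * (τ ^ (2 * α + 1) * dk (D+2) n (τ - θ)) := by positivity
    have t2 : 0 ≤ C0 * C1 * (θ + 1/n) ^ (2 * α + 1) * ((Real.pi - τ) ^ (2 * β + 1) * dk (D+2) n (τ - θ)) := by positivity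
    rcases le_total τ (Real.pi/2) with h3 | h3
    · have e1 := (H2 (Real.pi - τ) (Real.pi - τ + 1/n) hτ1 (by positivity) (by linarith) (by linarith)).1
      have e2 := peak (2 * β + 1) hn0 hτ1.le hθ1
      rw [show Real.pi - τ - (Real.pi - θ) = -(τ - θ) by ring, abs_neg] at e2
      have e3 := dk_split (K := D+2) (D := D) (N := N) (by omega) (d := τ - θ) (DD_b α β) hn0
      calc dk N n (τ - θ) * wt α β τ ≤ dk N n (τ - θ) * (C0 * mw α β τ) :=
            mul_le_mul_of_nonneg_left (H0 τ hτ).1 p.le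
        _ ≤ dk N n (τ - θ) * (C0 * (τ ^ (2 * α + 1) * (C2 * ((Real.pi - θ + 1/n) ^ (2 * β + 1) * (1 + n * |τ - θ|) ^ |2 * β + 1|)))) := by
            unfold mw
            gcongr
            exact e1.trans (by gcongr)
        _ = C0 * C2 * (Real.pi - θ + 1/n) ^ (2 * β + 1) * (τ ^ (2 * α + 1) * ((1 + n * |τ - θ|) ^ |2 * β + 1| * dk N n (τ - θ))) := by ring
        _ ≤ C0 * C2 * (Real.pi - θ + 1/n) ^ (2 * β + 1) * (τ ^ (2 * α + 1) * dk (D+2) n (τ - θ)) := by gcongr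
        _ ≤ _ := by linarith
    · have e1 := (H1 τ (τ + 1/n) hτ0 (by positivity) (by linarith) (by linarith)).1
      have e2 := peak (2 * α + 1) hn0 hτ0.le hθ0
      have e3 := dk_split (K := D+2) (D := D) (N := N) (by omega) (d := τ - θ) (DD_a α β) hn0
      calc dk N n (τ - θ) * wt α β τ ≤ dk N n (τ - θ) * (C0 * mw α β τ) :=
            mul_le_mul_of_nonneg_left (H0 τ hτ).1 p.le
        _ ≤ dk N n (τ - θ) * (C0 * ((C1 * ((θ + 1/n) ^ (2 * α + 1) * (1 + n * |τ - θ|) ^ |2 * α + 1|)) * (Real.pi - τ) ^ (2 * β + 1))) := by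
            unfold mw
            gcongr
            exact e1.trans (by gcongr)
        _ = C0 * C1 * (θ + 1/n) ^ (2 * α + 1) * ((Real.pi - τ) ^ (2 * β + 1) * ((1 + n * |τ - θ|) ^ |2 * α + 1| * dk N n (τ - θ))) := by ring
        _ ≤ C0 * C1 * (θ + 1/n) ^ (2 * α + 1) * ((Real.pi - τ) ^ (2 * β + 1) * dk (D+2) n (τ - θ)) := by gcongr
        _ ≤ _ := by linarith
  have gen : ∀ g : ℝ → ℝ, Measurable g → IntegrableOn g (Ioo 0 Real.pi) →
      IntegrableOn (fun τ => g τ * dk (D+2) n (τ - θ)) (Ioo 0 Real.pi) := by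
    intro g hg hi
    refine hi.norm.mono' (hg.mul (dk_cont' _ _ hn0).measurable).aestronglyMeasurable ?_
    refine Filter.Eventually.of_forall fun τ => ?_
    rw [norm_mul, Real.norm_of_nonneg (dk_pos _ hn0).le]
    exact mul_le_of_le_one_right (norm_nonneg _) (dk_le_one _ hn0)
  have i1 := (gen (fun τ => τ ^ (2 * α + 1)) (by fun_prop) (rpow_intOn _ (by linarith) _ Real.pi_pos.le)).const_mul
    (C0 * C2 * (Real.pi - θ + 1/n) ^ (2 * β + 1))
  have i2 := (gen (fun τ => (Real.pi - τ) ^ (2 * β + 1)) (by fun_prop) (rpow_intOn' _ (by linarith))).const_mul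
    (C0 * C1 * (θ + 1/n) ^ (2 * α + 1))
  have hb : ∫ τ in Ioo 0 Real.pi, (Real.pi - τ) ^ (2 * β + 1) * dk (D+2) n (τ - θ) ≤ Cb / n * (Real.pi - θ + 1/n) ^ (2 * β + 1) := by
    have := Hb n hn (Real.pi - θ) ⟨hθ1, by linarith⟩
    refine le_trans (le_of_eq ?_) this
    rw [← integral_Ioc_eq_integral_Ioo, ← intervalIntegral.integral_of_le Real.pi_pos.le,
      ← integral_Ioc_eq_integral_Ioo, ← intervalIntegral.integral_of_le Real.pi_pos.le]
    have := intervalIntegral.integral_comp_sub_left (a := 0) (b := Real.pi) (fun τ => τ ^ (2 * β + 1) * dk (D+2) n (τ - (Real.pi - θ))) Real.pi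
    rw [sub_zero, sub_self] at this
    rw [← this]
    congr 1; ext τ
    rw [show Real.pi - τ - (Real.pi - θ) = -(τ - θ) by ring, dk_neg]
  calc _ ≤ _ := setIntegral_mono_on (wt_dk_intOn α β hα hβ N hn0 θ) (i1.add i2) measurableSet_Ioo hpw
    _ = C0 * C2 * (Real.pi - θ + 1/n) ^ (2 * β + 1) * (∫ τ in Ioo 0 Real.pi, τ ^ (2 * α + 1) * dk (D+2) n (τ - θ)) +
     C0 * C1 * (θ + 1/n) ^ (2 * α + 1) * ∫ τ in Ioo 0 Real.pi, (Real.pi - τ) ^ (2 * β + 1) * dk (D+2) n (τ - θ) := by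
        refine (integral_add i1 i2).trans ?_
        rw [integral_const_mul, integral_const_mul]
    _ ≤ C0 * C2 * (Real.pi - θ + 1/n) ^ (2 * β + 1) * (Ca / n * (θ + 1/n) ^ (2 * α + 1)) +
     C0 * C1 * (θ + 1/n) ^ (2 * α + 1) * (Cb / n * (Real.pi - θ + 1/n) ^ (2 * β + 1)) := by
        have := Ha n hn θ hθ
        gcongr
    _ = _ := by unfold mwn; ring

/-- The measure `wt dτ` on `(0,π)`. -/
def nu (α β : ℝ) : Measure ℝ :=
  (volume.restrict (Ioo 0 Real.pi)).withDensity (fun τ => ENNReal.ofReal (wt α β τ))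

lemma nu_ae_mem (α β : ℝ) : ∀ᵐ τ ∂(nu α β), τ ∈ Ioo 0 Real.pi := by
  have : nu α β ≪ volume.restrict (Ioo 0 Real.pi) := withDensity_absolutelyContinuous _ _
  exact this.ae_le (ae_restrict_mem measurableSet_Ioo)

lemma wt_ofReal_meas (α β : ℝ) : Measurable (fun τ => ENNReal.ofReal (wt α β τ)) :=
  (wt_measurable α β).ennreal_ofReal

lemma nu_integral (α β : ℝ) (F : ℝ → ℝ) :
    ∫ τ, F τ ∂(nu α β) = ∫ τ in Ioo 0 Real.pi, F τ * wt α β τ := by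
  unfold nu
  rw [integral_withDensity_eq_integral_toReal_smul (wt_ofReal_meas α β)
    (Filter.Eventually.of_forall fun _ => ENNReal.ofReal_lt_top)]
  apply setIntegral_congr_fun measurableSet_Ioo
  intro τ hτ
  simp only [smul_eq_mul]
  rw [ENNReal.toReal_ofReal (wt_nonneg α β hτ), mul_comm]

lemma nu_integrable_iff (α β : ℝ) (F : ℝ → ℝ) :
    Integrable F (nu α β) ↔ IntegrableOn (fun τ => F τ * wt α β τ) (Ioo 0 Real.pi) := by
  unfold nu
  rw [integrable_withDensity_iff_integrable_smul' (wt_ofReal_meas α β)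
    (Filter.Eventually.of_forall fun _ => ENNReal.ofReal_lt_top)]
  apply integrableOn_congr_fun _ measurableSet_Ioo
  intro τ hτ
  simp only [smul_eq_mul]
  rw [ENNReal.toReal_ofReal (wt_nonneg α β hτ), mul_comm]

lemma nu_finite (α β : ℝ) (hα : -1 < α) (hβ : -1 < β) : IsFiniteMeasure (nu α β) := by
  have : Integrable (fun _ : ℝ => (1:ℝ)) (nu α β) := by
    rw [nu_integrable_iff]; simpa using wt_intOn α β hα hβ
  rw [integrable_const_iff] at this
  simpa using this

lemma bdd_int (α β : ℝ) (hα : -1 < α) (hβ : -1 < β) {F : ℝ → ℝ} (hF : Measurable F) {C : ℝ}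
    (h : ∀ τ ∈ Ioo 0 Real.pi, |F τ| ≤ C) : Integrable F (nu α β) := by
  have := nu_finite α β hα hβ
  refine Integrable.of_bound hF.aestronglyMeasurable C ?_
  filter_upwards [nu_ae_mem α β] with τ hτ
  exact h τ hτ

lemma cont_bdd {F : ℝ → ℝ} (hF : Continuous F) (a b : ℝ) : ∃ C, ∀ τ ∈ Icc a b, |F τ| ≤ C := by
  obtain ⟨C, hC⟩ := isCompact_Icc.exists_bound_of_continuousOn (s := Icc a b) (f := F) hF.continuousOn
  exact ⟨C, fun τ h => hC τ h⟩

lemma cont_int (α β : ℝ) (hα : -1 < α) (hβ : -1 < β) {F : ℝ → ℝ} (hF : Continuous F) :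
    Integrable F (nu α β) := by
  obtain ⟨C, hC⟩ := cont_bdd hF 0 Real.pi
  exact bdd_int α β hα hβ hF.measurable (fun τ h => hC τ ⟨h.1.le, h.2.le⟩)

lemma cos_image : Real.cos '' Ioo 0 Real.pi = Ioo (-1) 1 := by
  ext x; constructor
  · rintro ⟨τ, hτ, rfl⟩
    exact ⟨by linarith [one_add_cos_pos hτ], by linarith [one_sub_cos_pos hτ]⟩
  · intro h
    refine ⟨Real.arccos x, ⟨Real.arccos_pos.2 h.2, ?_⟩, Real.cos_arccos h.1.le h.2.le⟩
    refine lt_of_le_of_ne (Real.arccos_le_pi x) ?_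
    intro h2; rw [Real.arccos_eq_pi] at h2; linarith [h.1]

lemma cov (α β : ℝ) (F : ℝ → ℝ) :
    ∫ x in Ioo (-1) 1, F x * w α β x = ∫ τ, F (Real.cos τ) ∂(nu α β) := by
  rw [nu_integral, ← cos_image, integral_image_eq_integral_abs_deriv_smul (f' := fun τ => -Real.sin τ) measurableSet_Ioo
    (fun x _ => (Real.hasDerivAt_cos x).hasDerivWithinAt)
    (Real.injOn_cos.mono Ioo_subset_Icc_self)]
  apply setIntegral_congr_fun measurableSet_Ioo
  intro τ hτ
  have := Real.sin_pos_of_mem_Ioo hτ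
  simp only [smul_eq_mul]
  rw [abs_neg, abs_of_pos this]; unfold wt; ring

lemma cov_int (α β : ℝ) (F : ℝ → ℝ) :
    IntegrableOn (fun x => F x * w α β x) (Ioo (-1) 1) ↔ Integrable (fun τ => F (Real.cos τ)) (nu α β) := by
  rw [nu_integrable_iff, ← cos_image, integrableOn_image_iff_integrableOn_abs_deriv_smul (f' := fun τ => -Real.sin τ) measurableSet_Ioo
    (fun x _ => (Real.hasDerivAt_cos x).hasDerivWithinAt)
    (Real.injOn_cos.mono Ioo_subset_Icc_self)]
  apply integrableOn_congr_fun _ measurableSet_Ioo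
  intro τ hτ
  have := Real.sin_pos_of_mem_Ioo hτ
  simp only [smul_eq_mul]
  rw [abs_neg, abs_of_pos this]; unfold wt; ring

lemma ip_eq (α β : ℝ) (f g : ℝ → ℝ) : ip α β f g = ∫ τ, f (Real.cos τ) * g (Real.cos τ) ∂(nu α β) :=
  cov α β (fun x => f x * g x)

lemma nu_pos_open (α β : ℝ) {U : Set ℝ} (hU : IsOpen U) (hne : (U ∩ Ioo 0 Real.pi).Nonempty) :
    nu α β U ≠ 0 := by
  intro h
  unfold nu at h
  rw [withDensity_apply_eq_zero' (wt_ofReal_meas α β).aemeasurable] at h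
  have h2 : (volume.restrict (Ioo 0 Real.pi)) (U ∩ Ioo 0 Real.pi) = 0 := by
    refine measure_mono_null ?_ h
    intro x hx
    refine ⟨?_, hx.1⟩
    simp [wt_pos α β hx.2]
  rw [Measure.restrict_apply (hU.inter isOpen_Ioo).measurableSet, inter_assoc, inter_self] at h2
  exact ((hU.inter isOpen_Ioo).measure_pos volume hne).ne' h2

lemma cont_memLp (α β : ℝ) (hα : -1 < α) (hβ : -1 < β) {F : ℝ → ℝ} (hF : Continuous F) (p : ℝ≥0∞) :
    MemLp F p (nu α β) := by
  have := nu_finite α β hα hβ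
  obtain ⟨C, hC⟩ := cont_bdd hF 0 Real.pi
  refine MemLp.of_bound hF.aestronglyMeasurable C ?_
  filter_upwards [nu_ae_mem α β] with τ hτ
  exact hC τ ⟨hτ.1.le, hτ.2.le⟩

lemma ae_le_imp_le (α β : ℝ) {F : ℝ → ℝ} (hF : Continuous F) {C : ℝ}
    (h : ∀ᵐ τ ∂(nu α β), |F τ| ≤ C) : ∀ τ ∈ Icc 0 Real.pi, |F τ| ≤ C := by
  have h1 : ∀ τ ∈ Ioo 0 Real.pi, |F τ| ≤ C := by
    intro τ hτ
    by_contra hc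
    push Not at hc
    have hU : IsOpen {τ | C < |F τ|} := isOpen_lt continuous_const hF.abs
    refine nu_pos_open α β hU ⟨τ, hc, hτ⟩ ?_
    rw [ae_iff] at h
    simpa using h
  intro τ hτ
  rw [← closure_Ioo Real.pi_pos.ne] at hτ
  exact le_on_closure (f := fun τ => |F τ|) (g := fun _ => C) h1 hF.abs.continuousOn continuousOn_const hτ

lemma LpW_eq (α β : ℝ) (hα : -1 < α) (hβ : -1 < β) (p : ℝ≥0∞) (hp : 1 ≤ p) {f : ℝ → ℝ} (hf : Continuous f) :
    LpW α β p f = (eLpNorm (fun τ => f (Real.cos τ)) p (nu α β)).toReal := by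
  have hF : Continuous (fun τ => f (Real.cos τ)) := hf.comp Real.continuous_cos
  have hm := cont_memLp α β hα hβ hF p
  unfold LpW
  split_ifs with h
  · subst h
    set F := fun τ => f (Real.cos τ)
    have hsup : ∀ τ ∈ Icc 0 Real.pi, |F τ| ≤ (eLpNorm F ⊤ (nu α β)).toReal := by
      apply ae_le_imp_le α β hF
      filter_upwards [ae_le_eLpNormEssSup (f := F) (μ := nu α β)] with τ hτ
      rw [eLpNorm_exponent_top]
      rw [← Real.norm_eq_abs, ← toReal_enorm]
      apply ENNReal.toReal_mono _ hτ
      rw [← eLpNorm_exponent_top]; exact hm.eLpNorm_ne_top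
    obtain ⟨C0, hC0⟩ := cont_bdd hf (-1) 1
    have hbdd : BddAbove ((fun x => |f x|) '' Icc (-1 : ℝ) 1) := ⟨C0, by rintro _ ⟨x, hx, rfl⟩; exact hC0 x hx⟩
    apply le_antisymm
    · apply csSup_le ((nonempty_Icc.2 (by norm_num)).image _)
      rintro _ ⟨x, hx, rfl⟩
      have := hsup (Real.arccos x) ⟨Real.arccos_nonneg x, Real.arccos_le_pi x⟩
      simp only [F] at this
      rwa [Real.cos_arccos hx.1 hx.2] at this
    · apply ENNReal.toReal_le_of_le_ofReal
      · apply Real.sSup_nonneg; rintro _ ⟨x, hx, rfl⟩; exact abs_nonneg _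
      · rw [eLpNorm_exponent_top]
        apply eLpNormEssSup_le_of_ae_bound
        refine Filter.Eventually.of_forall fun τ => ?_
        exact le_csSup hbdd ⟨Real.cos τ, Real.cos_mem_Icc τ, rfl⟩
  · rw [hm.eLpNorm_eq_integral_rpow_norm (by intro h0; simp [h0] at hp) h]
    rw [ENNReal.toReal_ofReal (by positivity), cov, one_div]
    rfl

open Polynomial in
/-- `z = (1-X)/2` -/
def zP : Polynomial ℝ := C (1/2) * (1 - X)

lemma zP_eval (x : ℝ) : zP.eval x = (1 - x)/2 := by simp [zP]; ring

lemma zP_deriv : Polynomial.derivative zP = Polynomial.C (-1/2) := by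
  simp only [zP, Polynomial.derivative_C_mul, Polynomial.derivative_sub, Polynomial.derivative_one, Polynomial.derivative_X]
  rw [zero_sub, mul_neg, mul_one, ← Polynomial.C_neg]; norm_num

lemma zP_X : (Polynomial.X : Polynomial ℝ) = 1 - 2 * zP := by
  have : (2 : Polynomial ℝ) = Polynomial.C 2 := rfl
  simp only [zP, this, ← mul_assoc, ← Polynomial.C_mul]; norm_num

lemma zP_natDegree : zP.natDegree ≤ 1 := by
  unfold zP
  refine (Polynomial.natDegree_C_mul_le _ _).trans ?_
  refine (Polynomial.natDegree_sub_le _ _).trans ?_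
  simp

/-- Jacobi differential operator -/
def LP (α β : ℝ) (P : Polynomial ℝ) : Polynomial ℝ :=
  -((1 - Polynomial.X ^ 2) * Polynomial.derivative (Polynomial.derivative P)) -
    (Polynomial.C (β - α) - Polynomial.C (α + β + 2) * Polynomial.X) * Polynomial.derivative P

lemma LP_add (α β : ℝ) (P Q : Polynomial ℝ) : LP α β (P + Q) = LP α β P + LP α β Q := by
  unfold LP; simp only [Polynomial.derivative_add]; ring
lemma LP_C_mul (α β c : ℝ) (P : Polynomial ℝ) : LP α β (Polynomial.C c * P) = Polynomial.C c * LP α β P := by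
  unfold LP; simp only [Polynomial.derivative_C_mul]; ring
lemma LP_zero (α β : ℝ) : LP α β 0 = 0 := by unfold LP; simp
lemma LP_sum (α β : ℝ) {ι : Type*} (s : Finset ι) (f : ι → Polynomial ℝ) :
    LP α β (∑ i ∈ s, f i) = ∑ i ∈ s, LP α β (f i) := by
  classical
  induction s using Finset.induction_on with
  | empty => simp [LP_zero]
  | insert a s ha ih => rw [Finset.sum_insert ha, Finset.sum_insert ha, LP_add, ih]

lemma LP_zpow (α β : ℝ) (j : ℕ) : LP α β (zP ^ j) =
    Polynomial.C ((j:ℝ) * (j + (α + β + 1))) * zP ^ j - Polynomial.C ((j:ℝ) * (j + α)) * zP ^ (j - 1) := by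
  apply Polynomial.funext
  intro x
  rcases j with _ | _ | j
  · simp [LP]
  · simp only [LP, zero_add, pow_one, zP_deriv, Polynomial.derivative_C]
    simp [zP_eval]; ring
  · simp only [LP, Polynomial.derivative_pow, zP_deriv, Polynomial.derivative_mul, Polynomial.derivative_C]
    simp [zP_eval]; ring

/-- hypergeometric coefficients -/
def hc (α β : ℝ) (n k : ℕ) : ℝ := poch (-(n : ℝ)) k * poch ((n : ℝ) + α + β + 1) k /
        (poch (α + 1) k * k.factorial)

lemma poch_succ (a : ℝ) (k : ℕ) : poch a (k+1) = poch a k * (a + k) := by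
  unfold poch; rw [Finset.prod_range_succ]
lemma poch_pos {a : ℝ} (ha : 0 < a) (k : ℕ) : 0 < poch a k := by
  unfold poch; exact Finset.prod_pos fun i _ => by positivity

lemma hc_succ (α β : ℝ) (hα : -1 < α) (n j : ℕ) :
    hc α β n (j+1) * ((j+1 : ℝ) * (j + 1 + α)) = hc α β n j * ((-(n:ℝ) + j) * (n + α + β + 1 + j)) := by
  unfold hc
  have h1 := poch_pos (a := α + 1) (by linarith) j
  have h2 : 0 < α + 1 + j := by have : (0:ℝ) ≤ j := by positivity
                                linarith
  have h3 : (0:ℝ) < j.factorial := by positivity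
  rw [poch_succ, poch_succ, poch_succ, Nat.factorial_succ]
  push_cast
  field_simp
  ring

lemma poch_neg_self (n : ℕ) : poch (-(n:ℝ)) (n+1) = 0 := by
  rw [poch_succ]; simp

/-- Jacobi polynomial as a polynomial -/
def JPol (α β : ℝ) (n : ℕ) : Polynomial ℝ :=
  Polynomial.C (2 ^ n / poch ((n : ℝ) + α + β + 1) n * (poch (α + 1) n / n.factorial)) *
    ∑ k ∈ Finset.range (n+1), Polynomial.C (hc α β n k) * zP ^ k

lemma JPol_eval (α β : ℝ) (n : ℕ) (x : ℝ) : (JPol α β n).eval x = J α β n x := by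
  unfold JPol J JP hc
  simp only [Polynomial.eval_mul, Polynomial.eval_C, Polynomial.eval_finsetSum, Polynomial.eval_pow, zP_eval]
  ring

lemma JPol_natDegree (α β : ℝ) (n : ℕ) : (JPol α β n).natDegree ≤ n := by
  unfold JPol
  refine (Polynomial.natDegree_C_mul_le _ _).trans ?_
  refine Polynomial.natDegree_sum_le_of_forall_le _ _ fun i hi => ?_
  refine (Polynomial.natDegree_C_mul_le _ _).trans ?_
  refine (Polynomial.natDegree_pow_le).trans ?_
  have := zP_natDegree
  have := Finset.mem_range.1 hi
  nlinarith

lemma LP_JPol (α β : ℝ) (hα : -1 < α) (n : ℕ) :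
    LP α β (JPol α β n) = Polynomial.C ((n:ℝ) * (n + (α + β + 1))) * JPol α β n := by
  unfold JPol
  rw [LP_C_mul, mul_left_comm]
  congr 1
  rw [LP_sum]
  simp only [LP_C_mul, LP_zpow]
  simp only [mul_sub, Finset.sum_sub_distrib]
  rw [Finset.sum_range_succ' (fun k => Polynomial.C (hc α β n k) * (Polynomial.C ((k:ℝ) * (k + α)) * zP ^ (k - 1)))]
  simp only [Nat.cast_zero, zero_mul, Polynomial.C_0, mul_zero, add_zero, Nat.add_sub_cancel]
  have e : ∑ k ∈ Finset.range n, Polynomial.C (hc α β n (k + 1)) * (Polynomial.C (((k+1:ℕ):ℝ) * (((k + 1 : ℕ):ℝ) + α)) * zP ^ k)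
     = ∑ k ∈ Finset.range (n+1), Polynomial.C (hc α β n k * ((-(n:ℝ) + k) * (n + α + β + 1 + k))) * zP ^ k := by
    rw [Finset.sum_range_succ]
    simp only [neg_add_cancel, zero_mul, mul_zero, Polynomial.C_0, add_zero]
    refine Finset.sum_congr rfl fun k _ => ?_
    rw [← hc_succ α β hα, ← mul_assoc, ← Polynomial.C_mul]
    push_cast; rfl
  rw [e, ← Finset.sum_sub_distrib, Finset.mul_sum]
  refine Finset.sum_congr rfl fun k _ => ?_
  simp only [← mul_assoc, ← Polynomial.C_mul]
  rw [← sub_mul, ← Polynomial.C_sub]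
  congr 2; ring

/-- leading coefficient in z -/
lemma JPol_lead (α β : ℝ) (hα : -1 < α) (hβ : -1 < β) (n : ℕ) :
   2 ^ n / poch ((n : ℝ) + α + β + 1) n * (poch (α + 1) n / n.factorial) ≠ 0 ∧ hc α β n n ≠ 0 := by
  have h1 := poch_pos (a := α + 1) (by linarith) n
  have h2 : 0 < poch ((n:ℝ) + α + β + 1) n := by
    rcases n with _ | n
    · simp [poch]
    · apply poch_pos
      have : (0:ℝ) ≤ n := by positivity
      push_cast; linarith
  have h3 : poch (-(n:ℝ)) n ≠ 0 := by
    unfold poch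
    rw [Finset.prod_ne_zero_iff]
    intro i hi
    have : (i:ℝ) < n := by exact_mod_cast Finset.mem_range.1 hi
    linarith
  constructor
  · positivity
  · unfold hc
    have : poch (α + 1) n * n.factorial ≠ 0 := by positivity
    exact div_ne_zero (mul_ne_zero h3 h2.ne') this

/-- span of the first Jacobi polynomials -/
def JSpan (α β : ℝ) (m : ℕ) : Submodule ℝ (Polynomial ℝ) := Submodule.span ℝ (JPol α β '' {k | k ≤ m})

lemma zpow_mem (α β : ℝ) (hα : -1 < α) (hβ : -1 < β) (m : ℕ) : ∀ j, j ≤ m → zP ^ j ∈ JSpan α β m := by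
  intro j
  induction j using Nat.strong_induction_on with
  | _ j ih =>
  intro hj
  obtain ⟨h1, h2⟩ := JPol_lead α β hα hβ j
  have hJ : JPol α β j ∈ JSpan α β m := Submodule.subset_span ⟨j, hj, rfl⟩
  unfold JPol at hJ
  rw [Finset.sum_range_succ] at hJ
  simp only [← Polynomial.smul_eq_C_mul] at hJ
  rw [Submodule.smul_mem_iff _ h1] at hJ
  have h3 : ∑ x ∈ Finset.range j, hc α β j x • zP ^ x ∈ JSpan α β m :=
    Submodule.sum_mem _ fun i hi => Submodule.smul_mem _ _ (ih i (Finset.mem_range.1 hi) (by have := Finset.mem_range.1 hi; omega))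
  rw [Submodule.add_mem_iff_right _ h3, Submodule.smul_mem_iff _ h2] at hJ
  exact hJ

lemma poly_mem (α β : ℝ) (hα : -1 < α) (hβ : -1 < β) (m : ℕ) (P : Polynomial ℝ) (hP : P.natDegree ≤ m) :
    P ∈ JSpan α β m := by
  have e : P = (P.comp (1 - 2 * Polynomial.X)).comp zP := by
    rw [Polynomial.comp_assoc]
    have : (1 - 2 * Polynomial.X : Polynomial ℝ).comp zP = Polynomial.X := by
      simp only [Polynomial.sub_comp, Polynomial.one_comp, Polynomial.mul_comp, Polynomial.ofNat_comp, Polynomial.X_comp]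
      exact zP_X.symm
    rw [this, Polynomial.comp_X]
  rw [e, Polynomial.comp_eq_sum_left, Polynomial.sum_over_range' _ (by simp) (m+1)]
  · refine Submodule.sum_mem _ fun i hi => ?_
    rw [← Polynomial.smul_eq_C_mul]
    exact Submodule.smul_mem _ _ (zpow_mem α β hα hβ m i (by have := Finset.mem_range.1 hi; omega))
  · rw [Nat.lt_succ_iff]
    refine Polynomial.natDegree_comp_le.trans ?_
    have : (1 - 2 * Polynomial.X : Polynomial ℝ).natDegree ≤ 1 := by
      refine (Polynomial.natDegree_sub_le _ _).trans ?_
      have : (2 : Polynomial ℝ) = Polynomial.C 2 := rfl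
      rw [this]
      simp
    nlinarith

/-- composition with cos -/
lemma pc_cont (P : Polynomial ℝ) : Continuous (fun τ => P.eval (Real.cos τ)) :=
  P.continuous.comp Real.continuous_cos

lemma pc_deriv (P : Polynomial ℝ) (τ : ℝ) : HasDerivAt (fun τ => P.eval (Real.cos τ))
    (-(Real.sin τ * (Polynomial.derivative P).eval (Real.cos τ))) τ := by
  have := (P.hasDerivAt (Real.cos τ)).comp τ (Real.hasDerivAt_cos τ)
  exact this.congr_deriv (by ring)

lemma phi_deriv (α β : ℝ) (P : Polynomial ℝ) {τ : ℝ} (hτ : τ ∈ Ioo 0 Real.pi) :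
    HasDerivAt (fun τ => (1 - Real.cos τ) ^ (α + 1) * (1 + Real.cos τ) ^ (β + 1) * (Polynomial.derivative P).eval (Real.cos τ))
     ((LP α β P).eval (Real.cos τ) * wt α β τ) τ := by
  have h1 := one_sub_cos_pos hτ
  have h2 := one_add_cos_pos hτ
  have d1 : HasDerivAt (fun τ => 1 - Real.cos τ) (Real.sin τ) τ := by
    simpa using (Real.hasDerivAt_cos τ).const_sub 1
  have d2 : HasDerivAt (fun τ => 1 + Real.cos τ) (-Real.sin τ) τ := by
    simpa using (Real.hasDerivAt_cos τ).const_add 1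
  have d3 := (d1.rpow_const (p := α + 1) (Or.inl h1.ne')).mul (d2.rpow_const (p := β + 1) (Or.inl h2.ne'))
  have d4 := d3.mul (pc_deriv (Polynomial.derivative P) τ)
  refine d4.congr_deriv ?_
  simp only [Pi.mul_apply]
  unfold LP wt w
  rw [Real.rpow_add h1, Real.rpow_add h2, Real.rpow_one, Real.rpow_one]
  simp only [add_sub_cancel_right, Polynomial.eval_sub, Polynomial.eval_neg, Polynomial.eval_mul, Polynomial.eval_one, Polynomial.eval_pow, Polynomial.eval_X, Polynomial.eval_C]
  ring

lemma ibp (α β : ℝ) (hα : -1 < α) (hβ : -1 < β) (P : Polynomial ℝ) (v v' : ℝ → ℝ)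
    (hv : ∀ τ, HasDerivAt v (v' τ) τ) (hv' : Continuous v') :
    ∫ τ, (LP α β P).eval (Real.cos τ) * v τ ∂(nu α β) =
      - ∫ τ, Real.sin τ * (Polynomial.derivative P).eval (Real.cos τ) * v' τ ∂(nu α β) := by
  have hvc : Continuous v := continuous_iff_continuousAt.2 fun τ => (hv τ).continuousAt
  have i1 : Integrable (fun τ => (LP α β P).eval (Real.cos τ) * v τ) (nu α β) :=
    cont_int α β hα hβ ((pc_cont _).mul hvc)
  have i2 : Integrable (fun τ => Real.sin τ * (Polynomial.derivative P).eval (Real.cos τ) * v' τ) (nu α β) :=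
    cont_int α β hα hβ ((Real.continuous_sin.mul (pc_cont _)).mul hv')
  rw [eq_neg_iff_add_eq_zero, ← integral_add i1 i2, nu_integral]
  have i3 := (nu_integrable_iff _ _ _).1 (i1.add i2)
  rw [← integral_Ioc_eq_integral_Ioo, ← intervalIntegral.integral_of_le Real.pi_pos.le]
  have key := intervalIntegral.integral_eq_sub_of_hasDerivAt_of_le Real.pi_pos.le
    (f := fun τ => (1 - Real.cos τ) ^ (α + 1) * (1 + Real.cos τ) ^ (β + 1) * (Polynomial.derivative P).eval (Real.cos τ) * v τ)
    (f' := fun τ => ((LP α β P).eval (Real.cos τ) * v τ + Real.sin τ * (Polynomial.derivative P).eval (Real.cos τ) * v' τ) * wt α β τ)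
    ?_ ?_ ?_
  · rw [key]
    simp [Real.zero_rpow (show α + 1 ≠ 0 by linarith), Real.zero_rpow (show β + 1 ≠ 0 by linarith)]
  · apply Continuous.continuousOn
    refine Continuous.mul (Continuous.mul (Continuous.mul ?_ ?_) (pc_cont _)) hvc
    · exact Continuous.rpow_const (by fun_prop) (fun x => Or.inr (by linarith))
    · exact Continuous.rpow_const (by fun_prop) (fun x => Or.inr (by linarith))
  · intro τ hτ
    refine ((phi_deriv α β P hτ).mul (hv τ)).congr_deriv ?_
    have h1 := one_sub_cos_pos hτ
    have h2 := one_add_cos_pos hτ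
    have : (1 - Real.cos τ) ^ (α + 1) * (1 + Real.cos τ) ^ (β + 1) = Real.sin τ * wt α β τ := by
      unfold wt w
      rw [Real.rpow_add h1, Real.rpow_add h2, Real.rpow_one, Real.rpow_one]
      have : Real.sin τ * Real.sin τ = (1 - Real.cos τ) * (1 + Real.cos τ) := by
        nlinarith [Real.sin_sq_add_cos_sq τ]
      linear_combination (-(1 - Real.cos τ) ^ α * (1 + Real.cos τ) ^ β) * this
    rw [this]; ring
  · rw [intervalIntegrable_iff_integrableOn_Ioo_of_le Real.pi_pos.le]
    exact i3

/-- polynomial inner product -/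
def pip (α β : ℝ) (P Q : Polynomial ℝ) : ℝ := ∫ τ, P.eval (Real.cos τ) * Q.eval (Real.cos τ) ∂(nu α β)

lemma pip_symm (α β : ℝ) (P Q : Polynomial ℝ) : pip α β P Q = pip α β Q P := by
  unfold pip; congr 1; ext; ring

lemma LP_symm (α β : ℝ) (hα : -1 < α) (hβ : -1 < β) (P Q : Polynomial ℝ) :
    pip α β (LP α β P) Q = pip α β P (LP α β Q) := by
  have e : ∀ P Q : Polynomial ℝ, pip α β (LP α β P) Q = ∫ τ, Real.sin τ ^ 2 * (Polynomial.derivative P).eval (Real.cos τ) *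
     (Polynomial.derivative Q).eval (Real.cos τ) ∂(nu α β) := by
    intro P Q
    unfold pip
    rw [ibp α β hα hβ P _ _ (fun τ => pc_deriv Q τ) ((Real.continuous_sin.mul (pc_cont _)).neg), ← integral_neg]
    congr 1; ext τ; ring
  rw [e, pip_symm, e]
  congr 1; ext τ; ring

lemma pip_C_mul (α β c : ℝ) (P Q : Polynomial ℝ) : pip α β (Polynomial.C c * P) Q = c * pip α β P Q := by
  unfold pip; rw [← integral_const_mul]; congr 1; ext τ; simp; ring

lemma JPol_orth (α β : ℝ) (hα : -1 < α) (hβ : -1 < β) {k l : ℕ} (h : k ≠ l) :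
    pip α β (JPol α β k) (JPol α β l) = 0 := by
  have := LP_symm α β hα hβ (JPol α β k) (JPol α β l)
  rw [LP_JPol α β hα, LP_JPol α β hα, pip_C_mul, pip_symm α β _ (_ * _), pip_C_mul, pip_symm α β _ (JPol α β k)] at this
  have h2 : ((k:ℝ) * (k + (α + β + 1)) - l * (l + (α + β + 1))) ≠ 0 := by
    have e : ((k:ℝ) * (k + (α + β + 1)) - l * (l + (α + β + 1))) = (k - l) * (k + l + (α + β + 1)) := by ring
    rw [e]
    apply mul_ne_zero
    · rw [sub_ne_zero]; exact_mod_cast h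
    · have : (1:ℝ) ≤ k + l := by
        have : 1 ≤ k + l := by omega
        exact_mod_cast this
      linarith
  have h3 : ((k:ℝ) * (k + (α + β + 1)) - l * (l + (α + β + 1))) * pip α β (JPol α β k) (JPol α β l) = 0 := by linarith
  exact (mul_eq_zero.1 h3).resolve_left h2

lemma pip_self_pos (α β : ℝ) (hα : -1 < α) (hβ : -1 < β) {P : Polynomial ℝ} (hP : P ≠ 0) : 0 < pip α β P P := by
  have hi : Integrable (fun τ => P.eval (Real.cos τ) * P.eval (Real.cos τ)) (nu α β) :=
    cont_int α β hα hβ ((pc_cont P).mul (pc_cont P))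
  unfold pip
  refine lt_of_le_of_ne (integral_nonneg fun τ => mul_self_nonneg _) ?_
  intro h
  have h := (integral_eq_zero_iff_of_nonneg (fun τ => mul_self_nonneg _) hi).1 h.symm
  have h2 : ∀ τ ∈ Icc 0 Real.pi, |P.eval (Real.cos τ)| ≤ 0 := by
    apply ae_le_imp_le α β (pc_cont P)
    filter_upwards [h] with τ hτ
    simpa using hτ
  apply hP
  apply Polynomial.eq_zero_of_infinite_isRoot
  refine (Icc_infinite (show (-1:ℝ) < 1 by norm_num)).mono ?_
  intro x hx
  have := h2 (Real.arccos x) ⟨Real.arccos_nonneg x, Real.arccos_le_pi x⟩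
  rw [Real.cos_arccos hx.1 hx.2] at this
  simpa using this

lemma JPol_ne (α β : ℝ) (hα : -1 < α) (hβ : -1 < β) (k : ℕ) : JPol α β k ≠ 0 := by
  intro h
  obtain ⟨h1, h2⟩ := JPol_lead α β hα hβ k
  unfold JPol at h
  rw [← Polynomial.smul_eq_C_mul, smul_eq_zero_iff_right h1, Finset.sum_range_succ] at h
  have h3 := congrArg (fun p => p.coeff k) h
  simp only [Polynomial.coeff_add, Polynomial.finsetSum_coeff, Polynomial.coeff_C_mul, Polynomial.coeff_zero] at h3
  rw [Finset.sum_eq_zero] at h3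
  · rw [zero_add] at h3
    have : (zP ^ k).coeff k ≠ 0 := by
      have hz : zP.coeff 1 = -1/2 := by
        simp [zP, Polynomial.coeff_one]; norm_num
      have := Polynomial.coeff_pow_of_natDegree_le (m := k) zP_natDegree
      rw [mul_one] at this
      rw [this, hz]
      apply pow_ne_zero; norm_num
    exact mul_ne_zero h2 this h3
  · intro i hi
    have hi := Finset.mem_range.1 hi
    rw [Polynomial.coeff_eq_zero_of_natDegree_lt, mul_zero]
    refine lt_of_le_of_lt (Polynomial.natDegree_pow_le) ?_
    have := zP_natDegree
    nlinarith

lemma hJ_eq (α β : ℝ) (k : ℕ) : hJ α β k = pip α β (JPol α β k) (JPol α β k) := by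
  unfold hJ pip; rw [ip_eq]; simp only [JPol_eval]

lemma hJ_pos (α β : ℝ) (hα : -1 < α) (hβ : -1 < β) (k : ℕ) : 0 < hJ α β k := by
  rw [hJ_eq]; exact pip_self_pos α β hα hβ (JPol_ne α β hα hβ k)

lemma J_cont (α β : ℝ) (k : ℕ) : Continuous (J α β k) := by
  have : J α β k = fun x => (JPol α β k).eval x := by ext x; rw [JPol_eval]
  rw [this]; exact (JPol α β k).continuous

/-- `V` as a polynomial -/
def Vpol (η : ℝ → ℝ) (α β : ℝ) (n : ℕ) (f : ℝ → ℝ) : Polynomial ℝ :=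
  ∑ k ∈ Finset.range (2 * n + 1), Polynomial.C (η ((k : ℝ) / (n : ℝ)) * coeff α β k f) * JPol α β k

lemma Vpol_eval (η : ℝ → ℝ) (α β : ℝ) (n : ℕ) (f : ℝ → ℝ) (x : ℝ) :
    (Vpol η α β n f).eval x = V η α β n f x := by
  unfold Vpol V
  simp only [Polynomial.eval_finsetSum, Polynomial.eval_mul, Polynomial.eval_C, JPol_eval]

lemma Vpol_natDegree (η : ℝ → ℝ) (α β : ℝ) (n : ℕ) (f : ℝ → ℝ) : (Vpol η α β n f).natDegree ≤ 2 * n := by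
  unfold Vpol
  refine Polynomial.natDegree_sum_le_of_forall_le _ _ fun i hi => ?_
  refine (Polynomial.natDegree_C_mul_le _ _).trans ?_
  refine (JPol_natDegree α β i).trans ?_
  have := Finset.mem_range.1 hi
  omega

lemma V_cont (η : ℝ → ℝ) (α β : ℝ) (n : ℕ) (f : ℝ → ℝ) : Continuous (V η α β n f) := by
  have : V η α β n f = fun x => (Vpol η α β n f).eval x := by ext x; rw [Vpol_eval]
  rw [this]; exact (Vpol η α β n f).continuous

lemma ip_int (α β : ℝ) (hα : -1 < α) (hβ : -1 < β) {f g : ℝ → ℝ} (hf : Continuous f) (hg : Continuous g) :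
    Integrable (fun τ => f (Real.cos τ) * g (Real.cos τ)) (nu α β) :=
  cont_int α β hα hβ ((hf.comp Real.continuous_cos).mul (hg.comp Real.continuous_cos))

lemma ip_symm (α β : ℝ) (f g : ℝ → ℝ) : ip α β f g = ip α β g f := by
  unfold ip; congr 1; ext; ring

lemma ip_add (α β : ℝ) (hα : -1 < α) (hβ : -1 < β) {f g h : ℝ → ℝ} (hf : Continuous f) (hg : Continuous g) (hh : Continuous h) :
    ip α β (fun x => f x + g x) h = ip α β f h + ip α β g h := by
  simp only [ip_eq]
  rw [← integral_add (ip_int α β hα hβ hf hh) (ip_int α β hα hβ hg hh)]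
  congr 1; ext; ring

lemma ip_smul (α β c : ℝ) (f h : ℝ → ℝ) :
    ip α β (fun x => c * f x) h = c * ip α β f h := by
  simp only [ip_eq]
  rw [← integral_const_mul]
  congr 1; ext; ring

lemma coeff_add (α β : ℝ) (hα : -1 < α) (hβ : -1 < β) {f g : ℝ → ℝ} (hf : Continuous f) (hg : Continuous g) (k : ℕ) :
    coeff α β k (fun x => f x + g x) = coeff α β k f + coeff α β k g := by
  unfold coeff; rw [ip_add α β hα hβ hf hg (J_cont α β k)]; ring

lemma coeff_smul (α β c : ℝ) (f : ℝ → ℝ) (k : ℕ) :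
    coeff α β k (fun x => c * f x) = c * coeff α β k f := by
  unfold coeff; rw [ip_smul]; ring

lemma V_add (η : ℝ → ℝ) (α β : ℝ) (hα : -1 < α) (hβ : -1 < β) (n : ℕ) {f g : ℝ → ℝ} (hf : Continuous f) (hg : Continuous g) (x : ℝ) :
    V η α β n (fun x => f x + g x) x = V η α β n f x + V η α β n g x := by
  unfold V; rw [← Finset.sum_add_distrib]
  refine Finset.sum_congr rfl fun k _ => ?_
  rw [coeff_add α β hα hβ hf hg]; ring

lemma V_smul (η : ℝ → ℝ) (α β : ℝ) (n : ℕ) (c : ℝ) (f : ℝ → ℝ) (x : ℝ) :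
    V η α β n (fun x => c * f x) x = c * V η α β n f x := by
  unfold V; rw [Finset.mul_sum]
  refine Finset.sum_congr rfl fun k _ => ?_
  rw [coeff_smul]; ring

lemma V_sub (η : ℝ → ℝ) (α β : ℝ) (hα : -1 < α) (hβ : -1 < β) (n : ℕ) {f g : ℝ → ℝ} (hf : Continuous f) (hg : Continuous g) (x : ℝ) :
    V η α β n (fun x => f x - g x) x = V η α β n f x - V η α β n g x := by
  have : (fun x => f x - g x) = fun x => f x + (fun x => (-1) * g x) x := by ext; ring
  rw [this, V_add η α β hα hβ n hf (by fun_prop), V_smul]; ring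

lemma ip_V (η : ℝ → ℝ) (α β : ℝ) (hα : -1 < α) (hβ : -1 < β) (n : ℕ) (f : ℝ → ℝ) {g : ℝ → ℝ} (hg : Continuous g) :
    ip α β (V η α β n f) g = ∑ k ∈ Finset.range (2 * n + 1), η ((k : ℝ) / (n : ℝ)) * coeff α β k f * ip α β g (J α β k) := by
  rw [ip_eq]
  unfold V
  simp only [Finset.sum_mul]
  rw [integral_finsetSum]
  · refine Finset.sum_congr rfl fun k _ => ?_
    rw [ip_symm, ip_eq, ← integral_const_mul]
    congr 1; ext; ring
  · intro k _
    exact cont_int α β hα hβ (((((J_cont α β k).comp Real.continuous_cos).const_smul (η ((k : ℝ) / (n : ℝ)) * coeff α β k f))).mul (hg.comp Real.continuous_cos))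

lemma V_adj (η : ℝ → ℝ) (α β : ℝ) (hα : -1 < α) (hβ : -1 < β) (n : ℕ) {f g : ℝ → ℝ} (hf : Continuous f) (hg : Continuous g) :
    ip α β (V η α β n f) g = ip α β f (V η α β n g) := by
  rw [ip_V η α β hα hβ n f hg, ip_symm α β f, ip_V η α β hα hβ n g hf]
  refine Finset.sum_congr rfl fun k _ => ?_
  unfold coeff; ring

lemma coeff_J (α β : ℝ) (hα : -1 < α) (hβ : -1 < β) (k l : ℕ) :
    coeff α β l (fun x => (JPol α β k).eval x) = if l = k then 1 else 0 := by
  unfold coeff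
  have e : ip α β (fun x => (JPol α β k).eval x) (J α β l) = pip α β (JPol α β k) (JPol α β l) := by
    unfold pip; rw [ip_eq]; simp only [JPol_eval]
  rw [e]
  split_ifs with h
  · subst h; rw [hJ_eq]; apply div_self; rw [← hJ_eq]; exact (hJ_pos α β hα hβ l).ne'
  · rw [JPol_orth α β hα hβ (Ne.symm h), zero_div]

lemma V_J (η : ℝ → ℝ) (α β : ℝ) (hα : -1 < α) (hβ : -1 < β) (n : ℕ) (k : ℕ) (hk : k ≤ 2 * n) (x : ℝ) :
    V η α β n (fun x => (JPol α β k).eval x) x = η ((k:ℝ)/n) * (JPol α β k).eval x := by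
  unfold V
  simp only [coeff_J α β hα hβ]
  rw [Finset.sum_eq_single k]
  · simp [JPol_eval]
  · intro b _ hb; simp [hb]
  · intro h; exact absurd (Finset.mem_range.2 (by omega)) h

lemma V_repro (η : ℝ → ℝ) (hη : Admissible η) (α β : ℝ) (hα : -1 < α) (hβ : -1 < β) (n : ℕ) (hn : 1 ≤ n) (q : Polynomial ℝ)
    (hq : q.natDegree ≤ n) (x : ℝ) : V η α β n (fun x => q.eval x) x = q.eval x := by
  have hm := poly_mem α β hα hβ n q hq
  unfold JSpan at hm
  clear hq
  induction hm using Submodule.span_induction with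
  | mem p hp =>
    obtain ⟨k, hk, rfl⟩ := hp
    have hk : k ≤ n := hk
    rw [V_J η α β hα hβ n k (by omega)]
    have hn0 : (0:ℝ) < n := by exact_mod_cast hn
    rw [hη.2.1 _ (by positivity) (by rw [div_le_one hn0]; exact_mod_cast hk), one_mul]
  | zero =>
    have := V_smul η α β n 0 (fun _ => 0) x
    simpa using this
  | add p q _ _ hp hq =>
    simp only [Polynomial.eval_add]
    rw [V_add η α β hα hβ n p.continuous q.continuous, hp, hq]
  | smul c p _ hp =>
    simp only [Polynomial.eval_smul, smul_eq_mul]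
    rw [V_smul, hp]

lemma V_orth (η : ℝ → ℝ) (hη : Admissible η) (α β : ℝ) (hα : -1 < α) (hβ : -1 < β) (n : ℕ) (hn : 1 ≤ n) {f : ℝ → ℝ}
    (hf : Continuous f) (q : Polynomial ℝ) (hq : q.natDegree ≤ n) :
    ip α β (fun x => f x - V η α β n f x) (fun x => q.eval x) = 0 := by
  have e : (fun x => f x - V η α β n f x) = fun x => f x + (fun x => (-1) * V η α β n f x) x := by ext; ring
  have hV := V_cont η α β n f
  rw [e, ip_add α β hα hβ hf (by fun_prop) q.continuous, ip_smul, V_adj η α β hα hβ n hf q.continuous]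
  have : V η α β n (fun x => q.eval x) = fun x => q.eval x := by
    ext x; exact V_repro η hη α β hα hβ n hn q hq x
  rw [this]; ring

/-- kernel of `V` -/
def KV (η : ℝ → ℝ) (α β : ℝ) (n : ℕ) (x y : ℝ) : ℝ :=
  ∑ k ∈ Finset.range (2 * n + 1), η ((k : ℝ) / (n : ℝ)) / hJ α β k * J α β k x * J α β k y

lemma KV_symm (η : ℝ → ℝ) (α β : ℝ) (n : ℕ) (x y : ℝ) : KV η α β n x y = KV η α β n y x := by
  unfold KV; refine Finset.sum_congr rfl fun k _ => ?_; ring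

lemma KV_cont (η : ℝ → ℝ) (α β : ℝ) (n : ℕ) : Continuous (fun p : ℝ × ℝ => KV η α β n p.1 p.2) := by
  unfold KV
  refine continuous_finsetSum _ fun k _ => ?_
  have := J_cont α β k
  fun_prop

lemma V_kernel (η : ℝ → ℝ) (α β : ℝ) (hα : -1 < α) (hβ : -1 < β) (n : ℕ) {f : ℝ → ℝ} (hf : Continuous f) (x : ℝ) :
    V η α β n f x = ∫ τ, f (Real.cos τ) * KV η α β n x (Real.cos τ) ∂(nu α β) := by
  unfold V KV
  simp only [Finset.mul_sum]
  rw [integral_finsetSum]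
  · refine Finset.sum_congr rfl fun k _ => ?_
    unfold coeff
    rw [ip_eq]
    have : ∀ τ, f (Real.cos τ) * (η ((k : ℝ) / (n : ℝ)) / hJ α β k * J α β k x * J α β k (Real.cos τ)) =
      (η ((k : ℝ) / (n : ℝ)) / hJ α β k * J α β k x) * (f (Real.cos τ) * J α β k (Real.cos τ)) := fun τ => by ring
    simp only [this]
    rw [integral_const_mul]; ring
  · intro k _
    have := J_cont α β k
    exact cont_int α β hα hβ (by fun_prop)

lemma diff_int (α β : ℝ) (hα : -1 < α) (hβ : -1 < β) (G G' : ℝ → ℝ → ℝ)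
    (hG : Continuous (fun p : ℝ × ℝ => G p.1 p.2)) (hG' : Continuous (fun p : ℝ × ℝ => G' p.1 p.2))
    (hd : ∀ t τ, HasDerivAt (fun t => G t τ) (G' t τ) t) (t : ℝ) :
    HasDerivAt (fun t => ∫ τ, G t τ ∂(nu α β)) (∫ τ, G' t τ ∂(nu α β)) t := by
  have := nu_finite α β hα hβ
  obtain ⟨C, hC⟩ := (isCompact_Icc.prod isCompact_Icc).exists_bound_of_continuousOn
    (s := (Icc (t-1) (t+1)) ×ˢ (Icc 0 Real.pi)) hG'.continuousOn
  have cg : ∀ x, Continuous (G x) := fun x => hG.comp (by fun_prop : Continuous fun τ : ℝ => (x, τ))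
  have cg' : ∀ x, Continuous (G' x) := fun x => hG'.comp (by fun_prop : Continuous fun τ : ℝ => (x, τ))
  refine (hasDerivAt_integral_of_dominated_loc_of_deriv_le (μ := nu α β) (F := G) (F' := G') (s := Ioo (t-1) (t+1))
    (bound := fun _ => C) (Ioo_mem_nhds (by linarith) (by linarith)) ?_ ?_ ?_ ?_ ?_ ?_).2
  · exact Filter.Eventually.of_forall fun x => (cg x).aestronglyMeasurable
  · exact cont_int α β hα hβ (cg t)
  · exact (cg' t).aestronglyMeasurable
  · filter_upwards [nu_ae_mem α β] with τ hτ x hx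
    exact hC (x, τ) ⟨⟨hx.1.le, hx.2.le⟩, ⟨hτ.1.le, hτ.2.le⟩⟩
  · exact integrable_const C
  · exact Filter.Eventually.of_forall fun τ x _ => hd x τ

lemma slice (F : ℝ → ℝ → ℝ) (hF : Continuous (fun p : ℝ × ℝ => F p.1 p.2)) (t : ℝ) : Continuous (F t) :=
  hF.comp (by fun_prop : Continuous fun τ : ℝ => (t, τ))

/-- smooth weight -/
def qw (n θ τ : ℝ) : ℝ := Real.sqrt (1 + (n * (τ - θ)) ^ 2)
def qw' (n θ τ : ℝ) : ℝ := n * (n * (τ - θ)) / qw n θ τ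

lemma qw_one_le (n θ τ : ℝ) : 1 ≤ qw n θ τ := by
  unfold qw; rw [Real.one_le_sqrt]; nlinarith [sq_nonneg (n * (τ - θ))]
lemma qw_pos (n θ τ : ℝ) : 0 < qw n θ τ := lt_of_lt_of_le one_pos (qw_one_le n θ τ)
lemma qw_cont (n θ : ℝ) : Continuous (qw n θ) := by unfold qw; fun_prop
lemma qw'_cont (n θ : ℝ) : Continuous (qw' n θ) := by
  unfold qw'
  exact Continuous.div (by fun_prop) (qw_cont n θ) (fun x => (qw_pos n θ x).ne')
lemma qw_deriv (n θ τ : ℝ) : HasDerivAt (qw n θ) (qw' n θ τ) τ := by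
  have h : HasDerivAt (fun τ => 1 + (n * (τ - θ)) ^ 2) (2 * (n * (τ - θ)) * n) τ := by
    have h1 : HasDerivAt (fun τ => n * (τ - θ)) n τ := by
      simpa using ((hasDerivAt_id τ).sub_const θ).const_mul n
    have := (h1.pow 2).const_add 1
    refine this.congr_deriv ?_
    simp
  have := h.sqrt (by positivity)
  refine this.congr_deriv ?_
  unfold qw' qw
  field_simp
lemma qw_sq (n θ τ : ℝ) : qw n θ τ ^ 2 = 1 + (n * (τ - θ)) ^ 2 := by
  unfold qw; rw [Real.sq_sqrt (by positivity)]
lemma qw_ge (n θ τ : ℝ) : |n * (τ - θ)| ≤ qw n θ τ := by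
  apply abs_le_of_sq_le_sq _ (qw_pos n θ τ).le
  rw [qw_sq]; linarith
lemma qw'_le {n : ℝ} (hn : 0 < n) (θ τ : ℝ) : |qw' n θ τ| ≤ n := by
  unfold qw'
  rw [abs_div, abs_mul, abs_of_pos hn, abs_of_pos (qw_pos n θ τ), div_le_iff₀ (qw_pos n θ τ)]
  exact mul_le_mul_of_nonneg_left (qw_ge n θ τ) hn.le

def Sf (A t : ℝ) : ℝ := ∫ s in (0:ℝ)..t, Real.cos (A * s)
lemma Sf_deriv (A t : ℝ) : HasDerivAt (Sf A) (Real.cos (A * t)) t :=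
  intervalIntegral.integral_hasDerivAt_right (Continuous.intervalIntegrable (by fun_prop) _ _)
    (Continuous.stronglyMeasurableAtFilter (by fun_prop) _ _) (Continuous.continuousAt (by fun_prop))
lemma Sf_zero (A : ℝ) : Sf A 0 = 0 := by unfold Sf; simp
lemma Sf_cont (A : ℝ) : Continuous (Sf A) := continuous_iff_continuousAt.2 fun t => (Sf_deriv A t).continuousAt
lemma Sf_mul (A t : ℝ) : A * Sf A t = Real.sin (A * t) := by
  unfold Sf
  rw [← intervalIntegral.integral_const_mul]
  have : ∀ x ∈ uIcc 0 t, HasDerivAt (fun s => Real.sin (A * s)) (A * Real.cos (A * x)) x := by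
    intro x _
    have := ((hasDerivAt_id x).const_mul A).sin
    refine this.congr_deriv ?_; simp; ring
  rw [intervalIntegral.integral_eq_sub_of_hasDerivAt this (Continuous.intervalIntegrable (by fun_prop) _ _)]
  simp

/-- frequency -/
def Af (α β : ℝ) (k : ℕ) : ℝ := k + (α + β + 1)/2

section wave
variable (α β : ℝ) (N : ℕ) (c : ℕ → ℝ)
def uW (t τ : ℝ) : ℝ := ∑ k ∈ Finset.range N, c k * Sf (Af α β k) t * (JPol α β k).eval (Real.cos τ)
def uWτ (t τ : ℝ) : ℝ := ∑ k ∈ Finset.range N, c k * Sf (Af α β k) t * (-(Real.sin τ * (Polynomial.derivative (JPol α β k)).eval (Real.cos τ)))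
def vW (t τ : ℝ) : ℝ := ∑ k ∈ Finset.range N, c k * Real.cos (Af α β k * t) * (JPol α β k).eval (Real.cos τ)
def vWτ (t τ : ℝ) : ℝ := ∑ k ∈ Finset.range N, c k * Real.cos (Af α β k * t) * (-(Real.sin τ * (Polynomial.derivative (JPol α β k)).eval (Real.cos τ)))
def wW (t τ : ℝ) : ℝ := ∑ k ∈ Finset.range N, c k * (-(Af α β k ^ 2 * Sf (Af α β k) t)) * (JPol α β k).eval (Real.cos τ)

lemma gen_cont (g : ℕ → ℝ → ℝ) (h : ℕ → ℝ → ℝ) (hg : ∀ k, Continuous (g k)) (hh : ∀ k, Continuous (h k)) :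
    Continuous (fun p : ℝ × ℝ => ∑ k ∈ Finset.range N, c k * g k p.1 * h k p.2) := by
  refine continuous_finsetSum _ fun k _ => ?_
  have := hg k; have := hh k
  fun_prop

lemma b_cont (k : ℕ) : Continuous (fun τ => -(Real.sin τ * (Polynomial.derivative (JPol α β k)).eval (Real.cos τ))) :=
  (Real.continuous_sin.mul (pc_cont _)).neg

lemma uW_cont : Continuous (fun p : ℝ × ℝ => uW α β N c p.1 p.2) :=
  gen_cont N c (fun k t => Sf (Af α β k) t) _ (fun k => Sf_cont _) (fun k => pc_cont _)
lemma uWτ_cont : Continuous (fun p : ℝ × ℝ => uWτ α β N c p.1 p.2) :=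
  gen_cont N c (fun k t => Sf (Af α β k) t) _ (fun k => Sf_cont _) (fun k => b_cont α β k)
lemma vW_cont : Continuous (fun p : ℝ × ℝ => vW α β N c p.1 p.2) :=
  gen_cont N c (fun k t => Real.cos (Af α β k * t)) _ (fun k => by fun_prop) (fun k => pc_cont _)
lemma vWτ_cont : Continuous (fun p : ℝ × ℝ => vWτ α β N c p.1 p.2) :=
  gen_cont N c (fun k t => Real.cos (Af α β k * t)) _ (fun k => by fun_prop) (fun k => b_cont α β k)
lemma wW_cont : Continuous (fun p : ℝ × ℝ => wW α β N c p.1 p.2) :=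
  gen_cont N c (fun k t => (-(Af α β k ^ 2 * Sf (Af α β k) t))) _ (fun k => by have := Sf_cont (Af α β k); fun_prop) (fun k => pc_cont _)

lemma gen_deriv (g g' : ℕ → ℝ → ℝ) (h : ℕ → ℝ) (t : ℝ) (hg : ∀ k, HasDerivAt (g k) (g' k t) t) :
    HasDerivAt (fun t => ∑ k ∈ Finset.range N, c k * g k t * h k) (∑ k ∈ Finset.range N, c k * g' k t * h k) t :=
  HasDerivAt.fun_sum fun k _ => ((hg k).const_mul (c k)).mul_const (h k)

lemma uW_dt (t τ : ℝ) : HasDerivAt (fun t => uW α β N c t τ) (vW α β N c t τ) t :=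
  gen_deriv N c _ (fun k t => Real.cos (Af α β k * t)) _ t fun k => Sf_deriv _ t
lemma uWτ_dt (t τ : ℝ) : HasDerivAt (fun t => uWτ α β N c t τ) (vWτ α β N c t τ) t :=
  gen_deriv N c _ (fun k t => Real.cos (Af α β k * t)) _ t fun k => Sf_deriv _ t
lemma vW_dt (t τ : ℝ) : HasDerivAt (fun t => vW α β N c t τ) (wW α β N c t τ) t := by
  refine gen_deriv N c (fun k t => Real.cos (Af α β k * t)) (fun k t => (-(Af α β k ^ 2 * Sf (Af α β k) t))) _ t fun k => ?_
  have := ((hasDerivAt_id t).const_mul (Af α β k)).cos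
  refine this.congr_deriv ?_
  simp only [id]
  rw [← Sf_mul]; ring

lemma vW_dτ (t τ : ℝ) : HasDerivAt (fun τ => vW α β N c t τ) (vWτ α β N c t τ) τ :=
  HasDerivAt.fun_sum fun k _ => (pc_deriv (JPol α β k) τ).const_mul (c k * Real.cos (Af α β k * t))

/-- the polynomial u -/
def uPol (t : ℝ) : Polynomial ℝ := ∑ k ∈ Finset.range N, Polynomial.C (c k * Sf (Af α β k) t) * JPol α β k

lemma uPol_L (hα : -1 < α) (t τ : ℝ) : (LP α β (uPol α β N c t)).eval (Real.cos τ) = - wW α β N c t τ - ((α + β + 1)/2)^2 * uW α β N c t τ := by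
  unfold uPol wW uW
  simp only [LP_sum, LP_C_mul, LP_JPol α β hα, Polynomial.eval_finsetSum, Polynomial.eval_mul, Polynomial.eval_C]
  rw [Finset.mul_sum, ← Finset.sum_neg_distrib, ← Finset.sum_sub_distrib]
  refine Finset.sum_congr rfl fun k _ => ?_
  unfold Af; ring

lemma uPol_d (t τ : ℝ) : Real.sin τ * (Polynomial.derivative (uPol α β N c t)).eval (Real.cos τ) = - uWτ α β N c t τ := by
  unfold uPol uWτ
  simp only [Polynomial.derivative_sum, Polynomial.derivative_C_mul, Polynomial.eval_finsetSum, Polynomial.eval_mul, Polynomial.eval_C]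
  rw [Finset.mul_sum, ← Finset.sum_neg_distrib]
  refine Finset.sum_congr rfl fun k _ => ?_
  ring

variable (n θ : ℝ)
/-- energy density and energy -/
def eDen (j : ℕ) (t τ : ℝ) : ℝ := (vW α β N c t τ ^ 2 + uWτ α β N c t τ ^ 2 + ((α + β + 1)/2)^2 * uW α β N c t τ ^ 2) * qw n θ τ ^ j
def Eg (j : ℕ) (t : ℝ) : ℝ := ∫ τ, eDen α β N c n θ j t τ ∂(nu α β)

lemma eDen_cont (j : ℕ) : Continuous (fun p : ℝ × ℝ => eDen α β N c n θ j p.1 p.2) := by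
  unfold eDen
  have := uW_cont α β N c; have := uWτ_cont α β N c; have := vW_cont α β N c
  have := qw_cont n θ
  fun_prop

lemma Eg_deriv (hα : -1 < α) (hβ : -1 < β) (j : ℕ) (t : ℝ) : HasDerivAt (Eg α β N c n θ j)
    (∫ τ, -2 * (uWτ α β N c t τ * vW α β N c t τ * (j * qw n θ τ ^ (j-1) * qw' n θ τ)) ∂(nu α β)) t := by
  have hu := uW_cont α β N c; have huτ := uWτ_cont α β N c; have hv := vW_cont α β N c
  have hvτ := vWτ_cont α β N c; have hw := wW_cont α β N c
  have hq := qw_cont n θ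
  have hq' := qw'_cont n θ
  have key := diff_int α β hα hβ (eDen α β N c n θ j)
    (fun t τ => (2 * vW α β N c t τ * wW α β N c t τ + 2 * uWτ α β N c t τ * vWτ α β N c t τ + ((α + β + 1)/2)^2 * (2 * uW α β N c t τ * vW α β N c t τ)) * qw n θ τ ^ j)
    (eDen_cont α β N c n θ j) (by fun_prop) ?_ t
  · refine key.congr_deriv ?_
    have s : ∀ {F : ℝ → ℝ → ℝ}, Continuous (fun p : ℝ × ℝ => F p.1 p.2) → Continuous (F t) :=
      fun hF => hF.comp (by fun_prop : Continuous fun τ : ℝ => (t, τ))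
    have hu := s hu; have huτ := s huτ; have hv := s hv; have hvτ := s hvτ; have hw := s hw
    have I := ibp α β hα hβ (uPol α β N c t) (fun τ => vW α β N c t τ * qw n θ τ ^ j)
      (fun τ => vWτ α β N c t τ * qw n θ τ ^ j + vW α β N c t τ * (j * qw n θ τ ^ (j-1) * qw' n θ τ))
      (fun τ => (vW_dτ α β N c t τ).mul ((qw_deriv n θ τ).pow j)) (by fun_prop)
    simp only [uPol_L α β N c hα, uPol_d] at I
    rw [← integral_neg] at I
    have i1 : Integrable (fun τ => (- wW α β N c t τ - ((α + β + 1)/2)^2 * uW α β N c t τ) * (vW α β N c t τ * qw n θ τ ^ j)) (nu α β) :=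
      cont_int α β hα hβ (by fun_prop)
    have i2 : Integrable (fun τ => -(-uWτ α β N c t τ * (vWτ α β N c t τ * qw n θ τ ^ j + vW α β N c t τ * (j * qw n θ τ ^ (j-1) * qw' n θ τ)))) (nu α β) :=
      cont_int α β hα hβ (by fun_prop)
    have i3 : Integrable (fun τ => (2 * vW α β N c t τ * wW α β N c t τ + 2 * uWτ α β N c t τ * vWτ α β N c t τ + ((α + β + 1)/2)^2 * (2 * uW α β N c t τ * vW α β N c t τ)) * qw n θ τ ^ j) (nu α β) :=
      cont_int α β hα hβ (by fun_prop)
    have i4 : Integrable (fun τ => -2 * (uWτ α β N c t τ * vW α β N c t τ * (j * qw n θ τ ^ (j-1) * qw' n θ τ))) (nu α β) :=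
      cont_int α β hα hβ (by fun_prop)
    have e : ∀ τ, (2 * vW α β N c t τ * wW α β N c t τ + 2 * uWτ α β N c t τ * vWτ α β N c t τ + ((α + β + 1)/2)^2 * (2 * uW α β N c t τ * vW α β N c t τ)) * qw n θ τ ^ j
       - (-2 * (uWτ α β N c t τ * vW α β N c t τ * (j * qw n θ τ ^ (j-1) * qw' n θ τ))) =
       2 * (-(-uWτ α β N c t τ * (vWτ α β N c t τ * qw n θ τ ^ j + vW α β N c t τ * (j * qw n θ τ ^ (j-1) * qw' n θ τ))) -
        (- wW α β N c t τ - ((α + β + 1)/2)^2 * uW α β N c t τ) * (vW α β N c t τ * qw n θ τ ^ j)) := fun τ => by ring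
    rw [← sub_eq_zero, ← integral_sub i3 i4]
    simp only [e]
    rw [integral_const_mul, integral_sub i2 i1, I, sub_self, mul_zero]
  · intro t τ
    have h1 := (vW_dt α β N c t τ).pow 2
    have h2 := (uWτ_dt α β N c t τ).pow 2
    have h3 := ((uW_dt α β N c t τ).pow 2).const_mul (((α + β + 1)/2)^2)
    refine (((h1.add h2).add h3).mul_const (qw n θ τ ^ j)).congr_deriv ?_
    simp

lemma eDen_nonneg (j : ℕ) (t τ : ℝ) : 0 ≤ eDen α β N c n θ j t τ := by
  unfold eDen; have := qw_pos n θ τ; positivity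
lemma eDen_cont2 (j : ℕ) (t : ℝ) : Continuous (fun τ => eDen α β N c n θ j t τ) := by
  exact slice (eDen α β N c n θ j) (eDen_cont α β N c n θ j) t
lemma eDen_int (hα : -1 < α) (hβ : -1 < β) (j : ℕ) (t : ℝ) : Integrable (fun τ => eDen α β N c n θ j t τ) (nu α β) :=
  cont_int α β hα hβ (eDen_cont2 α β N c n θ j t)

lemma Eg_deriv_le (hα : -1 < α) (hβ : -1 < β) (hn : 0 < n) (j : ℕ) (t : ℝ) :
    (∫ τ, -2 * (uWτ α β N c t τ * vW α β N c t τ * (j * qw n θ τ ^ (j-1) * qw' n θ τ)) ∂(nu α β)) ≤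
      j * n * Eg α β N c n θ (j-1) t := by
  unfold Eg
  rw [← integral_const_mul]
  have h : Continuous (fun τ : ℝ => (t, τ)) := by fun_prop
  have huτ : Continuous (fun τ => uWτ α β N c t τ) := slice (uWτ α β N c) (uWτ_cont α β N c) t
  have hv : Continuous (fun τ => vW α β N c t τ) := slice (vW α β N c) (vW_cont α β N c) t
  have hq := qw_cont n θ
  have hq' := qw'_cont n θ
  refine integral_mono (cont_int α β hα hβ (by fun_prop)) ((eDen_int α β N c n θ hα hβ (j-1) t).const_mul _) ?_
  intro τ
  simp only
  unfold eDen
  have h1 := qw'_le hn θ τ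
  have h2 := qw_pos n θ τ
  have h3 : 0 ≤ (j:ℝ) * qw n θ τ ^ (j-1) := by positivity
  set a := uWτ α β N c t τ
  set b := vW α β N c t τ
  set d := uW α β N c t τ
  have h4 : -2 * (a * b) * qw' n θ τ ≤ (b^2 + a^2 + ((α + β + 1)/2)^2 * d^2) * n := by
    have h5 : |(-2 * (a * b)) * qw' n θ τ| ≤ |(-2 * (a * b))| * n := by
      rw [abs_mul]; exact mul_le_mul_of_nonneg_left h1 (abs_nonneg _)
    have h6 : |(-2 * (a * b))| ≤ b^2 + a^2 := by
      rw [abs_le]; constructor <;> nlinarith [sq_nonneg (a - b), sq_nonneg (a + b)]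
    have h7 : 0 ≤ ((α + β + 1)/2)^2 * d^2 := by positivity
    calc _ ≤ _ := le_abs_self _
      _ ≤ _ := h5
      _ ≤ (b^2 + a^2) * n := mul_le_mul_of_nonneg_right h6 hn.le
      _ ≤ _ := by apply mul_le_mul_of_nonneg_right _ hn.le; linarith
  calc -2 * (a * b * (j * qw n θ τ ^ (j-1) * qw' n θ τ)) = (-2 * (a * b) * qw' n θ τ) * (j * qw n θ τ ^ (j-1)) := by ring
    _ ≤ ((b^2 + a^2 + ((α + β + 1)/2)^2 * d^2) * n) * (j * qw n θ τ ^ (j-1)) := mul_le_mul_of_nonneg_right h4 h3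
    _ = _ := by ring

lemma Eg_mono (hα : -1 < α) (hβ : -1 < β) (j : ℕ) (t : ℝ) : Eg α β N c n θ (j-1) t ≤ Eg α β N c n θ j t := by
  unfold Eg
  refine integral_mono (eDen_int α β N c n θ hα hβ _ t) (eDen_int α β N c n θ hα hβ _ t) fun τ => ?_
  unfold eDen
  apply mul_le_mul_of_nonneg_left _ (by positivity)
  exact pow_le_pow_right₀ (qw_one_le n θ τ) (by omega)

lemma Eg_nonneg (j : ℕ) (t : ℝ) : 0 ≤ Eg α β N c n θ j t := integral_nonneg fun τ => eDen_nonneg α β N c n θ j t τ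

lemma Eg_growth (hα : -1 < α) (hβ : -1 < β) (hn : 0 < n) (j : ℕ) : ∀ t, 0 ≤ t →
    Eg α β N c n θ j t ≤ (1 + n * t) ^ j * Eg α β N c n θ j 0 := by
  induction j with
  | zero =>
    intro t ht
    have hd : ∀ t, HasDerivAt (Eg α β N c n θ 0) 0 t := by
      intro t
      refine (Eg_deriv α β N c n θ hα hβ 0 t).congr_deriv ?_
      simp
    have := is_const_of_deriv_eq_zero (fun t => (hd t).differentiableAt) (fun t => (hd t).deriv) t 0
    rw [this]; simp
  | succ j ih =>
    intro t ht
    set E0 := Eg α β N c n θ (j+1) 0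
    have hE0 : 0 ≤ E0 := Eg_nonneg α β N c n θ (j+1) 0
    have hd : ∀ t, HasDerivAt (fun t => (1 + n * t) ^ (j+1) * E0 - Eg α β N c n θ (j+1) t)
        (((j+1 : ℕ) * (1 + n * t) ^ j * n) * E0 - (∫ τ, -2 * (uWτ α β N c t τ * vW α β N c t τ * (((j+1:ℕ):ℝ) * qw n θ τ ^ (j+1-1) * qw' n θ τ)) ∂(nu α β))) t := by
      intro t
      have h1 : HasDerivAt (fun t => 1 + n * t) n t := by
        simpa using ((hasDerivAt_id t).const_mul n).const_add 1
      have := ((h1.pow (j+1)).mul_const E0).sub (Eg_deriv α β N c n θ hα hβ (j+1) t)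
      exact this
    have hm : MonotoneOn (fun t => (1 + n * t) ^ (j+1) * E0 - Eg α β N c n θ (j+1) t) (Ici 0) := by
      apply monotoneOn_of_deriv_nonneg (convex_Ici 0)
      · exact fun t _ => (hd t).continuousAt.continuousWithinAt
      · exact fun t _ => (hd t).differentiableAt.differentiableWithinAt
      · intro t ht
        rw [interior_Ici] at ht
        rw [(hd t).deriv]
        have h1 := Eg_deriv_le α β N c n θ hα hβ hn (j+1) t
        have h2 := ih t (le_of_lt ht)
        have h3 : Eg α β N c n θ j 0 ≤ E0 := by simpa using Eg_mono α β N c n θ hα hβ (j+1) 0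
        rw [Nat.add_sub_cancel] at h1
        have ht0 : 0 < t := ht
        have h4 : Eg α β N c n θ j t ≤ (1 + n * t) ^ j * E0 := h2.trans (mul_le_mul_of_nonneg_left h3 (by positivity))
        have h5 := mul_le_mul_of_nonneg_left h4 (show 0 ≤ ((j+1:ℕ):ℝ) * n by positivity)
        simp only [Nat.add_sub_cancel] at *
        linarith
    have := hm (mem_Ici.2 le_rfl) (mem_Ici.2 ht) ht
    simp only [mul_zero, add_zero, one_pow, one_mul] at this
    have e : E0 - Eg α β N c n θ (j+1) 0 = 0 := sub_self _
    linarith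

/-- Weighted propagation estimate for the cosine flow. -/
lemma wave_est (hα : -1 < α) (hβ : -1 < β) (hn : 0 < n) (j : ℕ) (t : ℝ) :
    ∫ τ, vW α β N c t τ ^ 2 * qw n θ τ ^ j ∂(nu α β) ≤
      (1 + n * |t|) ^ j * ∫ τ, vW α β N c 0 τ ^ 2 * qw n θ τ ^ j ∂(nu α β) := by
  have he : vW α β N c t = vW α β N c |t| := by
    ext τ; unfold vW
    refine Finset.sum_congr rfl fun k _ => ?_
    rw [← Real.cos_abs, abs_mul, ← Real.cos_abs (Af α β k * |t|), abs_mul, abs_abs]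
  rw [he]
  have h := Eg_growth α β N c n θ hα hβ hn j |t| (abs_nonneg t)
  have h0 : Eg α β N c n θ j 0 = ∫ τ, vW α β N c 0 τ ^ 2 * qw n θ τ ^ j ∂(nu α β) := by
    unfold Eg eDen uWτ uW
    simp [Sf_zero]
  rw [h0] at h
  refine le_trans ?_ h
  unfold Eg
  have hv : Continuous (fun τ => vW α β N c |t| τ) := slice (vW α β N c) (vW_cont α β N c) |t|
  have hq := qw_cont n θ
  refine integral_mono (cont_int α β hα hβ (by fun_prop)) (eDen_int α β N c n θ hα hβ j |t|) fun τ => ?_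
  unfold eDen
  have := qw_pos n θ τ
  apply mul_le_mul_of_nonneg_right _ (by positivity)
  have : 0 ≤ uWτ α β N c |t| τ ^ 2 + ((α + β + 1)/2)^2 * uW α β N c |t| τ ^ 2 := by positivity
  linarith
end wave

open FourierTransform in
lemma ft_bound (H : ℝ → ℂ) (hH : ContDiff ℝ (⊤:ℕ∞) H) (R M : ℝ) (hR : 0 < R) (hz : ∀ a, R ≤ |a| → H a = 0) (J : ℕ)
    (hM : ∀ a, ‖iteratedDeriv J H a‖ ≤ M) (t : ℝ) : (2 * Real.pi * |t|) ^ J * ‖𝓕 H t‖ ≤ 2 * R * M := by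
  have hts : tsupport H ⊆ Icc (-R) R := by
    refine closure_minimal (fun a ha => ?_) isClosed_Icc
    by_contra hc
    refine ha (hz a ?_)
    rw [Set.mem_Icc, ← abs_le] at hc
    exact (not_le.1 hc).le
  have hcs : HasCompactSupport H := isCompact_Icc.of_isClosed_subset isClosed_closure hts
  have hsup : ∀ k a, a ∉ Icc (-R) R → iteratedDeriv k H a = 0 := by
    intro k a ha
    rw [← norm_eq_zero, ← norm_iteratedFDeriv_eq_norm_iteratedDeriv, norm_eq_zero]
    by_contra hc
    exact ha (hts (support_iteratedFDeriv_subset k hc))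
  have hcont : ∀ k : ℕ, Continuous (iteratedDeriv k H) := fun k => hH.continuous_iteratedDeriv k (by exact_mod_cast le_top)
  have hIntg : ∀ k : ℕ, Integrable (iteratedDeriv k H) := by
    intro k
    refine (hcont k).integrable_of_hasCompactSupport ?_
    exact HasCompactSupport.intro isCompact_Icc (hsup k)
  have h1 := Real.fourier_iteratedDeriv (N := ⊤) (n := J) hH (fun k _ => hIntg k) (by exact_mod_cast le_top)
  have h2 : ‖𝓕 (iteratedDeriv J H) t‖ ≤ ∫ v, ‖iteratedDeriv J H v‖ :=
    VectorFourier.norm_fourierIntegral_le_integral_norm _ _ _ _ _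
  rw [h1] at h2
  have h3 : ∫ v, ‖iteratedDeriv J H v‖ ≤ 2 * R * M := by
    have : ∫ v, ‖iteratedDeriv J H v‖ = ∫ v in Icc (-R) R, ‖iteratedDeriv J H v‖ := by
      rw [setIntegral_eq_integral_of_forall_compl_eq_zero]
      intro x hx; rw [hsup J x hx, norm_zero]
    rw [this]
    calc ∫ v in Icc (-R) R, ‖iteratedDeriv J H v‖ ≤ ∫ v in Icc (-R) R, M := by
          refine setIntegral_mono ((hIntg J).norm.integrableOn) (by simp) hM
      _ = 2 * R * M := by
          simp; left; rw [max_eq_left (by linarith)]; ring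
  refine le_trans (le_of_eq ?_) (h2.trans h3)
  simp only [norm_smul, norm_pow, norm_mul, Complex.norm_I, Complex.norm_real, Real.norm_eq_abs, Complex.norm_ofNat, abs_of_pos Real.pi_pos]
  ring

lemma ofReal_iter (h : ℝ → ℝ) (hh : ContDiff ℝ (⊤:ℕ∞) h) (J : ℕ) (a : ℝ) :
    ‖iteratedDeriv J (fun a => (h a : ℂ)) a‖ = |iteratedDeriv J h a| := by
  rw [← norm_iteratedFDeriv_eq_norm_iteratedDeriv, ← Real.norm_eq_abs, ← norm_iteratedFDeriv_eq_norm_iteratedDeriv]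
  exact LinearIsometry.norm_iteratedFDeriv_comp_left (𝕜 := ℝ) Complex.ofRealLI (hh.contDiffAt (x := a)) (by exact_mod_cast le_top)

open FourierTransform in
lemma ft_even (j : ℕ) (R M : ℝ) (hR : 0 < R) (hM0 : 0 ≤ M) (h : ℝ → ℝ) (hh : ContDiff ℝ (⊤:ℕ∞) h) (he : ∀ a, h (-a) = h a)
    (hz : ∀ a, R ≤ |a| → h a = 0) (hM : ∀ a, |h a| ≤ M) (hMj : ∀ a, |iteratedDeriv (j+2) h a| ≤ M) :
    ∃ m : ℝ → ℝ, Continuous m ∧ Integrable (fun t => |m t| * (1 + 2 * Real.pi * |t|) ^ j) ∧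
      (∫ t, |m t| * (1 + 2 * Real.pi * |t|) ^ j) ≤ 2 ^ (j+4) * R * M * Real.pi ∧ 
      ∀ a, h a = ∫ t, m t * Real.cos (2 * Real.pi * a * t) := by
  set H : ℝ → ℂ := fun a => (h a : ℂ) with hHdef
  have hH : ContDiff ℝ (⊤:ℕ∞) H := Complex.ofRealCLM.contDiff.comp hh
  have hz' : ∀ a, R ≤ |a| → H a = 0 := fun a ha => by simp [hHdef, hz a ha]
  have b0 : ∀ t, ‖𝓕 H t‖ ≤ 2 * R * M := by
    intro t
    have := ft_bound H hH R M hR hz' 0 (fun a => by simpa [hHdef] using hM a) t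
    simpa using this
  have bj := ft_bound H hH R M hR hz' (j+2) (fun a => by rw [ofReal_iter h hh]; exact hMj a)
  have hIH : Integrable H := by
    refine hH.continuous.integrable_of_hasCompactSupport ?_
    refine HasCompactSupport.intro (isCompact_Icc (a := -R) (b := R)) fun a ha => hz' a ?_
    rw [Set.mem_Icc, ← abs_le] at ha
    exact (not_le.1 ha).le
  have hFc : Continuous (𝓕 H) := VectorFourier.fourierIntegral_continuous Real.continuous_fourierChar (by exact continuous_inner) hIH
  have key : ∀ t, ‖𝓕 H t‖ * (1 + 2 * Real.pi * |t|) ^ j ≤ 2 ^ (j+4) * R * M * dk 2 1 (t - 0) := by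
    intro t
    set y := 2 * Real.pi * |t| with hy
    have hy0 : |t| ≤ y := by
      rw [hy]; nlinarith [Real.pi_gt_three, abs_nonneg t]
    have hy1 : 0 ≤ y := (abs_nonneg t).trans hy0
    have e1 : (1 + y) ^ (j+2) * ‖𝓕 H t‖ ≤ 2 ^ (j+4) * R * M := by
      have : (1 + y) ^ (j+2) ≤ 2 ^ (j+2) * (1 + y ^ (j+2)) := by
        rcases le_total y 1 with h | h
        · calc (1+y)^(j+2) ≤ 2 ^ (j+2) := by gcongr; linarith
            _ ≤ _ := by 
              have : 0 ≤ y ^ (j+2) := by positivity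
              have : (0:ℝ) < 2 ^ (j+2) := by positivity
              nlinarith
        · calc (1+y)^(j+2) ≤ (2 * y) ^ (j+2) := by gcongr; linarith
            _ ≤ _ := by 
              rw [mul_pow]
              have : (0:ℝ) < 2 ^ (j+2) := by positivity
              nlinarith
      calc (1 + y) ^ (j+2) * ‖𝓕 H t‖ ≤ 2 ^ (j+2) * (1 + y ^ (j+2)) * ‖𝓕 H t‖ := by gcongr
        _ = 2 ^ (j+2) * (‖𝓕 H t‖ + y ^ (j+2) * ‖𝓕 H t‖) := by ring
        _ ≤ 2 ^ (j+2) * (2 * R * M + 2 * R * M) := by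
            exact mul_le_mul_of_nonneg_left (add_le_add (b0 t) (bj t)) (by positivity)
        _ = _ := by ring
    have e2 : dk 2 1 (t - 0) = ((1 + |t|)^2)⁻¹ := by simp [dk]
    rw [e2, ← div_eq_mul_inv, le_div_iff₀ (by positivity)]
    calc ‖𝓕 H t‖ * (1 + y) ^ j * (1 + |t|)^2 ≤ ‖𝓕 H t‖ * (1 + y) ^ j * (1 + y)^2 := by gcongr
      _ = (1 + y) ^ (j+2) * ‖𝓕 H t‖ := by ring
      _ ≤ _ := e1
  have idk := integrable_dk2 one_pos 0
  have hre : ∀ t, |(𝓕 H t).re| ≤ ‖𝓕 H t‖ := fun t => Complex.abs_re_le_norm _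
  have hwm : Continuous (fun t : ℝ => (1 + 2 * Real.pi * |t|) ^ j) := by fun_prop
  have hmc : Continuous (fun t => (𝓕 H t).re) := Complex.continuous_re.comp hFc
  have kb : ∀ t, |(𝓕 H t).re| * (1 + 2 * Real.pi * |t|) ^ j ≤ 2 ^ (j+4) * R * M * dk 2 1 (t - 0) := fun t =>
    (mul_le_mul_of_nonneg_right (hre t) (by positivity)).trans (key t)
  have iA : Integrable (fun t => |(𝓕 H t).re| * (1 + 2 * Real.pi * |t|) ^ j) := by
    refine (idk.1.const_mul (2 ^ (j+4) * R * M)).mono' ((hmc.abs.mul hwm).aestronglyMeasurable) (Filter.Eventually.of_forall fun t => ?_)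
    rw [Real.norm_eq_abs, abs_of_nonneg (by positivity)]
    exact kb t
  have one_le : ∀ t : ℝ, 1 ≤ (1 + 2 * Real.pi * |t|) ^ j := fun t => one_le_pow₀ (by have := Real.pi_pos; have := abs_nonneg t; nlinarith [mul_nonneg Real.pi_pos.le (abs_nonneg t)])
  have iF : Integrable (𝓕 H) := by
    refine (idk.1.const_mul (2 ^ (j+4) * R * M)).mono' hFc.aestronglyMeasurable (Filter.Eventually.of_forall fun t => ?_)
    exact (le_mul_of_one_le_right (norm_nonneg _) (one_le t)).trans (key t)
  refine ⟨fun t => (𝓕 H t).re, hmc, iA, ?_, ?_⟩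
  · calc _ ≤ ∫ t, 2 ^ (j+4) * R * M * dk 2 1 (t - 0) := integral_mono iA (idk.1.const_mul _) kb
      _ = 2 ^ (j+4) * R * M * ∫ t, dk 2 1 (t - 0) := integral_const_mul _ _
      _ ≤ _ := by
        have := idk.2
        rw [div_one] at this
        gcongr
  · have inv := hH.continuous.fourierInv_fourier_eq hIH iF
    have ia : ∀ a, H a = ∫ v, Complex.exp (↑(2 * Real.pi * (v * a)) * Complex.I) • 𝓕 H v := by
      intro a
      have := congrFun inv a
      rw [Real.fourierInv_eq'] at this
      rw [← this]
      simp [mul_comm]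
    have ii : ∀ a : ℝ, Integrable (fun v : ℝ => Complex.exp (↑(2 * Real.pi * (v * a)) * Complex.I) • 𝓕 H v) := by
      intro a
      refine iF.norm.mono' (Continuous.aestronglyMeasurable (by fun_prop)) (Filter.Eventually.of_forall fun t => ?_)
      rw [norm_smul, Complex.norm_exp_ofReal_mul_I, one_mul]
    intro a
    have hr : (H a).re = (1/2) * ((H a).re + (H (-a)).re) := by
      simp [hHdef, he]; ring
    have e0 : h a = (H a).re := by simp [hHdef]
    rw [e0, hr, ia a, ia (-a)]
    rw [← RCLike.re_eq_complex_re]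
    rw [← integral_re (ii a), ← integral_re (ii (-a)), ← integral_add (ii a).re (ii (-a)).re, ← integral_const_mul]
    congr 1; ext t
    simp only [RCLike.re_eq_complex_re, smul_eq_mul, Complex.mul_re, Complex.exp_ofReal_mul_I_re, Complex.exp_ofReal_mul_I_im]
    rw [show 2 * Real.pi * (t * -a) = - (2 * Real.pi * (t * a)) by ring, Real.cos_neg, Real.sin_neg,
      show 2 * Real.pi * a * t = 2 * Real.pi * (t * a) by ring]
    ring

lemma eta_smooth (η : ℝ → ℝ) (hη : Admissible η) : ∃ ψ : ℝ → ℝ, ContDiff ℝ (⊤:ℕ∞) ψ ∧ (∀ s, s ≤ 1 → ψ s = 0) ∧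
    (∀ s, 2 ≤ s → ψ s = -1) ∧ ∀ s, 0 ≤ s → ψ s = η s - 1 := by
  obtain ⟨h1, h2, h3⟩ := hη
  refine ⟨fun s => if s ≤ 1/2 then 0 else η s - 1, ?_, ?_, ?_, ?_⟩
  · refine contDiff_iff_contDiffAt.2 fun s => ?_
    rcases lt_or_ge s 1 with hs | hs
    · refine (contDiffAt_const (c := (0:ℝ))).congr_of_eventuallyEq ?_
      filter_upwards [Iio_mem_nhds hs] with x hx
      split_ifs with h
      · rfl
      · rw [h2 x (by linarith) (le_of_lt hx)]; ring
    · refine ((h1.sub contDiff_const).contDiffAt (x := s)).congr_of_eventuallyEq (f := fun x => η x - 1) ?_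
      filter_upwards [Ioi_mem_nhds (show (1/2:ℝ) < s by linarith)] with x hx
      rw [if_neg (not_le.2 hx)]
  · intro s hs
    dsimp only
    split_ifs with h
    · rfl
    · rw [h2 s (by linarith) hs]; ring
  · intro s hs
    dsimp only
    rw [if_neg (by linarith), h3 s hs]; ring
  · intro s hs
    dsimp only
    split_ifs with h
    · rw [h2 s hs (by linarith)]; ring
    · rfl

lemma psi_bdd (ψ : ℝ → ℝ) (hψ : ContDiff ℝ (⊤:ℕ∞) ψ) (h1 : ∀ s, s ≤ 1 → ψ s = 0) (h2 : ∀ s, 2 ≤ s → ψ s = -1) (J : ℕ) :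
    ∃ B, 0 ≤ B ∧ ∀ s, |iteratedDeriv J ψ s| ≤ B := by
  have hc : Continuous (iteratedDeriv J ψ) := hψ.continuous_iteratedDeriv J (by exact_mod_cast le_top)
  obtain ⟨B, hB⟩ := isCompact_Icc.exists_bound_of_continuousOn (s := Icc (1:ℝ) 2) hc.continuousOn
  have hB0 : 0 ≤ B := (norm_nonneg _).trans (hB 1 (by norm_num))
  refine ⟨B + 1, by linarith, fun s => ?_⟩
  by_cases hs1 : s < 1
  · have : ψ =ᶠ[nhds s] fun _ => 0 := by
      filter_upwards [Iio_mem_nhds hs1] with x hx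
      exact h1 x (le_of_lt hx)
    rw [this.iteratedDeriv_eq, iteratedDeriv_const]
    simp; linarith
  by_cases hs2 : 2 < s
  · have : ψ =ᶠ[nhds s] fun _ => -1 := by
      filter_upwards [Ioi_mem_nhds hs2] with x hx
      exact h2 x (le_of_lt hx)
    rw [this.iteratedDeriv_eq, iteratedDeriv_const]
    split_ifs <;> simp <;> linarith
  · have := hB s ⟨by linarith, by linarith⟩
    rw [Real.norm_eq_abs] at this
    linarith

lemma eta_h (η : ℝ → ℝ) (hη : Admissible η) (α β : ℝ) (hα : -1 < α) (hβ : -1 < β) (J : ℕ) : ∃ R M : ℝ, 0 < R ∧ 0 ≤ M ∧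
    ∀ n : ℕ, 1 ≤ n → ∃ h : ℝ → ℝ, ContDiff ℝ (⊤:ℕ∞) h ∧ (∀ a, h (-a) = h a) ∧ (∀ a, R ≤ |a| → h a = 0) ∧ (∀ a, |h a| ≤ M) ∧
    (∀ a, |iteratedDeriv J h a| ≤ M) ∧ ∀ k : ℕ, h (Af α β k / n) = η (k/n) := by
  obtain ⟨ψ, hψ, h1, h2, h3⟩ := eta_smooth η hη
  obtain ⟨B0, hB0, hB0'⟩ := psi_bdd ψ hψ h1 h2 0
  obtain ⟨B, hB, hB'⟩ := psi_bdd ψ hψ h1 h2 J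
  simp only [iteratedDeriv_zero] at hB0'
  refine ⟨3 + |α + β + 1|, 1 + 2 * B0 + 2 * B, by positivity, by positivity, fun n hn => ?_⟩
  have hn' : (1:ℝ) ≤ n := by exact_mod_cast hn
  set δ := (α + β + 1) / (2 * n) with hδ
  have hδ1 : |δ| ≤ |α + β + 1| := by
    rw [hδ, abs_div, abs_of_pos (show (0:ℝ) < 2 * n by linarith)]
    exact div_le_self (abs_nonneg _) (by linarith)
  have hδ2 : -(1/2) ≤ δ := by
    rw [hδ, le_div_iff₀ (by linarith)]; linarith
  have cd1 : ContDiff ℝ (⊤:ℕ∞) (fun a => ψ (a - δ)) := hψ.comp (by fun_prop)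
  have cd2 : ContDiff ℝ (⊤:ℕ∞) (fun a => ψ (-δ - a)) := hψ.comp (by fun_prop)
  have eg : ∀ a, 3 + |α + β + 1| ≤ a → 1 + ψ (a - δ) + ψ (-δ - a) = 0 := by
    intro a ha
    have := abs_le.1 hδ1
    rw [h2 _ (by linarith), h1 _ (by linarith)]; ring
  have ev : ∀ a, 1 + ψ (-a - δ) + ψ (-δ - -a) = 1 + ψ (a - δ) + ψ (-δ - a) := by
    intro a
    rw [show -a - δ = -δ - a by ring, show -δ - -a = a - δ by ring]; ring
  refine ⟨fun a => 1 + ψ (a - δ) + ψ (-δ - a), (contDiff_const.add cd1).add cd2, ev, ?_, ?_, ?_, ?_⟩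
  · intro a ha
    rcases le_total 0 a with h | h
    · rw [abs_of_nonneg h] at ha; exact eg a ha
    · rw [abs_of_nonpos h] at ha
      dsimp only
      rw [← ev]
      exact eg (-a) ha
  · intro a
    calc _ ≤ |(1:ℝ)| + |ψ (a - δ)| + |ψ (-δ - a)| := abs_add_three _ _ _
      _ ≤ _ := by have := hB0' (a - δ); have := hB0' (-δ - a); rw [abs_one]; linarith
  · intro a
    have e1 := iteratedDeriv_fun_add (n := J) (x := a) ((contDiff_const (c := (1:ℝ)).add cd1).contDiffAt.of_le (by exact_mod_cast le_top)) (cd2.contDiffAt.of_le (by exact_mod_cast le_top))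
    have e2 := iteratedDeriv_fun_add (n := J) (x := a) ((contDiff_const (c := (1:ℝ)) (𝕜 := ℝ) (E := ℝ)).contDiffAt.of_le (by exact_mod_cast le_top) (n := (⊤:ℕ∞))) (cd1.contDiffAt.of_le (by exact_mod_cast le_top))
    rw [e1, e2, iteratedDeriv_comp_sub_const, iteratedDeriv_comp_const_sub, iteratedDeriv_const]
    dsimp only
    calc _ ≤ |if J = 0 then (1:ℝ) else 0| + |iteratedDeriv J ψ (a - δ)| + |(-1:ℝ)^J • iteratedDeriv J ψ (-δ - a)| := abs_add_three _ _ _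
      _ ≤ 1 + B + B := by
        have a1 := hB' (a - δ)
        have a2 := hB' (-δ - a)
        have a3 : |if J = 0 then (1:ℝ) else 0| ≤ 1 := by split_ifs <;> simp
        have a4 : |(-1:ℝ)^J • iteratedDeriv J ψ (-δ - a)| = |iteratedDeriv J ψ (-δ - a)| := by
          rw [smul_eq_mul, abs_mul, abs_pow, abs_neg, abs_one, one_pow, one_mul]
        rw [a4]; linarith
      _ ≤ _ := by linarith
  · intro k
    have e : Af α β k / n = k/n + δ := by
      unfold Af; rw [hδ]; field_simp
    have hk : (0:ℝ) ≤ k / n := by positivity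
    dsimp only
    rw [e, show (k/n + δ - δ : ℝ) = k/n by ring, h3 _ hk, h1 _ (by linarith)]; ring

/-- weighted Cauchy–Schwarz -/
lemma wcs {X : Type*} [MeasurableSpace X] (μ : Measure X) (f g ω : X → ℝ) (hω : ∀ x, 0 ≤ ω x) (h1 : Integrable (fun x => f x ^ 2 * ω x) μ)
    (h2 : Integrable (fun x => g x ^ 2 * ω x) μ) (h3 : Integrable (fun x => f x * g x * ω x) μ) :
    (∫ x, f x * g x * ω x ∂μ) ^ 2 ≤ (∫ x, f x ^ 2 * ω x ∂μ) * ∫ x, g x ^ 2 * ω x ∂μ := by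
  set A := ∫ x, f x ^ 2 * ω x ∂μ
  set B := ∫ x, g x ^ 2 * ω x ∂μ
  set C := ∫ x, f x * g x * ω x ∂μ
  have key : ∀ t : ℝ, 0 ≤ B * (t * t) + (-2 * C) * t + A := by
    intro t
    have e : ∫ x, (f x - t * g x) ^ 2 * ω x ∂μ = B * (t * t) + (-2 * C) * t + A := by
      have : ∀ x, (f x - t * g x) ^ 2 * ω x = ((t * t) * (g x ^ 2 * ω x) + (-2 * t) * (f x * g x * ω x)) + f x ^ 2 * ω x := fun x => by ring
      simp only [this]
      refine (integral_add (f := fun x => (t * t) * (g x ^ 2 * ω x) + (-2 * t) * (f x * g x * ω x)) ((h2.const_mul _).add (h3.const_mul _)) h1).trans ?_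
      rw [show (∫ x, ((t * t) * (g x ^ 2 * ω x) + (-2 * t) * (f x * g x * ω x)) ∂μ) = t * t * B + -2 * t * C from by
        refine (integral_add (h2.const_mul _) (h3.const_mul _)).trans ?_
        rw [integral_const_mul, integral_const_mul]]
      ring
    rw [← e]
    exact integral_nonneg fun x => mul_nonneg (sq_nonneg _) (hω x)
  have := discrim_le_zero key
  unfold discrim at this
  nlinarith

lemma mult_poly (η : ℝ → ℝ) (hη : Admissible η) (α β : ℝ) (hα : -1 < α) (hβ : -1 < β) (j : ℕ) : ∃ C, 0 < C ∧
    ∀ n : ℕ, 1 ≤ n → ∀ (θ : ℝ) (N : ℕ) (c : ℕ → ℝ),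
    (∫ τ, (∑ k ∈ Finset.range N, η (k/n) * c k * (JPol α β k).eval (Real.cos τ)) ^ 2 * qw n θ τ ^ j ∂(nu α β)) ≤
      C * ∫ τ, (∑ k ∈ Finset.range N, c k * (JPol α β k).eval (Real.cos τ)) ^ 2 * qw n θ τ ^ j ∂(nu α β) := by
  obtain ⟨R, M, hR, hM, hn⟩ := eta_h η hη α β hα hβ (j+2)
  set K := 2 ^ (j+4) * R * M * Real.pi with hK
  have hK0 : 0 ≤ K := by have := Real.pi_pos; positivity
  refine ⟨K ^ 2 + 1, by positivity, fun n hn1 θ N c => ?_⟩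
  obtain ⟨h, s1, s2, s3, s4, s5, s6⟩ := hn n hn1
  obtain ⟨m, m1, m2, m3, m4⟩ := ft_even j R M hR hM h s1 s2 s3 s4 s5
  have hn0 : (0:ℝ) < n := by exact_mod_cast hn1
  set v : ℝ → ℝ := fun τ => ∑ k ∈ Finset.range N, η (k/n) * c k * (JPol α β k).eval (Real.cos τ) with hv
  have vc : Continuous v := continuous_finsetSum _ fun k _ => continuous_const.mul (pc_cont _)
  have qc : Continuous (fun τ => qw n θ τ ^ j) := (qw_cont n θ).pow j
  have q0 : ∀ τ, 0 ≤ qw n θ τ ^ j := fun τ => pow_nonneg (qw_pos n θ τ).le j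
  set Y := ∫ τ, v τ ^ 2 * qw n θ τ ^ j ∂(nu α β) with hY
  set X := ∫ τ, vW α β N c 0 τ ^ 2 * qw n θ τ ^ j ∂(nu α β) with hX
  have eX : (∫ τ, (∑ k ∈ Finset.range N, c k * (JPol α β k).eval (Real.cos τ)) ^ 2 * qw n θ τ ^ j ∂(nu α β)) = X := by
    rw [hX]; congr 1; ext τ; unfold vW; simp
  rw [eX]
  have X0 : 0 ≤ X := integral_nonneg fun τ => mul_nonneg (sq_nonneg _) (q0 τ)
  have Y0 : 0 ≤ Y := integral_nonneg fun τ => mul_nonneg (sq_nonneg _) (q0 τ)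
  have vWc : ∀ t, Continuous (vW α β N c t) := slice _ (vW_cont α β N c)
  set B : ℝ → ℝ := fun t => ∫ τ, vW α β N c t τ * v τ * qw n θ τ ^ j ∂(nu α β) with hB
  have Bb : ∀ t, |B (2 * Real.pi * t / n)| ≤ (1 + 2 * Real.pi * |t|) ^ j * (Real.sqrt X * Real.sqrt Y) := by
    intro t
    set t' := 2 * Real.pi * t / n
    have h1 := wcs (nu α β) (vW α β N c t') v (fun τ => qw n θ τ ^ j) q0 (cont_int α β hα hβ (((vWc t').pow 2).mul qc))
      (cont_int α β hα hβ ((vc.pow 2).mul qc)) (cont_int α β hα hβ (((vWc t').mul vc).mul qc))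
    have h2 := wave_est α β N c n θ hα hβ hn0 j t'
    have e : n * |t'| = 2 * Real.pi * |t| := by
      have : (0:ℝ) < 2 * Real.pi := by positivity
      simp only [t']; rw [abs_div, abs_mul, abs_of_pos this, abs_of_pos hn0]; field_simp
    rw [e] at h2
    set P := (1 + 2 * Real.pi * |t|) ^ j with hP
    have P1 : 1 ≤ P := one_le_pow₀ (by have := mul_nonneg Real.pi_pos.le (abs_nonneg t); linarith)
    have h3 : B t' ^ 2 ≤ (P * X) * Y := h1.trans (mul_le_mul_of_nonneg_right h2 Y0)
    refine abs_le_of_sq_le_sq ?_ (by positivity) |> fun h => h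
    rw [mul_pow, mul_pow, Real.sq_sqrt X0, Real.sq_sqrt Y0]
    refine h3.trans ?_
    have : P ≤ P ^ 2 := by nlinarith
    calc P * X * Y = P * (X * Y) := by ring
      _ ≤ _ := mul_le_mul_of_nonneg_right this (by positivity)
  have mi : Integrable m := by
    refine m2.mono' m1.aestronglyMeasurable (Filter.Eventually.of_forall fun t => ?_)
    exact le_mul_of_one_le_right (norm_nonneg _) (one_le_pow₀ (by have := mul_nonneg Real.pi_pos.le (abs_nonneg t); linarith))
  have mci : ∀ a, Integrable (fun t => m t * Real.cos (2 * Real.pi * a * t)) := by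
    intro a
    refine mi.norm.mono' (m1.mul (by fun_prop)).aestronglyMeasurable (Filter.Eventually.of_forall fun t => ?_)
    rw [norm_mul]
    exact mul_le_of_le_one_right (norm_nonneg _) (by rw [Real.norm_eq_abs]; exact Real.abs_cos_le_one _)
  set b : ℕ → ℝ := fun k => ∫ τ, (JPol α β k).eval (Real.cos τ) * v τ * qw n θ τ ^ j ∂(nu α β) with hb
  have bi : ∀ k, Integrable (fun τ => (JPol α β k).eval (Real.cos τ) * v τ * qw n θ τ ^ j) (nu α β) := fun k =>
    cont_int α β hα hβ (((pc_cont _).mul vc).mul qc)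
  have eB : ∀ t, B t = ∑ k ∈ Finset.range N, c k * Real.cos (Af α β k * t) * b k := by
    intro t
    simp only [hB, vW, hb]
    simp only [Finset.sum_mul]
    rw [integral_finsetSum]
    · refine Finset.sum_congr rfl fun k _ => ?_
      rw [← integral_const_mul]
      congr 1; ext τ; ring
    · intro k _
      refine ((bi k).const_mul (c k * Real.cos (Af α β k * t))).congr (Filter.Eventually.of_forall fun τ => ?_)
      dsimp only; ring
  have eY : Y = ∫ t, m t * B (2 * Real.pi * t / n) := by
    have e1 : Y = ∑ k ∈ Finset.range N, η (k/n) * c k * b k := by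
      have : Y = ∫ τ, (∑ k ∈ Finset.range N, η (k/n) * c k * ((JPol α β k).eval (Real.cos τ) * v τ * qw n θ τ ^ j)) ∂(nu α β) := by
        rw [hY]; congr 1; ext τ
        rw [sq, show v τ * v τ * qw n θ τ ^ j = v τ * (v τ * qw n θ τ ^ j) by ring]
        conv_lhs => enter [1]; rw [hv]
        simp only
        rw [Finset.sum_mul]
        exact Finset.sum_congr rfl fun k _ => by ring
      rw [this, integral_finsetSum _ (fun k _ => (bi k).const_mul _)]
      refine Finset.sum_congr rfl fun k _ => integral_const_mul _ _
    rw [e1]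
    simp only [eB, Finset.mul_sum]
    have ig : ∀ k, Integrable (fun t => m t * (c k * Real.cos (Af α β k * (2 * Real.pi * t / n)) * b k)) := by
      intro k
      refine ((mci (Af α β k / n)).const_mul (c k * b k)).congr (Filter.Eventually.of_forall fun t => ?_)
      dsimp only
      rw [show 2 * Real.pi * (Af α β k / n) * t = Af α β k * (2 * Real.pi * t / n) by ring]; ring
    rw [integral_finsetSum _ (fun k _ => ig k)]
    refine Finset.sum_congr rfl fun k _ => ?_
    rw [← s6 k, m4, show ∀ z : ℝ, z * c k * b k = z * (c k * b k) from fun z => by ring, ← integral_mul_const]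
    congr 1; ext t
    rw [show 2 * Real.pi * (Af α β k / n) * t = Af α β k * (2 * Real.pi * t / n) by ring]; ring
  have fin : Y ≤ K * (Real.sqrt X * Real.sqrt Y) := by
    calc Y ≤ |Y| := le_abs_self _
      _ ≤ ∫ t, |m t| * (1 + 2 * Real.pi * |t|) ^ j * (Real.sqrt X * Real.sqrt Y) := by
        refine (congrArg abs eY).le.trans ?_
        rw [← Real.norm_eq_abs]
        refine norm_integral_le_of_norm_le (m2.mul_const _) (Filter.Eventually.of_forall fun t => ?_)
        rw [norm_mul, Real.norm_eq_abs, Real.norm_eq_abs, mul_assoc |m t|]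
        exact mul_le_mul_of_nonneg_left (Bb t) (abs_nonneg _)
      _ = (∫ t, |m t| * (1 + 2 * Real.pi * |t|) ^ j) * (Real.sqrt X * Real.sqrt Y) := integral_mul_const _ _
      _ ≤ _ := mul_le_mul_of_nonneg_right m3 (by positivity)
  set x := Real.sqrt X
  set y := Real.sqrt Y
  have hx : x ^ 2 = X := Real.sq_sqrt X0
  have hy : y ^ 2 = Y := Real.sq_sqrt Y0
  have hx0 : 0 ≤ x := Real.sqrt_nonneg _
  have hy0 : 0 ≤ y := Real.sqrt_nonneg _
  rw [← hy] at fin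
  rw [← hx, ← hy]
  have : y ≤ K * x := by
    by_contra hc
    push Not at hc
    have : 0 < y := lt_of_le_of_lt (by positivity) hc
    nlinarith
  nlinarith [mul_self_le_mul_self hy0 this, sq_nonneg x]

lemma int_dom {X : Type*} [MeasurableSpace X] {μ : Measure X} {F G H : X → ℝ} {a b : ℝ} (hF : Integrable F μ) (hG : Integrable G μ) (hH : Integrable H μ)
    (h : ∀ x, F x ≤ a * G x + b * H x) : (∫ x, F x ∂μ) ≤ a * (∫ x, G x ∂μ) + b * ∫ x, H x ∂μ := by
  rw [← integral_const_mul, ← integral_const_mul, ← integral_add (hG.const_mul a) (hH.const_mul b)]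
  exact integral_mono hF ((hG.const_mul a).add (hH.const_mul b)) h

lemma JSpan_rep (α β : ℝ) (m : ℕ) (P : Polynomial ℝ) (hP : P ∈ JSpan α β m) :
    ∃ c : ℕ → ℝ, P = ∑ k ∈ Finset.range (m+1), Polynomial.C (c k) * JPol α β k := by
  unfold JSpan at hP
  induction hP using Submodule.span_induction with
  | mem p hp =>
    obtain ⟨k, hk, rfl⟩ := hp
    have hk : k ≤ m := hk
    refine ⟨fun i => if i = k then 1 else 0, ?_⟩
    rw [Finset.sum_eq_single k]
    · simp
    · intro b _ hb; simp [hb]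
    · intro h; exact absurd (Finset.mem_range.2 (by omega)) h
  | zero => exact ⟨0, by simp⟩
  | add x y _ _ hx hy =>
    obtain ⟨c, rfl⟩ := hx
    obtain ⟨d, rfl⟩ := hy
    refine ⟨c + d, ?_⟩
    rw [← Finset.sum_add_distrib]
    refine Finset.sum_congr rfl fun k _ => ?_
    simp [add_mul]
  | smul a x _ hx =>
    obtain ⟨c, rfl⟩ := hx
    refine ⟨fun k => a * c k, ?_⟩
    rw [Finset.smul_sum]
    refine Finset.sum_congr rfl fun k _ => ?_
    rw [Polynomial.smul_eq_C_mul, Polynomial.C_mul, mul_assoc]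

lemma coeff_sum (α β : ℝ) (hα : -1 < α) (hβ : -1 < β) (N l : ℕ) (c : ℕ → ℝ) :
    coeff α β l (fun x => ∑ k ∈ Finset.range N, c k * (JPol α β k).eval x) = if l < N then c l else 0 := by
  induction N with
  | zero => simp [coeff, ip]
  | succ N ih =>
    simp only [Finset.sum_range_succ]
    have c1 : Continuous (fun x => ∑ k ∈ Finset.range N, c k * (JPol α β k).eval x) := continuous_finsetSum _ fun k _ => continuous_const.mul (Polynomial.continuous _)
    have c2 : Continuous (fun x => c N * (JPol α β N).eval x) := continuous_const.mul (Polynomial.continuous _)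
    rw [coeff_add α β hα hβ c1 c2, ih,
      coeff_smul, coeff_J α β hα hβ]
    rcases lt_trichotomy l N with h | h | h
    · simp [h, h.ne, Nat.lt_succ_of_lt h]
    · subst h; simp
    · rw [if_neg (by omega), if_neg (by omega), if_neg (by omega)]; simp

lemma V_sum (η : ℝ → ℝ) (hη : Admissible η) (α β : ℝ) (hα : -1 < α) (hβ : -1 < β) (n N : ℕ) (hn : 1 ≤ n) (hN : 2 * n + 1 ≤ N) (c : ℕ → ℝ) (x : ℝ) :
    V η α β n (fun x => ∑ k ∈ Finset.range N, c k * (JPol α β k).eval x) x = ∑ k ∈ Finset.range N, η (k/n) * c k * (JPol α β k).eval x := by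
  unfold V
  simp only [coeff_sum α β hα hβ]
  have hn0 : (0:ℝ) < n := by exact_mod_cast hn
  rw [← Finset.sum_subset (Finset.range_mono hN)]
  · refine Finset.sum_congr rfl fun k hk => ?_
    rw [if_pos (by have := Finset.mem_range.1 hk; omega), JPol_eval]
  · intro k _ hk
    rw [hη.2.2 _ ?_]
    · simp
    · rw [le_div_iff₀ hn0]
      have : 2 * n ≤ k := by rw [Finset.mem_range] at hk; omega
      exact_mod_cast this

lemma mult_pol (η : ℝ → ℝ) (hη : Admissible η) (α β : ℝ) (hα : -1 < α) (hβ : -1 < β) (j : ℕ) : ∃ C, 0 < C ∧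
    ∀ n : ℕ, 1 ≤ n → ∀ (θ : ℝ) (q : Polynomial ℝ),
    (∫ τ, (V η α β n (fun x => q.eval x) (Real.cos τ)) ^ 2 * qw n θ τ ^ j ∂(nu α β)) ≤
      C * ∫ τ, (q.eval (Real.cos τ)) ^ 2 * qw n θ τ ^ j ∂(nu α β) := by
  obtain ⟨C, hC, h⟩ := mult_poly η hη α β hα hβ j
  refine ⟨C, hC, fun n hn θ q => ?_⟩
  obtain ⟨c, hc⟩ := JSpan_rep α β (max q.natDegree (2*n)) q (poly_mem α β hα hβ _ q (le_max_left _ _))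
  have e : (fun x => q.eval x) = fun x => ∑ k ∈ Finset.range (max q.natDegree (2*n) + 1), c k * (JPol α β k).eval x := by
    ext x; conv_lhs => rw [hc]
    rw [Polynomial.eval_finsetSum]; simp
  have e' : ∀ x, q.eval x = ∑ k ∈ Finset.range (max q.natDegree (2*n) + 1), c k * (JPol α β k).eval x := fun x => congrFun e x
  have := h n hn θ (max q.natDegree (2*n) + 1) c
  simp only [← e'] at this
  refine le_trans (le_of_eq ?_) this
  rw [e]
  simp only [V_sum η hη α β hα hβ n (max q.natDegree (2*n) + 1) hn (by have := le_max_right q.natDegree (2*n); omega) c]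

lemma mult_cont (η : ℝ → ℝ) (hη : Admissible η) (α β : ℝ) (hα : -1 < α) (hβ : -1 < β) (j : ℕ) : ∃ C, 0 < C ∧
    ∀ n : ℕ, 1 ≤ n → ∀ (θ : ℝ) (g : ℝ → ℝ), Continuous g → 
    (∫ τ, (V η α β n g (Real.cos τ)) ^ 2 * qw n θ τ ^ j ∂(nu α β)) ≤
      C * ∫ τ, (g (Real.cos τ)) ^ 2 * qw n θ τ ^ j ∂(nu α β) := by
  obtain ⟨C, hC, h⟩ := mult_pol η hη α β hα hβ j
  refine ⟨4 * C, by linarith, fun n hn θ g hg => ?_⟩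
  have hfin := nu_finite α β hα hβ
  -- bound for kernel
  obtain ⟨K, hK⟩ := (isCompact_Icc.prod isCompact_Icc).exists_bound_of_continuousOn (s := Icc (-1:ℝ) 1 ×ˢ Icc (-1:ℝ) 1) (KV_cont η α β n).continuousOn
  have hK0 : 0 ≤ K := (norm_nonneg _).trans (hK (1,1) (by simp))
  set mass := (nu α β).real univ with hmass
  have cmem : ∀ τ, Real.cos τ ∈ Icc (-1:ℝ) 1 := fun τ => ⟨Real.neg_one_le_cos τ, Real.cos_le_one τ⟩
  have Vb : ∀ (f : ℝ → ℝ), Continuous f → ∀ ε, (∀ x ∈ Icc (-1:ℝ) 1, |f x| ≤ ε) → ∀ τ, |V η α β n f (Real.cos τ)| ≤ ε * K * mass := by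
    intro f hf ε hε τ
    rw [V_kernel η α β hα hβ n hf, ← Real.norm_eq_abs]
    refine (norm_integral_le_of_norm_le_const (C := ε * K) (Filter.Eventually.of_forall fun s => ?_)).trans (le_of_eq rfl)
    rw [norm_mul, Real.norm_eq_abs]
    exact mul_le_mul (hε _ (cmem s)) (hK (_, _) ⟨cmem τ, cmem s⟩) (norm_nonneg _) ((abs_nonneg _).trans (hε _ (cmem s)))
  have qc : Continuous (fun τ => qw n θ τ ^ j) := (qw_cont n θ).pow j
  have q0 : ∀ τ, 0 ≤ qw n θ τ ^ j := fun τ => pow_nonneg (qw_pos n θ τ).le j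
  set Q := ∫ τ, qw n θ τ ^ j ∂(nu α β) with hQ
  have Q0 : 0 ≤ Q := integral_nonneg q0
  have cc : Continuous Real.cos := Real.continuous_cos
  set X := ∫ τ, (g (Real.cos τ)) ^ 2 * qw n θ τ ^ j ∂(nu α β) with hX
  set Y := ∫ τ, (V η α β n g (Real.cos τ)) ^ 2 * qw n θ τ ^ j ∂(nu α β) with hY
  have key : ∀ ε, 0 < ε → Y ≤ 4 * C * X + ε ^ 2 * (2 * (K * mass) ^ 2 * Q + 4 * C * Q) := by
    intro ε hε
    obtain ⟨q, hq⟩ := exists_polynomial_near_of_continuousOn (-1) 1 g hg.continuousOn ε hε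
    have qpc : Continuous (fun x => q.eval x) := q.continuous
    have h1 := h n hn θ q
    have cq := qpc.comp cc
    have cg := hg.comp cc
    have cV : ∀ f, Continuous (fun τ => V η α β n f (Real.cos τ)) := fun f => (V_cont η α β n f).comp cc
    have h2 : Y ≤ 2 * (∫ τ, (V η α β n (fun x => q.eval x) (Real.cos τ)) ^ 2 * qw n θ τ ^ j ∂(nu α β)) + 2 * (ε * K * mass) ^ 2 * Q := by
      refine int_dom (cont_int α β hα hβ (((cV _).pow 2).mul qc)) (cont_int α β hα hβ (((cV _).pow 2).mul qc)) (cont_int α β hα hβ qc) fun τ => ?_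
      have e := V_sub η α β hα hβ n hg qpc (Real.cos τ)
      have b := Vb (fun x => g x - q.eval x) (hg.sub qpc) ε (fun x hx => by rw [abs_sub_comm]; exact (hq x hx).le) τ
      rw [e] at b
      have b2 := sq_le_sq' (abs_le.1 b).1 (abs_le.1 b).2
      have := q0 τ
      have : (V η α β n g (Real.cos τ)) ^ 2 ≤ 2 * (V η α β n (fun x => q.eval x) (Real.cos τ)) ^ 2 + 2 * (ε * K * mass) ^ 2 := by
        nlinarith [sq_nonneg (V η α β n g (Real.cos τ) - 2 * V η α β n (fun x => q.eval x) (Real.cos τ))]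
      nlinarith
    have h3 : (∫ τ, (q.eval (Real.cos τ)) ^ 2 * qw n θ τ ^ j ∂(nu α β)) ≤ 2 * X + 2 * ε ^ 2 * Q := by
      refine int_dom (cont_int α β hα hβ ((cq.pow 2).mul qc)) (cont_int α β hα hβ ((cg.pow 2).mul qc)) (cont_int α β hα hβ qc) fun τ => ?_
      have b := (hq (Real.cos τ) (cmem τ)).le
      have b2 := sq_le_sq' (abs_le.1 b).1 (abs_le.1 b).2
      have := q0 τ
      have : (q.eval (Real.cos τ)) ^ 2 ≤ 2 * (g (Real.cos τ)) ^ 2 + 2 * ε ^ 2 := by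
        nlinarith [sq_nonneg (q.eval (Real.cos τ) - 2 * g (Real.cos τ))]
      nlinarith
    have h4 := mul_le_mul_of_nonneg_left h3 hC.le
    nlinarith
  refine le_of_forall_pos_le_add fun δ hδ => ?_
  set W := (2 * (K * mass) ^ 2 * Q + 4 * C * Q) with hW
  have W0 : 0 ≤ W := by positivity
  refine (key (Real.sqrt (δ / (W + 1))) (by positivity)).trans ?_
  rw [Real.sq_sqrt (by positivity)]
  have : δ / (W + 1) * W ≤ δ := by
    rw [div_mul_eq_mul_div, div_le_iff₀ (by positivity)]; nlinarith
  linarith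

/-- trigonometric polynomials of degree at most m -/
def TP (m : ℕ) (f : ℝ → ℝ) : Prop := ∃ P : Polynomial ℂ, P.natDegree ≤ 2 * m ∧
  ∀ τ : ℝ, (f τ : ℂ) = Complex.exp (-(m * τ * Complex.I)) * P.eval (Complex.exp (τ * Complex.I))

lemma TP_mul {m l : ℕ} {f g : ℝ → ℝ} (hf : TP m f) (hg : TP l g) : TP (m + l) (fun τ => f τ * g τ) := by
  obtain ⟨P, hP, eP⟩ := hf
  obtain ⟨Q, hQ, eQ⟩ := hg
  refine ⟨P * Q, Polynomial.natDegree_mul_le.trans (by omega), fun τ => ?_⟩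
  rw [Polynomial.eval_mul, Complex.ofReal_mul, eP, eQ]
  rw [show (-(((m + l : ℕ) : ℂ) * τ * Complex.I)) = -(m * τ * Complex.I) + -(l * τ * Complex.I) by push_cast; ring, Complex.exp_add]
  ring

lemma TP_mono {m l : ℕ} {f : ℝ → ℝ} (hf : TP m f) (h : m ≤ l) : TP l f := by
  obtain ⟨P, hP, eP⟩ := hf
  refine ⟨Polynomial.X ^ (l - m) * P, Polynomial.natDegree_mul_le.trans (by rw [Polynomial.natDegree_X_pow]; omega), fun τ => ?_⟩
  rw [Polynomial.eval_mul, Polynomial.eval_pow, Polynomial.eval_X, eP, ← Complex.exp_nat_mul, ← mul_assoc, ← Complex.exp_add]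
  congr 2
  push_cast [h]; ring

lemma TP_add {m : ℕ} {f g : ℝ → ℝ} (hf : TP m f) (hg : TP m g) : TP m (fun τ => f τ + g τ) := by
  obtain ⟨P, hP, eP⟩ := hf
  obtain ⟨Q, hQ, eQ⟩ := hg
  refine ⟨P + Q, (Polynomial.natDegree_add_le _ _).trans (max_le hP hQ), fun τ => ?_⟩
  rw [Polynomial.eval_add, Complex.ofReal_add, eP, eQ]; ring

lemma TP_smul {m : ℕ} {f : ℝ → ℝ} (hf : TP m f) (c : ℝ) : TP m (fun τ => c * f τ) := by
  obtain ⟨P, hP, eP⟩ := hf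
  refine ⟨Polynomial.C (c:ℂ) * P, (Polynomial.natDegree_C_mul_le _ _).trans hP, fun τ => ?_⟩
  rw [Polynomial.eval_mul, Polynomial.eval_C, Complex.ofReal_mul, eP]; ring

lemma TP_const (m : ℕ) (c : ℝ) : TP m (fun _ => c) := by
  refine TP_mono (m := 0) ⟨Polynomial.C (c:ℂ), by simp, fun τ => by simp⟩ (Nat.zero_le _)

lemma TP_cos (k : ℕ) (θ : ℝ) : TP k (fun τ => Real.cos (k * (τ - θ))) := by
  refine ⟨Polynomial.C (Complex.exp (-(k * θ * Complex.I)) / 2) * Polynomial.X ^ (2 * k) + Polynomial.C (Complex.exp (k * θ * Complex.I) / 2), ?_, fun τ => ?_⟩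
  · refine (Polynomial.natDegree_add_le _ _).trans (max_le ((Polynomial.natDegree_C_mul_le _ _).trans (by simp)) (by simp))
  · simp only [Polynomial.eval_add, Polynomial.eval_mul, Polynomial.eval_C, Polynomial.eval_pow, Polynomial.eval_X]
    rw [Complex.ofReal_cos, Complex.cos, ← Complex.exp_nat_mul, mul_add, ← mul_div_assoc, div_mul_eq_mul_div, ← mul_div_assoc, ← Complex.exp_add, ← Complex.exp_add, ← Complex.exp_add, add_div]
    push_cast
    congr 3 <;> ring

lemma TP_pow {m : ℕ} {f : ℝ → ℝ} (hf : TP m f) (k : ℕ) : TP (k * m) (fun τ => f τ ^ k) := by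
  induction k with
  | zero => simpa using TP_const 0 1
  | succ k ih =>
    have := TP_mul ih hf
    simp only [pow_succ]
    rw [show (k+1) * m = k * m + m by ring]; exact this

lemma TP_sum {m : ℕ} {ι : Type*} (s : Finset ι) (f : ι → ℝ → ℝ) (hf : ∀ i ∈ s, TP m (f i)) : TP m (fun τ => ∑ i ∈ s, f i τ) := by
  classical
  induction s using Finset.induction_on with
  | empty => simpa using TP_const m 0
  | insert a s ha ih =>
    simp only [Finset.sum_insert ha]
    exact TP_add (hf a (Finset.mem_insert_self _ _)) (ih fun i hi => hf i (Finset.mem_insert_of_mem hi))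

lemma TP_poly (q : Polynomial ℝ) (m : ℕ) (hq : q.natDegree ≤ m) : TP m (fun τ => q.eval (Real.cos τ)) := by
  simp only [Polynomial.eval_eq_sum_range]
  refine TP_sum _ _ fun i hi => ?_
  refine TP_mono (m := i) (TP_smul ?_ _) (by have := Finset.mem_range.1 hi; omega)
  have := TP_pow (TP_cos 1 0) i
  simpa using this

lemma int_exp (k : ℤ) (hk : k ≠ 0) : ∫ τ in (-Real.pi)..Real.pi, Complex.exp ((k * Complex.I) * τ) = 0 := by
  have hc : (k * Complex.I : ℂ) ≠ 0 := mul_ne_zero (by exact_mod_cast hk) Complex.I_ne_zero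
  rw [integral_exp_mul_complex hc]
  have : Complex.exp (k * Complex.I * (Real.pi:ℝ)) = Complex.exp (k * Complex.I * ((-Real.pi:ℝ):ℂ)) := by
    rw [Complex.exp_eq_exp_iff_exists_int]
    exact ⟨k, by push_cast; ring⟩
  rw [this]; simp

lemma coef_int (P : Polynomial ℂ) (k : ℕ) : (∫ τ in (-Real.pi)..Real.pi, P.eval (Complex.exp (τ * Complex.I)) * Complex.exp (-(k * τ * Complex.I))) = 2 * Real.pi * P.coeff k := by
  have e : ∀ τ : ℝ, P.eval (Complex.exp (τ * Complex.I)) * Complex.exp (-(k * τ * Complex.I)) =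
      ∑ i ∈ Finset.range (max P.natDegree k + 1), P.coeff i * Complex.exp ((((i:ℤ) - (k:ℤ) : ℤ) * Complex.I) * τ) := by
    intro τ
    rw [Polynomial.eval_eq_sum_range' (n := max P.natDegree k + 1) (by have := le_max_left P.natDegree k; omega), Finset.sum_mul]
    refine Finset.sum_congr rfl fun i _ => ?_
    rw [mul_assoc, ← Complex.exp_nat_mul, ← Complex.exp_add]
    congr 2; push_cast; ring
  simp only [e]
  rw [intervalIntegral.integral_finsetSum]
  · rw [Finset.sum_eq_single k]
    · simp; left; ring
    · intro i _ hi
      rw [intervalIntegral.integral_const_mul, int_exp _ (by omega), mul_zero]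
    · intro h; exact absurd (Finset.mem_range.2 (by have := le_max_right P.natDegree k; omega)) h
  · intro i _
    exact Continuous.intervalIntegrable (by fun_prop) _ _

lemma nikolskii {m : ℕ} {f : ℝ → ℝ} (hf : TP m f) (θ : ℝ) : |f θ| ≤ (2 * m + 1) * ∫ τ in (-Real.pi)..Real.pi, |f τ| := by
  obtain ⟨P, hP, eP⟩ := hf
  have hn : ∀ τ, |f τ| = ‖P.eval (Complex.exp (τ * Complex.I))‖ := by
    intro τ
    rw [← Real.norm_eq_abs, ← Complex.norm_real, eP, norm_mul,
      show (-(m * τ * Complex.I) : ℂ) = ((-(m * τ) : ℝ) : ℂ) * Complex.I by push_cast; ring, Complex.norm_exp_ofReal_mul_I, one_mul]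
  have hc : ∀ k, ‖P.coeff k‖ ≤ ∫ τ in (-Real.pi)..Real.pi, |f τ| := by
    intro k
    have h := coef_int P k
    have h1 : ‖∫ τ in (-Real.pi)..Real.pi, P.eval (Complex.exp (τ * Complex.I)) * Complex.exp (-(k * τ * Complex.I))‖ ≤ ∫ τ in (-Real.pi)..Real.pi, |f τ| := by
      refine (intervalIntegral.norm_integral_le_integral_norm (by linarith [Real.pi_pos])).trans (le_of_eq ?_)
      congr 1; ext τ
      rw [norm_mul, hn, show (-(k * τ * Complex.I) : ℂ) = ((-(k * τ) : ℝ) : ℂ) * Complex.I by push_cast; ring, Complex.norm_exp_ofReal_mul_I, mul_one]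
    rw [h, norm_mul, norm_mul, Complex.norm_real, Real.norm_eq_abs, abs_of_pos Real.pi_pos, Complex.norm_ofNat] at h1
    refine le_trans ?_ h1
    exact le_mul_of_one_le_left (norm_nonneg _) (by linarith [Real.pi_gt_three])
  rw [hn, Polynomial.eval_eq_sum_range' (n := 2 * m + 1) (by omega)]
  calc _ ≤ ∑ i ∈ Finset.range (2 * m + 1), ‖P.coeff i * Complex.exp (θ * Complex.I) ^ i‖ := norm_sum_le _ _
    _ ≤ ∑ i ∈ Finset.range (2 * m + 1), ∫ τ in (-Real.pi)..Real.pi, |f τ| := by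
      refine Finset.sum_le_sum fun i _ => ?_
      rw [norm_mul, norm_pow, Complex.norm_exp_ofReal_mul_I, one_pow, mul_one]
      exact hc i
    _ = _ := by simp

/-- Dirichlet kernel -/
def Dk (l : ℕ) (u : ℝ) : ℝ := 1 + 2 * ∑ k ∈ Finset.range l, Real.cos ((k + 1 : ℕ) * u)

lemma Dk_sin (l : ℕ) (u : ℝ) : Dk l u * Real.sin (u/2) = Real.sin ((2 * l + 1) * (u/2)) := by
  induction l with
  | zero => simp [Dk]
  | succ l ih =>
    unfold Dk at *
    rw [Finset.sum_range_succ, mul_add, ← add_assoc, add_mul, ih]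
    push_cast
    rw [show (2 * ((l:ℝ) + 1) + 1) * (u/2) = (l + 1) * u + u/2 by ring, show (2 * (l:ℝ) + 1) * (u/2) = (l + 1) * u - u/2 by ring,
      Real.sin_add, Real.sin_sub]
    ring

lemma Dk_cont (l : ℕ) : Continuous (Dk l) := by unfold Dk; fun_prop

lemma Dk_zero (l : ℕ) : Dk l 0 = 2 * l + 1 := by simp [Dk]; ring

lemma Dk_neg (l : ℕ) (u : ℝ) : Dk l (-u) = Dk l u := by
  unfold Dk; simp only [mul_neg, Real.cos_neg]

lemma Dk_per (l : ℕ) (u : ℝ) : Dk l (u + 2 * Real.pi) = Dk l u := by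
  unfold Dk
  congr 2
  refine Finset.sum_congr rfl fun k _ => ?_
  rw [mul_add, Real.cos_add_nat_mul_two_pi]

lemma Dk_le (l : ℕ) (u : ℝ) : |Dk l u| ≤ 2 * l + 1 := by
  unfold Dk
  calc _ ≤ |(1:ℝ)| + |2 * ∑ k ∈ Finset.range l, Real.cos ((k + 1 : ℕ) * u)| := abs_add_le _ _
    _ ≤ 1 + 2 * ∑ k ∈ Finset.range l, (1:ℝ) := by
      rw [abs_one, abs_mul, abs_two]
      gcongr
      exact (Finset.abs_sum_le_sum_abs _ _).trans (Finset.sum_le_sum fun k _ => Real.abs_cos_le_one _)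
    _ = _ := by simp; ring

lemma Dk_bound {l : ℕ} {u d n K : ℝ} (hn : 0 ≤ n) (hK : 0 ≤ K) (h1 : |d| / Real.pi ≤ |Real.sin (u/2)|) (h2 : n ≤ K * (2 * l + 1)) :
    |Dk l u / (2 * l + 1)| ≤ (1 + K * Real.pi) * (1 + n * |d|)⁻¹ := by
  have hl : (0:ℝ) < 2 * l + 1 := by positivity
  rw [abs_div, abs_of_pos hl, ← div_eq_mul_inv, div_le_div_iff₀ hl (by positivity)]
  have a1 := Dk_le l u
  have a2 : |Dk l u| * |d| ≤ Real.pi := by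
    have : |Dk l u| * |Real.sin (u/2)| ≤ 1 := by rw [← abs_mul, Dk_sin]; exact Real.abs_sin_le_one _
    have : |Dk l u| * (|d| / Real.pi) ≤ 1 := (mul_le_mul_of_nonneg_left h1 (abs_nonneg _)).trans this
    rw [← mul_div_assoc, div_le_one Real.pi_pos] at this
    exact this
  have a3 : n * (|Dk l u| * |d|) ≤ (K * (2 * l + 1)) * Real.pi := mul_le_mul h2 a2 (by positivity) (by positivity)
  nlinarith

lemma sin_half_ge {d : ℝ} (hd : |d| ≤ Real.pi) : |d| / Real.pi ≤ |Real.sin (d/2)| := by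
  have h := Real.mul_le_sin (x := |d|/2) (by positivity) (by linarith)
  have e : |Real.sin (d/2)| = Real.sin (|d|/2) := by
    rw [← abs_of_nonneg (a := Real.sin (|d|/2))]
    · rcases abs_choice d with h | h <;> rw [h]
      rw [neg_div, Real.sin_neg, abs_neg]
    · exact Real.sin_nonneg_of_nonneg_of_le_pi (by positivity) (by linarith [Real.pi_pos])
  rw [e]
  refine le_trans (le_of_eq ?_) h
  field_simp

lemma sin_half_fold {a b : ℝ} (ha : a ∈ Icc 0 Real.pi) (hb : b ∈ Icc 0 Real.pi) : |Real.sin ((a - b)/2)| ≤ |Real.sin ((a + b)/2)| := by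
  rw [← sq_le_sq]
  have h1 := Real.sin_nonneg_of_mem_Icc ha
  have h2 := Real.sin_nonneg_of_mem_Icc hb
  have e : Real.sin ((a+b)/2) ^ 2 - Real.sin ((a-b)/2) ^ 2 = Real.sin a * Real.sin b := by
    rw [show a = 2 * (a/2) by ring, show b = 2 * (b/2) by ring, Real.sin_two_mul, Real.sin_two_mul,
      show (2 * (a/2) + 2 * (b/2))/2 = a/2 + b/2 by ring, show (2 * (a/2) - 2 * (b/2))/2 = a/2 - b/2 by ring, Real.sin_add, Real.sin_sub]
    ring
  nlinarith [mul_nonneg h1 h2]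

lemma abs_sub_le_pi {a b : ℝ} (ha : a ∈ Icc 0 Real.pi) (hb : b ∈ Icc 0 Real.pi) : |a - b| ≤ Real.pi := by
  rw [abs_le]; constructor <;> linarith [ha.1, ha.2, hb.1, hb.2]

lemma Jk_bound (M : ℕ) {l : ℕ} {a b n K : ℝ} (hn : 0 ≤ n) (hK : 0 ≤ K) (h2 : n ≤ K * (2 * l + 1)) (ha : a ∈ Icc 0 Real.pi) (hb : b ∈ Icc 0 Real.pi) :
    |Dk l (a - b) / (2 * l + 1)| ^ M ≤ (1 + K * Real.pi) ^ M * dk M n (a - b) ∧ |Dk l (a + b) / (2 * l + 1)| ^ M ≤ (1 + K * Real.pi) ^ M * dk M n (a - b) := by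
  have h := sin_half_ge (abs_sub_le_pi ha hb)
  have b1 := Dk_bound (l := l) hn hK h h2
  have b2 := Dk_bound (l := l) hn hK (h.trans (sin_half_fold ha hb)) h2
  unfold dk
  rw [← inv_pow, ← mul_pow]
  exact ⟨pow_le_pow_left₀ (abs_nonneg _) b1 M, pow_le_pow_left₀ (abs_nonneg _) b2 M⟩

lemma TP_Dk (l : ℕ) (θ : ℝ) : TP l (fun τ => Dk l (τ - θ) / (2 * l + 1)) := by
  have : (fun τ => Dk l (τ - θ) / (2 * l + 1)) = fun τ => (2 * l + 1 : ℝ)⁻¹ * (1 + 2 * ∑ k ∈ Finset.range l, Real.cos ((k + 1 : ℕ) * (τ - θ))) := by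
    ext τ; unfold Dk; ring
  rw [this]
  refine TP_smul (TP_add (TP_const _ _) (TP_smul (TP_sum _ _ fun k hk => ?_) _)) _
  exact TP_mono (TP_cos (k+1) θ) (by have := Finset.mem_range.1 hk; omega)

/-- local L1 bound for polynomials of degree 2n -/
lemma local_bound (M : ℕ) : ∃ C, 0 < C ∧ ∀ n : ℕ, 1 ≤ n → ∀ q : Polynomial ℝ, q.natDegree ≤ 2 * n → ∀ θ ∈ Icc 0 Real.pi,
    |q.eval (Real.cos θ)| ≤ C * n * ∫ τ in (0:ℝ)..Real.pi, |q.eval (Real.cos τ)| * dk M n (τ - θ) := by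
  refine ⟨(2 * M + 5) * (2 * (1 + 1 * Real.pi) ^ M), by have := Real.pi_pos; positivity, fun n hn q hq θ hθ => ?_⟩
  have hn1 : (1:ℝ) ≤ n := by exact_mod_cast hn
  set G : ℝ → ℝ := fun τ => q.eval (Real.cos τ) * (Dk n (τ - θ) / (2 * n + 1)) ^ M with hG
  have hTP : TP (2 * n + M * n) G := TP_mul (TP_poly q (2*n) hq) (TP_pow (TP_Dk n θ) M)
  have h1 := nikolskii hTP θ
  have e1 : G θ = q.eval (Real.cos θ) := by
    have : (2 * (n:ℝ) + 1) ≠ 0 := by positivity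
    simp only [hG, sub_self, Dk_zero, div_self this, one_pow, mul_one]
  rw [e1] at h1
  have Gc : Continuous G := by
    have := Dk_cont n
    simp only [hG]
    exact (pc_cont q).mul (((this.comp (by fun_prop)).div_const _).pow M)
  have dc : Continuous (fun τ => dk M n (τ - θ)) := dk_cont' _ _ (by linarith)
  have hq2 : Continuous (fun τ => |q.eval (Real.cos τ)| * dk M n (τ - θ)) := (pc_cont q).abs.mul dc
  set I := ∫ τ in (0:ℝ)..Real.pi, |q.eval (Real.cos τ)| * dk M n (τ - θ) with hI
  have hpi := Real.pi_pos
  have b1 : (∫ τ in (0:ℝ)..Real.pi, |G τ|) ≤ (1 + 1 * Real.pi) ^ M * I := by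
    rw [hI, ← intervalIntegral.integral_const_mul]
    refine intervalIntegral.integral_mono_on hpi.le (Gc.abs.intervalIntegrable _ _) ((continuous_const.mul hq2).intervalIntegrable _ _) fun τ hτ => ?_
    simp only [hG, abs_mul, abs_pow]
    have := (Jk_bound M (l := n) (n := n) (K := 1) (by linarith) (by norm_num) (by linarith) hτ hθ).1
    calc _ ≤ |q.eval (Real.cos τ)| * ((1 + 1 * Real.pi) ^ M * dk M n (τ - θ)) := mul_le_mul_of_nonneg_left this (abs_nonneg _)
      _ = _ := by ring
  have b2 : (∫ τ in (-Real.pi)..0, |G τ|) ≤ (1 + 1 * Real.pi) ^ M * I := by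
    have : (∫ τ in (-Real.pi)..0, |G τ|) = ∫ τ in (0:ℝ)..Real.pi, |G (-τ)| := by
      rw [intervalIntegral.integral_comp_neg (fun τ => |G τ|)]; simp
    rw [this, hI, ← intervalIntegral.integral_const_mul]
    refine intervalIntegral.integral_mono_on hpi.le ((Gc.comp continuous_neg).abs.intervalIntegrable _ _) ((continuous_const.mul hq2).intervalIntegrable _ _) fun τ hτ => ?_
    simp only [hG, abs_mul, abs_pow, Real.cos_neg]
    rw [show -τ - θ = -(τ + θ) by ring, Dk_neg]
    have := (Jk_bound M (l := n) (n := n) (K := 1) (by linarith) (by norm_num) (by linarith) hτ hθ).2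
    calc _ ≤ |q.eval (Real.cos τ)| * ((1 + 1 * Real.pi) ^ M * dk M n (τ - θ)) := mul_le_mul_of_nonneg_left this (abs_nonneg _)
      _ = _ := by ring
  rw [← intervalIntegral.integral_add_adjacent_intervals (Gc.abs.intervalIntegrable (-Real.pi) 0) (Gc.abs.intervalIntegrable 0 Real.pi)] at h1
  refine h1.trans ?_
  have I0 : 0 ≤ I := intervalIntegral.integral_nonneg hpi.le fun τ _ => mul_nonneg (abs_nonneg _) (dk_pos M (by linarith) ).le
  calc _ ≤ (2 * ((2 * n + M * n : ℕ):ℝ) + 1) * ((1 + 1 * Real.pi) ^ M * I + (1 + 1 * Real.pi) ^ M * I) := by gcongr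
    _ ≤ ((2 * M + 5) * n) * ((1 + 1 * Real.pi) ^ M * I + (1 + 1 * Real.pi) ^ M * I) := by
      refine mul_le_mul_of_nonneg_right ?_ (by positivity)
      push_cast; nlinarith
    _ = _ := by ring

lemma absorb (N : ℕ) : ∃ C δ : ℝ, 0 < C ∧ 0 < δ ∧ δ ≤ 1 ∧ ∀ n : ℕ, 1 ≤ n → ∀ q : Polynomial ℝ, q.natDegree ≤ 2 * n → ∀ θ ∈ Icc 0 Real.pi,
    |q.eval (Real.cos θ)| ≤ C * n * ∫ τ in (δ/n)..(Real.pi - δ/n), |q.eval (Real.cos τ)| * dk N n (τ - θ) := by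
  obtain ⟨C0, hC0, H0⟩ := local_bound N
  set C := C0 + 1 with hCd
  have hC : 0 < C := by linarith
  have H : ∀ n : ℕ, 1 ≤ n → ∀ q : Polynomial ℝ, q.natDegree ≤ 2 * n → ∀ θ ∈ Icc 0 Real.pi,
    |q.eval (Real.cos θ)| ≤ C * n * ∫ τ in (0:ℝ)..Real.pi, |q.eval (Real.cos τ)| * dk N n (τ - θ) := by
    intro n hn q hq θ hθ
    have hn0 : (0:ℝ) < n := by exact_mod_cast hn
    refine (H0 n hn q hq θ hθ).trans ?_
    have : 0 ≤ ∫ τ in (0:ℝ)..Real.pi, |q.eval (Real.cos τ)| * dk N n (τ - θ) :=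
      intervalIntegral.integral_nonneg Real.pi_pos.le fun τ _ => mul_nonneg (abs_nonneg _) (dk_pos N hn0).le
    gcongr
    linarith
  refine ⟨2 * C, 1/(4*C), by positivity, by positivity, ?_, fun n hn q hq θ0 hθ0 => ?_⟩
  · rw [div_le_one (by positivity)]; linarith
  have hn1 : (1:ℝ) ≤ n := by exact_mod_cast hn
  have hn0 : (0:ℝ) < n := by linarith
  set F : ℝ → ℝ := fun τ => |q.eval (Real.cos τ)| * dk N n (τ - θ0) with hF
  have Fc : Continuous F := (pc_cont q).abs.mul (dk_cont' _ _ hn0)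
  have F0 : ∀ τ, 0 ≤ F τ := fun τ => mul_nonneg (abs_nonneg _) (dk_pos N hn0).le
  obtain ⟨θ1, hθ1, hmax⟩ := isCompact_Icc.exists_isMaxOn ⟨θ0, hθ0⟩ (f := F) Fc.continuousOn
  set Ms := F θ1 with hMs
  have h1 : Ms ≤ C * n * ∫ τ in (0:ℝ)..Real.pi, F τ := by
    calc Ms = |q.eval (Real.cos θ1)| * dk N n (θ1 - θ0) := rfl
      _ ≤ (C * n * ∫ τ in (0:ℝ)..Real.pi, |q.eval (Real.cos τ)| * dk N n (τ - θ1)) * dk N n (θ1 - θ0) := 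
        mul_le_mul_of_nonneg_right (H n hn q hq θ1 hθ1) (dk_pos N hn0).le
      _ = C * n * ∫ τ in (0:ℝ)..Real.pi, |q.eval (Real.cos τ)| * dk N n (τ - θ1) * dk N n (θ1 - θ0) := by
        rw [intervalIntegral.integral_mul_const]; ring
      _ ≤ _ := by
        refine mul_le_mul_of_nonneg_left ?_ (by positivity)
        refine intervalIntegral.integral_mono_on Real.pi_pos.le ?_ (Fc.intervalIntegrable _ _) fun τ _ => ?_
        · exact ((((pc_cont q).abs.mul (dk_cont' _ _ hn0)).mul continuous_const).intervalIntegrable _ _)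
        · simp only [hF]
          rw [mul_assoc]
          exact mul_le_mul_of_nonneg_left (dk_mul_le N hn0 _ _ _) (abs_nonneg _)
  set d := 1/(4*C)/n with hd
  have hd0 : 0 < d := by positivity
  have hdC : C * n * d = 1/4 := by rw [hd]; field_simp
  have hd1 : d ≤ 1 := by
    rw [hd, div_div, div_le_one (by positivity)]
    nlinarith
  have hpi := Real.pi_gt_three
  have s1 : (∫ τ in (0:ℝ)..d, F τ) ≤ d * Ms := by
    calc _ ≤ ∫ τ in (0:ℝ)..d, Ms := intervalIntegral.integral_mono_on hd0.le (Fc.intervalIntegrable _ _) (by simp) fun τ hτ => hmax ⟨hτ.1, by linarith [hτ.2]⟩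
      _ = _ := by simp
  have s2 : (∫ τ in (Real.pi - d)..Real.pi, F τ) ≤ d * Ms := by
    calc _ ≤ ∫ τ in (Real.pi - d)..Real.pi, Ms := intervalIntegral.integral_mono_on (by linarith) (Fc.intervalIntegrable _ _) (by simp) fun τ hτ => hmax ⟨by linarith [hτ.1], hτ.2⟩
      _ = _ := by simp
  have s3 : (∫ τ in (0:ℝ)..Real.pi, F τ) = (∫ τ in (0:ℝ)..d, F τ) + (∫ τ in d..(Real.pi - d), F τ) + ∫ τ in (Real.pi - d)..Real.pi, F τ := by
    rw [intervalIntegral.integral_add_adjacent_intervals (Fc.intervalIntegrable _ _) (Fc.intervalIntegrable _ _),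
      intervalIntegral.integral_add_adjacent_intervals (Fc.intervalIntegrable _ _) (Fc.intervalIntegrable _ _)]
  rw [s3] at h1
  have h2 : |q.eval (Real.cos θ0)| ≤ Ms := by
    have : F θ0 ≤ Ms := hmax hθ0
    simpa [hF, dk] using this
  have hCn : 0 < C * n := by positivity
  have h3 : C * n * (∫ τ in (0:ℝ)..d, F τ) ≤ 1/4 * Ms := by
    rw [← hdC, mul_assoc (C * n)]; exact mul_le_mul_of_nonneg_left s1 hCn.le
  have h4 : C * n * (∫ τ in (Real.pi - d)..Real.pi, F τ) ≤ 1/4 * Ms := by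
    rw [← hdC, mul_assoc (C * n)]; exact mul_le_mul_of_nonneg_left s2 hCn.le
  nlinarith

lemma mwn_peak (α β : ℝ) {n τ θ : ℝ} (hn : 0 < n) (hτ : τ ∈ Icc 0 Real.pi) (hθ : θ ∈ Icc 0 Real.pi) :
    mwn α β n τ ≤ mwn α β n θ * (1 + n * |τ - θ|) ^ (|2 * α + 1| + |2 * β + 1|) := by
  have h1 := peak (2 * α + 1) hn hτ.1 hθ.1
  have h2 := peak (2 * β + 1) (τ := Real.pi - τ) (θ := Real.pi - θ) hn (by linarith [hτ.2]) (by linarith [hθ.2])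
  rw [show Real.pi - τ - (Real.pi - θ) = -(τ - θ) by ring, abs_neg] at h2
  have p : 0 < 1 + n * |τ - θ| := by positivity
  rw [Real.rpow_add p]
  unfold mwn
  have t1 := hτ.1
  have t2 : 0 ≤ Real.pi - τ := by linarith [hτ.2]
  have t3 := hθ.1
  have t4 : 0 ≤ Real.pi - θ := by linarith [hθ.2]
  calc _ ≤ ((θ + 1/n) ^ (2 * α + 1) * (1 + n * |τ - θ|) ^ |2 * α + 1|) * ((Real.pi - θ + 1/n) ^ (2 * β + 1) * (1 + n * |τ - θ|) ^ |2 * β + 1|) :=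
      mul_le_mul h1 h2 (by positivity) (by positivity)
    _ = _ := by ring

lemma mwn_le_wt (α β δ : ℝ) (hδ : 0 < δ) : ∃ C, 0 < C ∧ ∀ n : ℝ, 0 < n → ∀ τ, δ/n ≤ τ → τ ≤ Real.pi - δ/n → 
    mwn α β n τ ≤ C * wt α β τ ∧ wt α β τ ≤ C * mwn α β n τ := by
  obtain ⟨C0, hC0, H0⟩ := wt_comp α β
  obtain ⟨C1, hC1, H1⟩ := rpow_comp (2 * α + 1) (m := δ/(1+δ)) (M := 1) (by positivity) (by norm_num)
  obtain ⟨C2, hC2, H2⟩ := rpow_comp (2 * β + 1) (m := δ/(1+δ)) (M := 1) (by positivity) (by norm_num)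
  refine ⟨C1 * C2 * C0, by positivity, fun n hn τ h1 h2 => ?_⟩
  have hd : 0 < δ/n := by positivity
  have hτ : τ ∈ Ioo 0 Real.pi := ⟨by linarith, by linarith⟩
  have key : ∀ x, δ/n ≤ x → δ/(1+δ) * (x + 1/n) ≤ x := by
    intro x hx
    rw [div_mul_eq_mul_div, div_le_iff₀ (by positivity)]
    have : δ * (1/n) = δ/n := by ring
    nlinarith
  have n1 : 0 < 1/n := by positivity
  have t1 := hτ.1
  have t2 : 0 < Real.pi - τ := by linarith [hτ.2]
  have a1 := H1 τ (τ + 1/n) hτ.1 (by linarith) (key τ h1) (by linarith)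
  have a2 := H2 (Real.pi - τ) (Real.pi - τ + 1/n) t2 (by linarith) (key _ (by linarith)) (by linarith)
  have a3 := H0 τ hτ
  have w0 := (wt_pos α β hτ).le
  constructor
  · unfold mwn
    calc _ ≤ (C1 * τ ^ (2 * α + 1)) * (C2 * (Real.pi - τ) ^ (2 * β + 1)) := mul_le_mul a1.2 a2.2 (by positivity) (by positivity)
      _ = C1 * C2 * mw α β τ := by unfold mw; ring
      _ ≤ C1 * C2 * (C0 * wt α β τ) := by gcongr; exact a3.2
      _ = _ := by ring
  · calc wt α β τ ≤ C0 * mw α β τ := a3.1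
      _ ≤ C0 * ((C1 * (τ + 1/n) ^ (2 * α + 1)) * (C2 * (Real.pi - τ + 1/n) ^ (2 * β + 1))) := by
        unfold mw
        refine mul_le_mul_of_nonneg_left (mul_le_mul a1.1 a2.1 (by positivity) (by positivity)) hC0.le
      _ = _ := by unfold mwn; ring

lemma christoffel (α β : ℝ) (hα : -1 < α) (hβ : -1 < β) (j : ℕ) (hj : 2 ≤ j) : ∃ C, 0 < C ∧ ∀ n : ℕ, 1 ≤ n → ∀ q : Polynomial ℝ, q.natDegree ≤ 2 * n →
    ∀ θ ∈ Icc 0 Real.pi, q.eval (Real.cos θ) ^ 2 ≤ C * n / mwn α β n θ * ∫ τ, q.eval (Real.cos τ) ^ 2 * dk j n (τ - θ) ∂(nu α β) := by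
  obtain ⟨C, δ, hC, hδ, hδ1, H⟩ := absorb (j + DD α β)
  obtain ⟨C1, hC1, H1⟩ := mwn_le_wt α β δ hδ
  refine ⟨C ^ 2 * Real.pi * C1, by positivity, fun n hn q hq θ hθ => ?_⟩
  have hn1 : (1:ℝ) ≤ n := by exact_mod_cast hn
  have hn0 : (0:ℝ) < n := by linarith
  set N := j + DD α β with hN
  set G := Icc (δ/n) (Real.pi - δ/n) with hG
  have hdn : 0 < δ/n := by positivity
  have hdn1 : δ/n ≤ 1 := by rw [div_le_one hn0]; linarith
  have hpi := Real.pi_gt_three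
  have mp := mwn_pos α β hn0 hθ
  have qc := pc_cont q
  have dc := dk_cont' N θ hn0
  have dc' := dk_cont' j θ hn0
  have e1 := H n hn q hq θ hθ
  rw [intervalIntegral.integral_of_le (by linarith), ← integral_Icc_eq_integral_Ioc] at e1
  have ci : ∀ {F : ℝ → ℝ}, Continuous F → IntegrableOn F G := fun hF => hF.continuousOn.integrableOn_Icc
  have e2 := wcs (volume.restrict G) (fun τ => |q.eval (Real.cos τ)|) (fun _ => 1) (fun τ => dk N n (τ - θ)) (fun τ => (dk_pos N hn0).le)
    (ci ((qc.abs.pow 2).mul dc)) (ci ((continuous_const.pow 2).mul dc)) (ci ((qc.abs.mul continuous_const).mul dc))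
  simp only [mul_one, one_pow, one_mul, sq_abs] at e2
  have ii := integrable_dk2 hn0 θ
  have e3 : (∫ τ in G, dk N n (τ - θ)) ≤ Real.pi / n := by
    calc _ ≤ ∫ τ in G, dk 2 n (τ - θ) := setIntegral_mono (ci dc) ii.1.integrableOn fun τ => dk_anti (by omega) hn0
      _ ≤ ∫ τ, dk 2 n (τ - θ) := setIntegral_le_integral ii.1 (Filter.Eventually.of_forall fun τ => (dk_pos 2 hn0).le)
      _ ≤ _ := ii.2
  have e4 : (∫ τ in G, q.eval (Real.cos τ) ^ 2 * dk N n (τ - θ)) ≤ C1 / mwn α β n θ * ∫ τ, q.eval (Real.cos τ) ^ 2 * dk j n (τ - θ) ∂(nu α β) := by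
    rw [nu_integral, ← integral_const_mul]
    have hIntg : IntegrableOn (fun τ => q.eval (Real.cos τ) ^ 2 * dk j n (τ - θ) * wt α β τ) (Ioo 0 Real.pi) := 
      (nu_integrable_iff α β _).1 (cont_int α β hα hβ ((qc.pow 2).mul dc'))
    have hsub : G ⊆ Ioo 0 Real.pi := fun τ hτ => ⟨by linarith [hτ.1], by linarith [hτ.2]⟩
    calc _ ≤ ∫ τ in G, C1 / mwn α β n θ * (q.eval (Real.cos τ) ^ 2 * dk j n (τ - θ) * wt α β τ) := by
          refine setIntegral_mono_on (ci ((qc.pow 2).mul dc)) ((hIntg.mono_set hsub).const_mul _) measurableSet_Icc fun τ hτ => ?_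
          have hτ' : τ ∈ Icc 0 Real.pi := ⟨(hsub hτ).1.le, (hsub hτ).2.le⟩
          have b1 := mwn_peak α β hn0 hθ hτ'
          have b2 := (H1 n hn0 τ hτ.1 hτ.2).1
          have b3 := dk_split (N := N) (K := j) (D := DD α β) (by omega) (d := τ - θ) (DD_ab α β) hn0
          rw [abs_sub_comm] at b1
          have dp : 0 < dk N n (τ - θ) := dk_pos N hn0
          set P := (1 + n * |τ - θ|) ^ (|2 * α + 1| + |2 * β + 1|)
          have P0 : 0 < P := by positivity
          have w0 := (wt_pos α β (hsub hτ)).le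
          have b4 : mwn α β n θ * dk N n (τ - θ) ≤ C1 * (dk j n (τ - θ) * wt α β τ) := by
            calc _ ≤ (mwn α β n τ * P) * dk N n (τ - θ) := by gcongr
              _ ≤ (C1 * wt α β τ * P) * dk N n (τ - θ) := by gcongr
              _ = C1 * wt α β τ * (P * dk N n (τ - θ)) := by ring
              _ ≤ C1 * wt α β τ * dk j n (τ - θ) := by gcongr
              _ = _ := by ring
          rw [div_mul_eq_mul_div, le_div_iff₀ mp]
          nlinarith [mul_le_mul_of_nonneg_left b4 (sq_nonneg (q.eval (Real.cos τ)))]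
      _ ≤ _ := by
          refine setIntegral_mono_set (hIntg.const_mul _) ?_ (Filter.Eventually.of_forall hsub)
          filter_upwards [ae_restrict_mem measurableSet_Ioo] with τ hτ
          have := wt_pos α β hτ
          have := dk_pos j hn0 (d := τ - θ)
          simp only [Pi.zero_apply]
          positivity
  set I := ∫ τ, q.eval (Real.cos τ) ^ 2 * dk j n (τ - θ) ∂(nu α β)
  set A := ∫ τ in G, |q.eval (Real.cos τ)| * dk N n (τ - θ)
  set B := ∫ τ in G, q.eval (Real.cos τ) ^ 2 * dk N n (τ - θ)
  have A0 : 0 ≤ A := integral_nonneg fun τ => mul_nonneg (abs_nonneg _) (dk_pos N hn0).le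
  have B0 : 0 ≤ B := integral_nonneg fun τ => mul_nonneg (sq_nonneg _) (dk_pos N hn0).le
  calc q.eval (Real.cos θ) ^ 2 = |q.eval (Real.cos θ)| ^ 2 := (sq_abs _).symm
    _ ≤ (C * n * A) ^ 2 := by gcongr
    _ = C ^ 2 * n ^ 2 * A ^ 2 := by ring
    _ ≤ C ^ 2 * n ^ 2 * ((C1 / mwn α β n θ * I) * (Real.pi / n)) := by
        refine mul_le_mul_of_nonneg_left (e2.trans ?_) (by positivity)
        exact mul_le_mul e4 e3 (integral_nonneg fun τ => (dk_pos N hn0).le) (B0.trans e4)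
    _ = _ := by field_simp

lemma schur_lintegral {X Y : Type*} [MeasurableSpace X] [MeasurableSpace Y] (μ : Measure X) (ν : Measure Y) [SFinite μ] [SFinite ν]
    (A : X → Y → ℝ≥0∞) (hA : Measurable (Function.uncurry A)) (F : Y → ℝ≥0∞) (hF : Measurable F) (C : ℝ≥0∞)
    (h1 : ∀ᵐ x ∂μ, ∫⁻ y, A x y ∂ν ≤ C) (h2 : ∀ᵐ y ∂ν, ∫⁻ x, A x y ∂μ ≤ C) (p : ℝ) (hp : 1 ≤ p) :
    ∫⁻ x, (∫⁻ y, A x y * F y ∂ν) ^ p ∂μ ≤ C ^ p * ∫⁻ y, F y ^ p ∂ν := by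
  have hAx : ∀ x, Measurable (A x) := fun x => hA.comp measurable_prodMk_left
  have hAy : ∀ y, Measurable (fun x => A x y) := fun y => hA.comp (measurable_prodMk_right)
  have hp0 : 0 < p := by linarith
  have step : ∀ᵐ x ∂μ, (∫⁻ y, A x y * F y ∂ν) ^ p ≤ C ^ (p - 1) * ∫⁻ y, A x y * F y ^ p ∂ν := by
    filter_upwards [h1] with x hx
    rcases eq_or_lt_of_le hp with rfl | hp1
    · simp
    · have hpq : (p / (p - 1)).HolderConjugate p := by
        have : p - 1 ≠ 0 := by linarith
        exact (Real.HolderConjugate.conjExponent hp1).symm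
      have := ENNReal.lintegral_mul_le_Lp_mul_Lq (ν.withDensity (A x)) hpq (f := fun _ => 1) (g := F) aemeasurable_const hF.aemeasurable
      simp only [Pi.mul_apply, one_mul, ENNReal.one_rpow] at this
      rw [lintegral_withDensity_eq_lintegral_mul _ (hAx x) hF, lintegral_withDensity_eq_lintegral_mul _ (hAx x) (hF.pow_const p),
        lintegral_withDensity_eq_lintegral_mul _ (hAx x) measurable_const] at this
      simp only [Pi.mul_apply, mul_one] at this
      calc _ ≤ ((∫⁻ y, A x y ∂ν) ^ (1 / (p/(p-1))) * (∫⁻ y, A x y * F y ^ p ∂ν) ^ (1/p)) ^ p := ENNReal.rpow_le_rpow this hp0.le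
        _ = (∫⁻ y, A x y ∂ν) ^ (p-1) * ∫⁻ y, A x y * F y ^ p ∂ν := by
          rw [ENNReal.mul_rpow_of_nonneg _ _ hp0.le, ← ENNReal.rpow_mul, ← ENNReal.rpow_mul]
          congr 2
          · field_simp
          · rw [one_div, inv_mul_cancel₀ hp0.ne', ENNReal.rpow_one]
        _ ≤ _ := by gcongr
  have hm2 : Measurable (Function.uncurry fun x y => A x y * F y ^ p) := hA.mul ((hF.pow_const p).comp measurable_snd)
  calc _ ≤ ∫⁻ x, C ^ (p - 1) * ∫⁻ y, A x y * F y ^ p ∂ν ∂μ := lintegral_mono_ae step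
    _ = C ^ (p - 1) * ∫⁻ y, ∫⁻ x, A x y * F y ^ p ∂μ ∂ν := by
      rw [lintegral_const_mul _ hm2.lintegral_prod_right, lintegral_lintegral_swap hm2.aemeasurable]
    _ = C ^ (p - 1) * ∫⁻ y, (∫⁻ x, A x y ∂μ) * F y ^ p ∂ν := by
      congr 1
      exact lintegral_congr fun y => lintegral_mul_const _ (hAy y)
    _ ≤ C ^ (p - 1) * ∫⁻ y, C * F y ^ p ∂ν := by
      gcongr 1
      refine lintegral_mono_ae ?_
      filter_upwards [h2] with y hy
      gcongr
    _ = _ := by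
      rw [lintegral_const_mul _ (hF.pow_const p), ← mul_assoc]
      congr 1
      conv_lhs => rw [← ENNReal.rpow_one C, ← ENNReal.rpow_mul]
      rw [one_mul]
      rw [← ENNReal.rpow_add_of_nonneg _ _ (by linarith) (by norm_num)]
      congr 1; ring

lemma schur {X Y : Type*} [MeasurableSpace X] [MeasurableSpace Y] (μ : Measure X) (ν : Measure Y) [SFinite μ] [SFinite ν]
    (A : X → Y → ℝ≥0∞) (hA : Measurable (Function.uncurry A)) (F : Y → ℝ) (hF : Measurable F) (G : X → ℝ) (C : ℝ≥0∞)
    (h1 : ∀ᵐ x ∂μ, ∫⁻ y, A x y ∂ν ≤ C) (h2 : ∀ᵐ y ∂ν, ∫⁻ x, A x y ∂μ ≤ C)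
    (hG : ∀ᵐ x ∂μ, ‖G x‖ₑ ≤ ∫⁻ y, A x y * ‖F y‖ₑ ∂ν) (p : ℝ≥0∞) (hp : 1 ≤ p) :
    eLpNorm G p μ ≤ C * eLpNorm F p ν := by
  by_cases hpt : p = ⊤
  · subst hpt
    rw [eLpNorm_exponent_top, eLpNorm_exponent_top]
    refine eLpNormEssSup_le_of_ae_enorm_bound ?_
    filter_upwards [h1, hG] with x hx hg
    refine hg.trans ?_
    calc _ ≤ ∫⁻ y, A x y * eLpNormEssSup F ν ∂ν := by
          refine lintegral_mono_ae ?_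
          filter_upwards [enorm_ae_le_eLpNormEssSup F ν] with y hy
          gcongr
      _ = (∫⁻ y, A x y ∂ν) * eLpNormEssSup F ν := lintegral_mul_const _ (hA.comp measurable_prodMk_left)
      _ ≤ _ := by gcongr
  · have hp0 : p ≠ 0 := by rintro rfl; simp at hp
    have hr : 1 ≤ p.toReal := by
      rw [← ENNReal.toReal_one]; exact (ENNReal.toReal_le_toReal (by simp) hpt).2 hp
    have hr0 : 0 < p.toReal := by linarith
    rw [eLpNorm_eq_lintegral_rpow_enorm_toReal hp0 hpt, eLpNorm_eq_lintegral_rpow_enorm_toReal hp0 hpt]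
    have := schur_lintegral μ ν A hA (fun y => ‖F y‖ₑ) hF.enorm C h1 h2 p.toReal hr
    calc _ ≤ (∫⁻ x, (∫⁻ y, A x y * ‖F y‖ₑ ∂ν) ^ p.toReal ∂μ) ^ (1/p.toReal) := by
          refine ENNReal.rpow_le_rpow (lintegral_mono_ae ?_) (by positivity)
          filter_upwards [hG] with x hx
          exact ENNReal.rpow_le_rpow hx hr0.le
      _ ≤ (C ^ p.toReal * ∫⁻ y, ‖F y‖ₑ ^ p.toReal ∂ν) ^ (1/p.toReal) := ENNReal.rpow_le_rpow this (by positivity)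
      _ = _ := by
        rw [ENNReal.mul_rpow_of_nonneg _ _ (by positivity), ← ENNReal.rpow_mul, mul_one_div_cancel hr0.ne', ENNReal.rpow_one]

lemma dk_le_qw (j : ℕ) {n : ℝ} (hn : 0 < n) (θ τ : ℝ) : dk j n (τ - θ) ≤ (qw n θ τ ^ j)⁻¹ := by
  unfold dk
  refine inv_anti₀ (pow_pos (qw_pos n θ τ) j) (pow_le_pow_left₀ (qw_pos n θ τ).le ?_ j)
  unfold qw
  rw [Real.sqrt_le_left (by positivity)]
  have : (n * (τ - θ)) ^ 2 = (n * |τ - θ|) ^ 2 := by rw [mul_pow, mul_pow, sq_abs]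
  rw [this]
  have : 0 ≤ n * |τ - θ| := by positivity
  nlinarith

lemma qw_le_dk (j : ℕ) {n : ℝ} (hn : 0 < n) (θ τ : ℝ) : (qw n θ τ ^ j)⁻¹ ≤ 2 ^ j * dk j n (τ - θ) := by
  unfold dk
  have h0 := qw_one_le n θ τ
  have h1 := qw_ge n θ τ
  rw [abs_mul, abs_of_pos hn] at h1
  have h2 : (1 + n * |τ - θ|) ^ j ≤ 2 ^ j * qw n θ τ ^ j := by
    rw [← mul_pow]
    exact pow_le_pow_left₀ (by positivity) (by linarith) j
  have h3 : 0 < qw n θ τ ^ j := pow_pos (by linarith) j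
  rw [inv_le_iff_one_le_mul₀ h3, mul_right_comm]
  have : 0 < (1 + n * |τ - θ|) ^ j := by positivity
  rw [← div_eq_mul_inv, le_div_iff₀ this]
  linarith

lemma V_inf (η : ℝ → ℝ) (hη : Admissible η) (α β : ℝ) (hα : -1 < α) (hβ : -1 < β) : ∃ C, 0 < C ∧
    ∀ n : ℕ, 1 ≤ n → ∀ f : ℝ → ℝ, Continuous f → (∀ x, |f x| ≤ 1) → ∀ θ ∈ Icc 0 Real.pi,
      |V η α β n f (Real.cos θ)| ≤ C := by
  obtain ⟨C1, hC1, H1⟩ := wt_dk α β hα hβ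
  set j := 2 * DD α β + 2 with hj
  obtain ⟨C2, hC2, H2⟩ := christoffel α β hα hβ j (by omega)
  obtain ⟨C3, hC3, H3⟩ := mult_cont η hη α β hα hβ j
  refine ⟨Real.sqrt (C2 * (C3 * (2 ^ j * C1))), by positivity, fun n hn f hf hf1 θ hθ => ?_⟩
  apply Real.abs_le_sqrt
  have hn1 : (1:ℝ) ≤ n := by exact_mod_cast hn
  have hn0 : (0:ℝ) < n := by linarith
  have hV := V_cont η α β n f
  set v := V η α β n f with hv
  set ω : ℝ → ℝ := fun τ => (qw n θ τ ^ j)⁻¹ with hω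
  have hω0 : ∀ τ, 0 < ω τ := fun τ => inv_pos.2 (pow_pos (qw_pos n θ τ) j)
  have hωc : Continuous ω := ((qw_cont n θ).pow j).inv₀ fun τ => (pow_pos (qw_pos n θ τ) j).ne'
  set g : ℝ → ℝ := fun x => v x * ω (Real.arccos x) with hg
  have hgc : Continuous g := hV.mul (hωc.comp Real.continuous_arccos)
  have hvc : Continuous (fun τ => v (Real.cos τ)) := hV.comp Real.continuous_cos
  have hfc : Continuous (fun τ => f (Real.cos τ)) := hf.comp Real.continuous_cos
  have hWc : Continuous (fun τ => V η α β n g (Real.cos τ)) := (V_cont η α β n g).comp Real.continuous_cos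
  have hqc := qw_cont n θ
  -- ∫ v² ω
  set X := ∫ τ, v (Real.cos τ) ^ 2 * ω τ ∂(nu α β) with hX
  set Y := ∫ τ, f (Real.cos τ) ^ 2 * ω τ ∂(nu α β) with hY
  have hX0 : 0 ≤ X := integral_nonneg fun τ => mul_nonneg (sq_nonneg _) (hω0 τ).le
  have hY0 : 0 ≤ Y := integral_nonneg fun τ => mul_nonneg (sq_nonneg _) (hω0 τ).le
  have harc : ∀ᵐ τ ∂(nu α β), Real.arccos (Real.cos τ) = τ := by
    filter_upwards [nu_ae_mem α β] with τ hτ using Real.arccos_cos hτ.1.le hτ.2.le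
  have e1 : X = ip α β v g := by
    rw [ip_eq]; refine integral_congr_ae ?_
    filter_upwards [harc] with τ hτ
    simp only [hg, hτ]; ring
  have e2 : X = ∫ τ, f (Real.cos τ) * (V η α β n g (Real.cos τ) * qw n θ τ ^ j) * ω τ ∂(nu α β) := by
    rw [e1, hv, V_adj η α β hα hβ n hf hgc, ip_eq]
    refine integral_congr_ae (Filter.Eventually.of_forall fun τ => ?_)
    have := (pow_pos (qw_pos n θ τ) j).ne'
    simp only [hω]; field_simp
  have c1 : Continuous (fun τ => f (Real.cos τ) ^ 2 * ω τ) := by fun_prop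
  have c2 : Continuous (fun τ => (V η α β n g (Real.cos τ) * qw n θ τ ^ j) ^ 2 * ω τ) := by fun_prop
  have c3 : Continuous (fun τ => f (Real.cos τ) * (V η α β n g (Real.cos τ) * qw n θ τ ^ j) * ω τ) := by fun_prop
  have e3 := wcs (nu α β) (fun τ => f (Real.cos τ)) (fun τ => V η α β n g (Real.cos τ) * qw n θ τ ^ j) ω (fun τ => (hω0 τ).le)
    (cont_int α β hα hβ c1) (cont_int α β hα hβ c2) (cont_int α β hα hβ c3)
  rw [← e2] at e3
  have e4 : ∫ τ, (V η α β n g (Real.cos τ) * qw n θ τ ^ j) ^ 2 * ω τ ∂(nu α β) ≤ C3 * X := by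
    refine le_trans (le_of_eq ?_) ((H3 n hn θ g hgc).trans (le_of_eq ?_))
    · refine integral_congr_ae (Filter.Eventually.of_forall fun τ => ?_)
      have := (pow_pos (qw_pos n θ τ) j).ne'
      simp only [hω]; field_simp
    · congr 1
      refine integral_congr_ae ?_
      filter_upwards [harc] with τ hτ
      have := (pow_pos (qw_pos n θ τ) j).ne'
      simp only [hg, hω, hτ]; field_simp
  have e5 : X ≤ C3 * Y := by
    have : X ^ 2 ≤ Y * (C3 * X) := e3.trans (by gcongr)
    rcases hX0.eq_or_lt with h | h
    · rw [← h]; positivity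
    · have : X * X ≤ (C3 * Y) * X := by nlinarith
      exact le_of_mul_le_mul_right this h
  have i0 : Integrable (fun τ => dk j n (τ - θ)) (nu α β) := cont_int α β hα hβ (dk_cont' j θ hn0)
  have hm := mwn_pos α β hn0 hθ
  have e6 : Y ≤ 2 ^ j * (C1 / n * mwn α β n θ) := by
    calc Y ≤ ∫ τ, 2 ^ j * dk j n (τ - θ) ∂(nu α β) := by
          refine integral_mono (cont_int α β hα hβ c1) (i0.const_mul _) fun τ => ?_
          have h1 : f (Real.cos τ) ^ 2 ≤ 1 := by
            rw [← sq_abs]; exact pow_le_one₀ (abs_nonneg _) (hf1 _)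
          calc _ ≤ 1 * ω τ := by gcongr; exact (hω0 τ).le
            _ ≤ _ := by rw [one_mul]; exact qw_le_dk j hn0 θ τ
      _ ≤ _ := by
          rw [integral_const_mul, nu_integral]
          gcongr
          exact H1 j le_rfl n hn1 θ hθ
  have e7 := H2 n hn (Vpol η α β n f) (Vpol_natDegree η α β n f) θ hθ
  simp only [Vpol_eval] at e7
  have c4 : Continuous (fun τ => v (Real.cos τ) ^ 2 * ω τ) := by fun_prop
  have c5 : Continuous (fun τ => v (Real.cos τ) ^ 2 * dk j n (τ - θ)) := by
    have := dk_cont' j θ hn0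
    fun_prop
  have e8 : ∫ τ, v (Real.cos τ) ^ 2 * dk j n (τ - θ) ∂(nu α β) ≤ X := by
    refine integral_mono (cont_int α β hα hβ c5) (cont_int α β hα hβ c4) fun τ => ?_
    exact mul_le_mul_of_nonneg_left (dk_le_qw j hn0 θ τ) (sq_nonneg _)
  calc _ ≤ _ := e7
    _ ≤ C2 * n / mwn α β n θ * (C3 * (2 ^ j * (C1 / n * mwn α β n θ))) := by
        gcongr
        exact e8.trans (e5.trans (by gcongr))
    _ = _ := by field_simp

lemma KV_L1 (η : ℝ → ℝ) (hη : Admissible η) (α β : ℝ) (hα : -1 < α) (hβ : -1 < β) : ∃ C, 0 < C ∧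
    ∀ n : ℕ, 1 ≤ n → ∀ θ ∈ Icc 0 Real.pi, ∫ τ, |KV η α β n (Real.cos θ) (Real.cos τ)| ∂(nu α β) ≤ C := by
  obtain ⟨C, hC, H⟩ := V_inf η hη α β hα hβ
  refine ⟨C, hC, fun n hn θ hθ => ?_⟩
  have hfin := nu_finite α β hα hβ
  set M := (nu α β).real univ with hM
  have hM0 : 0 ≤ M := by positivity
  have hK := slice (KV η α β n) (KV_cont η α β n) (Real.cos θ)
  set k := KV η α β n (Real.cos θ) with hk
  refine le_of_forall_pos_le_add fun ε hε => ?_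
  set δ := ε / (M + 1) with hδ
  have hδ0 : 0 < δ := by positivity
  have hden : ∀ x, 0 < |k x| + δ := fun x => by positivity
  have hfc : Continuous (fun x => k x / (|k x| + δ)) := hK.div (by fun_prop) fun x => (hden x).ne'
  have h1 := H n hn (fun x => k x / (|k x| + δ)) hfc (fun x => by
    rw [abs_div, abs_of_pos (hden x), div_le_one (hden x)]; linarith) θ hθ
  rw [V_kernel η α β hα hβ n hfc] at h1
  have h2 := (le_abs_self _).trans h1
  have c1 : Continuous (fun τ => |k (Real.cos τ)|) := by fun_prop
  have c2 : Continuous (fun τ => k (Real.cos τ) / (|k (Real.cos τ)| + δ) * k (Real.cos τ)) :=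
    (hfc.comp Real.continuous_cos).mul (hK.comp Real.continuous_cos)
  have := int_dom (a := 1) (b := δ) (cont_int α β hα hβ c1) (cont_int α β hα hβ c2) (integrable_const (μ := nu α β) (1:ℝ)) (fun τ => by
    have := hden (Real.cos τ)
    set z := k (Real.cos τ)
    have e : z / (|z| + δ) * z = |z| ^ 2 / (|z| + δ) := by rw [sq_abs]; ring
    rw [e, one_mul, mul_one, ← sub_le_iff_le_add, le_div_iff₀ this]
    nlinarith [abs_nonneg z])
  simp only [integral_const, smul_eq_mul, mul_one, one_mul] at this
  refine this.trans (add_le_add h2 ?_)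
  rw [← hM, hδ, div_mul_eq_mul_div, div_le_iff₀ (by positivity)]
  nlinarith

lemma cos_slice_meas (K : ℝ → ℝ → ℝ) (hK : Continuous (fun p : ℝ × ℝ => K p.1 p.2)) :
    Measurable (Function.uncurry fun x y : ℝ => ‖K (Real.cos x) (Real.cos y)‖ₑ) := by
  have h1 : Continuous (fun p : ℝ × ℝ => (Real.cos p.1, Real.cos p.2)) := by fun_prop
  have := hK.comp h1
  exact this.measurable.enorm

lemma V_bdd (η : ℝ → ℝ) (hη : Admissible η) (α β : ℝ) (hα : -1 < α) (hβ : -1 < β) : ∃ C, 0 < C ∧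
    ∀ n : ℕ, 1 ≤ n → ∀ p : ℝ≥0∞, 1 ≤ p → ∀ f : ℝ → ℝ, Continuous f →
      LpW α β p (V η α β n f) ≤ C * LpW α β p f := by
  obtain ⟨C, hC, H⟩ := KV_L1 η hη α β hα hβ
  refine ⟨C, hC, fun n hn p hp f hf => ?_⟩
  have hfin := nu_finite α β hα hβ
  have hV := V_cont η α β n f
  have hfc : Continuous (fun τ => f (Real.cos τ)) := hf.comp Real.continuous_cos
  rw [LpW_eq α β hα hβ p hp hV, LpW_eq α β hα hβ p hp hf]
  have hKc := KV_cont η α β n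
  have key : ∀ᵐ x ∂(nu α β), ∫⁻ y, ‖KV η α β n (Real.cos x) (Real.cos y)‖ₑ ∂(nu α β) ≤ ENNReal.ofReal C := by
    filter_upwards [nu_ae_mem α β] with x hx
    have c1 : Continuous (fun τ => KV η α β n (Real.cos x) (Real.cos τ)) := (slice _ hKc _).comp Real.continuous_cos
    rw [← ofReal_integral_norm_eq_lintegral_enorm (cont_int α β hα hβ c1)]
    exact ENNReal.ofReal_le_ofReal (H n hn x ⟨hx.1.le, hx.2.le⟩)
  have hmeas : Measurable (Function.uncurry fun x y : ℝ => ‖KV η α β n (Real.cos x) (Real.cos y)‖ₑ) := by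
    exact cos_slice_meas _ hKc
  have key2 : ∀ᵐ y ∂(nu α β), ∫⁻ x, ‖KV η α β n (Real.cos x) (Real.cos y)‖ₑ ∂(nu α β) ≤ ENNReal.ofReal C := by
    filter_upwards [key] with y hy
    refine le_trans (le_of_eq ?_) hy
    refine lintegral_congr fun x => ?_
    rw [KV_symm]
  have key3 : ∀ x : ℝ, ‖V η α β n f (Real.cos x)‖ₑ ≤ ∫⁻ y, ‖KV η α β n (Real.cos x) (Real.cos y)‖ₑ * ‖f (Real.cos y)‖ₑ ∂(nu α β) := by
    intro x
    rw [V_kernel η α β hα hβ n hf]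
    refine (enorm_integral_le_lintegral_enorm _).trans (le_of_eq ?_)
    refine lintegral_congr fun y => ?_
    rw [enorm_mul, mul_comm]
  have := schur (nu α β) (nu α β) (fun x y => ‖KV η α β n (Real.cos x) (Real.cos y)‖ₑ) hmeas
    (fun τ => f (Real.cos τ)) hfc.measurable (fun τ => V η α β n f (Real.cos τ)) (ENNReal.ofReal C) key key2
    (Filter.Eventually.of_forall key3) p hp
  have h2 := (cont_memLp α β hα hβ hfc p).2
  refine (ENNReal.toReal_mono (ENNReal.mul_ne_top ENNReal.ofReal_ne_top h2.ne) this).trans (le_of_eq ?_)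
  rw [ENNReal.toReal_mul, ENNReal.toReal_ofReal hC.le]

lemma LpW_add (α β : ℝ) (hα : -1 < α) (hβ : -1 < β) {p : ℝ≥0∞} (hp : 1 ≤ p) {f g : ℝ → ℝ} (hf : Continuous f) (hg : Continuous g) :
    LpW α β p (fun x => f x + g x) ≤ LpW α β p f + LpW α β p g := by
  rw [LpW_eq α β hα hβ p hp hf, LpW_eq α β hα hβ p hp hg, LpW_eq α β hα hβ p hp (f := fun x => f x + g x) (hf.add hg)]
  have c1 := cont_memLp α β hα hβ (F := fun τ => f (Real.cos τ)) (hf.comp Real.continuous_cos) p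
  have c2 := cont_memLp α β hα hβ (F := fun τ => g (Real.cos τ)) (hg.comp Real.continuous_cos) p
  rw [← ENNReal.toReal_add c1.2.ne c2.2.ne]
  exact ENNReal.toReal_mono (ENNReal.add_ne_top.2 ⟨c1.2.ne, c2.2.ne⟩) (eLpNorm_add_le c1.1 c2.1 hp)

lemma LpW_neg (α β : ℝ) (p : ℝ≥0∞) (f : ℝ → ℝ) : LpW α β p (fun x => - f x) = LpW α β p f := by
  unfold LpW; simp only [abs_neg]

lemma LpW_nonneg (α β : ℝ) (p : ℝ≥0∞) (f : ℝ → ℝ) : 0 ≤ LpW α β p f := by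
  unfold LpW
  split_ifs
  · apply Real.sSup_nonneg; rintro _ ⟨x, _, rfl⟩; exact abs_nonneg _
  · apply Real.rpow_nonneg
    refine setIntegral_nonneg measurableSet_Ioo fun x hx => ?_
    refine mul_nonneg (Real.rpow_nonneg (abs_nonneg _) _) ?_
    unfold w
    exact mul_nonneg (Real.rpow_nonneg (by linarith [hx.2]) _) (Real.rpow_nonneg (by linarith [hx.1]) _)

/-- near best approximation by V -/
lemma V_near (η : ℝ → ℝ) (hη : Admissible η) (α β : ℝ) (hα : -1 < α) (hβ : -1 < β) : ∃ C, 0 < C ∧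
    ∀ n : ℕ, 1 ≤ n → ∀ p : ℝ≥0∞, 1 ≤ p → ∀ f : ℝ → ℝ, Continuous f →
      LpW α β p (fun x => f x - V η α β n f x) ≤ C * E α β p n f := by
  obtain ⟨C, hC, H⟩ := V_bdd η hη α β hα hβ
  refine ⟨1 + C, by linarith, fun n hn p hp f hf => ?_⟩
  unfold E
  rw [← div_le_iff₀' (by linarith)]
  refine le_csInf ⟨_, 0, by simp, rfl⟩ ?_
  rintro r ⟨q, hq, rfl⟩
  rw [div_le_iff₀' (by linarith)]
  have hd : Continuous (fun x => f x - q.eval x) := hf.sub q.continuous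
  have hV := V_cont η α β n (fun x => f x - q.eval x)
  have e : (fun x => f x - V η α β n f x) = fun x => (f x - q.eval x) + (-(V η α β n (fun x => f x - q.eval x) x)) := by
    ext x
    rw [V_sub η α β hα hβ n hf q.continuous, V_repro η hη α β hα hβ n hn q hq]; ring
  rw [e]
  refine (LpW_add α β hα hβ hp hd hV.neg).trans ?_
  have e2 := LpW_neg α β p (V η α β n (fun x => f x - q.eval x))
  have e3 : LpW α β p (-V η α β n fun x => f x - Polynomial.eval x q) = LpW α β p (V η α β n (fun x => f x - q.eval x)) := e2
  rw [e3]
  have := H n hn p hp _ hd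
  linarith

/-- cosine sums of degree at most m -/
def CSm (m : ℕ) : Submodule ℝ (ℝ → ℝ) := Submodule.span ℝ {f | ∃ k : ℕ, k ≤ m ∧ f = fun u => Real.cos (k * u)}

lemma CSm_cos {m k : ℕ} (h : k ≤ m) : (fun u : ℝ => Real.cos (k * u)) ∈ CSm m := Submodule.subset_span ⟨k, h, rfl⟩

lemma CSm_cos_mul (j k m : ℕ) (h : j + k ≤ m) (hjk : k ≤ j) : ((fun u : ℝ => Real.cos (j * u)) * fun u => Real.cos (k * u)) ∈ CSm m := by
  have e : ((fun u : ℝ => Real.cos (j * u)) * fun u => Real.cos (k * u)) =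
     (1/2 : ℝ) • (fun u : ℝ => Real.cos ((j + k : ℕ) * u)) + (1/2 : ℝ) • (fun u : ℝ => Real.cos ((j - k : ℕ) * u)) := by
    ext u
    simp only [Pi.mul_apply, Pi.add_apply, Pi.smul_apply, smul_eq_mul]
    push_cast [hjk]
    rw [add_mul, sub_mul, Real.cos_add, Real.cos_sub]; ring
  rw [e]
  exact Submodule.add_mem _ (Submodule.smul_mem _ _ (CSm_cos h)) (Submodule.smul_mem _ _ (CSm_cos (by omega)))

lemma CSm_mul {m l : ℕ} {f g : ℝ → ℝ} (hf : f ∈ CSm m) (hg : g ∈ CSm l) : f * g ∈ CSm (m + l) := by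
  have h := Submodule.mul_mem_mul hf hg
  unfold CSm at h
  rw [Submodule.span_mul_span] at h
  refine (Submodule.span_le.2 ?_) h
  rintro _ ⟨_, ⟨j, hj, rfl⟩, _, ⟨k, hk, rfl⟩, rfl⟩
  rcases le_total k j with hjk | hjk
  · exact CSm_cos_mul j k _ (by omega) hjk
  · have := CSm_cos_mul k j (m + l) (by omega) hjk
    rw [mul_comm] at this
    exact this

lemma CSm_one (m : ℕ) : (1 : ℝ → ℝ) ∈ CSm m := by
  have := CSm_cos (m := m) (k := 0) (Nat.zero_le _)
  convert this using 1
  ext u; simp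

lemma CSm_pow {m : ℕ} {f : ℝ → ℝ} (hf : f ∈ CSm m) (k : ℕ) : f ^ k ∈ CSm (k * m) := by
  induction k with
  | zero => simpa using CSm_one 0
  | succ k ih =>
    rw [pow_succ, Nat.succ_mul]; exact CSm_mul ih hf

lemma CSm_Dk (l : ℕ) : (fun u => Dk l u / (2 * l + 1)) ∈ CSm l := by
  have e : (fun u => Dk l u / (2 * l + 1)) = (2 * l + 1 : ℝ)⁻¹ • (1 + (2:ℝ) • ∑ k ∈ Finset.range l, fun u : ℝ => Real.cos ((k + 1 : ℕ) * u)) := by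
    ext u
    simp only [Dk, Pi.smul_apply, Pi.add_apply, Pi.one_apply, Finset.sum_apply, smul_eq_mul]; ring
  rw [e]
  refine Submodule.smul_mem _ _ (Submodule.add_mem _ (CSm_one l) (Submodule.smul_mem _ _ (Submodule.sum_mem _ fun k hk => ?_)))
  exact CSm_cos (by have := Finset.mem_range.1 hk; omega)

lemma CSm_cont {m : ℕ} {f : ℝ → ℝ} (hf : f ∈ CSm m) : Continuous f := by
  unfold CSm at hf
  induction hf using Submodule.span_induction with
  | mem f hf => obtain ⟨k, _, rfl⟩ := hf; fun_prop
  | zero => exact continuous_const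
  | add f g _ _ h1 h2 => exact h1.add h2
  | smul c f _ h => exact h.const_smul c

/-- symmetrized integral -/
def SI (f : ℝ → ℝ) (a b τ : ℝ) : ℝ := ∫ v in a..b, (f (τ - v) + f (τ + v))

lemma SI_add {f g : ℝ → ℝ} (hf : Continuous f) (hg : Continuous g) (a b τ : ℝ) : SI (f + g) a b τ = SI f a b τ + SI g a b τ := by
  unfold SI
  rw [← intervalIntegral.integral_add]
  · refine intervalIntegral.integral_congr fun v _ => ?_
    simp only [Pi.add_apply]; ring
  · exact Continuous.intervalIntegrable (by fun_prop) _ _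
  · exact Continuous.intervalIntegrable (by fun_prop) _ _

lemma SI_smul (c : ℝ) (f : ℝ → ℝ) (a b τ : ℝ) : SI (c • f) a b τ = c * SI f a b τ := by
  unfold SI
  rw [← intervalIntegral.integral_const_mul]
  refine intervalIntegral.integral_congr fun v _ => ?_
  simp only [Pi.smul_apply, smul_eq_mul]; ring

lemma SI_cos (k : ℕ) (a b τ : ℝ) : SI (fun u => Real.cos (k * u)) a b τ = (2 * ∫ v in a..b, Real.cos (k * v)) * (Polynomial.Chebyshev.T ℝ k).eval (Real.cos τ) := by
  unfold SI
  rw [Polynomial.Chebyshev.T_real_cos, ← intervalIntegral.integral_const_mul, ← intervalIntegral.integral_mul_const]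
  refine intervalIntegral.integral_congr fun v _ => ?_
  simp only [mul_sub, mul_add, Real.cos_sub, Real.cos_add]
  push_cast; ring

lemma SI_poly {m : ℕ} {f : ℝ → ℝ} (hf : f ∈ CSm m) (a b : ℝ) : ∃ Q : Polynomial ℝ, Q.natDegree ≤ m ∧ ∀ τ, SI f a b τ = Q.eval (Real.cos τ) := by
  unfold CSm at hf
  induction hf using Submodule.span_induction with
  | mem f hf =>
    obtain ⟨k, hk, rfl⟩ := hf
    refine ⟨Polynomial.C (2 * ∫ v in a..b, Real.cos (k * v)) * Polynomial.Chebyshev.T ℝ k, ?_, fun τ => ?_⟩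
    · refine (Polynomial.natDegree_C_mul_le _ _).trans ?_
      rw [Polynomial.Chebyshev.natDegree_T]; simpa using hk
    · rw [SI_cos, Polynomial.eval_mul, Polynomial.eval_C]
  | zero => exact ⟨0, by simp, fun τ => by simp [SI]⟩
  | add f g hf hg h1 h2 =>
    obtain ⟨P, hP, eP⟩ := h1
    obtain ⟨Q, hQ, eQ⟩ := h2
    refine ⟨P + Q, (Polynomial.natDegree_add_le _ _).trans (max_le hP hQ), fun τ => ?_⟩
    rw [SI_add (CSm_cont hf) (CSm_cont hg), eP, eQ, Polynomial.eval_add]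
  | smul c f hf h1 =>
    obtain ⟨P, hP, eP⟩ := h1
    refine ⟨Polynomial.C c * P, (Polynomial.natDegree_C_mul_le _ _).trans hP, fun τ => ?_⟩
    rw [SI_smul, eP, Polynomial.eval_mul, Polynomial.eval_C]

lemma SI_const {m : ℕ} {f : ℝ → ℝ} (hf : f ∈ CSm m) (τ : ℝ) : SI f 0 Real.pi τ = SI f 0 Real.pi 0 := by
  unfold CSm at hf
  induction hf using Submodule.span_induction with
  | mem f hf =>
    obtain ⟨k, hk, rfl⟩ := hf
    rw [SI_cos, SI_cos]
    rcases Nat.eq_zero_or_pos k with rfl | h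
    · simp
    · have h0 : (k:ℝ) ≠ 0 := by positivity
      have : ∫ v in (0:ℝ)..Real.pi, Real.cos (k * v) = 0 := by
        rw [intervalIntegral.integral_comp_mul_left (fun v => Real.cos v) h0, integral_cos]
        simp [Real.sin_nat_mul_pi]
      rw [this]; ring
  | zero => simp [SI]
  | add f g hf hg h1 h2 => rw [SI_add (CSm_cont hf) (CSm_cont hg), SI_add (CSm_cont hf) (CSm_cont hg), h1, h2]
  | smul c f hf h1 => rw [SI_smul, SI_smul, h1]

lemma step_approx (N : ℕ) : ∃ C, 0 < C ∧ ∀ m : ℕ, 1 ≤ m → ∀ θ ∈ Icc 0 Real.pi, ∃ Q : Polynomial ℝ, Q.natDegree < m ∧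
    ∀ τ ∈ Icc 0 Real.pi, |(if θ < τ then 1 else 0) - Q.eval (Real.cos τ)| ≤ C * dk N m (τ - θ) := by
  have hpi := Real.pi_pos
  set M := 2 * (N + 1) with hM
  set K := (1 + M * Real.pi) ^ M with hK
  have hK0 : 0 < K := by positivity
  refine ⟨4 * K * Real.pi, by positivity, fun m hm θ hθ => ?_⟩
  have hm1 : (1:ℝ) ≤ m := by exact_mod_cast hm
  have hm0 : (0:ℝ) < m := by linarith
  set l := (m - 1) / M with hl
  have hl1 : M * l ≤ m - 1 := Nat.mul_div_le _ _
  have hl2 : m ≤ M * (2 * l + 1) := by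
    have : m - 1 < M * (l + 1) := Nat.lt_mul_div_succ _ (by omega)
    have h3 : M * (l + 1) ≤ M * (2 * l + 1) := Nat.mul_le_mul_left _ (by omega)
    omega
  have hl3 : (m:ℝ) ≤ M * (2 * l + 1) := by exact_mod_cast hl2
  set f : ℝ → ℝ := (fun u => Dk l u / (2 * l + 1)) ^ M with hf
  have hfm : f ∈ CSm (M * l) := CSm_pow (CSm_Dk l) M
  have hfc := CSm_cont hfm
  have hfe : ∀ u, f u = (Dk l u / (2 * l + 1)) ^ M := fun u => rfl
  have hf0 : ∀ u, 0 ≤ f u := fun u => by rw [hfe, hM, pow_mul]; positivity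
  have hfa : ∀ u, f u = |Dk l u / (2 * l + 1)| ^ M := fun u => by rw [← abs_pow, ← hfe, abs_of_nonneg (hf0 u)]
  set I := SI f 0 Real.pi 0 with hI
  have hI1 : 1 ≤ 2 * m * I := by
    have ht := TP_pow (TP_Dk l 0) M
    have h1 := nikolskii ht 0
    simp only [sub_zero] at h1
    have h2 : |(Dk l 0 / (2 * l + 1)) ^ M| = 1 := by
      rw [Dk_zero, div_self (by positivity)]; simp
    have h3 : ∫ τ in (-Real.pi)..Real.pi, |(Dk l τ / (2 * l + 1)) ^ M| = I := by
      have : (fun τ => |(Dk l τ / (2 * l + 1)) ^ M|) = f := by ext τ; rw [← hfe, abs_of_nonneg (hf0 τ)]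
      rw [this, hI]; unfold SI
      rw [intervalIntegral.integral_add (Continuous.intervalIntegrable (by fun_prop) _ _) (Continuous.intervalIntegrable (by fun_prop) _ _)]
      simp only [zero_sub, zero_add]
      rw [intervalIntegral.integral_comp_neg (fun v => f v), neg_zero,
        intervalIntegral.integral_add_adjacent_intervals (hfc.intervalIntegrable _ _) (hfc.intervalIntegrable _ _)]
    rw [h2, h3] at h1
    have h4 : 0 ≤ I := by
      rw [hI]; unfold SI
      refine intervalIntegral.integral_nonneg hpi.le fun v _ => add_nonneg (hf0 _) (hf0 _)
    have h5 : (2 * ((M * l : ℕ):ℝ) + 1) ≤ 2 * m := by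
      have : 2 * (M * l) + 1 ≤ 2 * m := by omega
      exact_mod_cast this
    exact h1.trans (by gcongr)
  have hI0 : 0 < I := by
    by_contra h; push Not at h
    have : 2 * m * I ≤ 0 := mul_nonpos_of_nonneg_of_nonpos (by positivity) h
    linarith
  obtain ⟨Q, hQ, eQ⟩ := SI_poly hfm θ Real.pi
  refine ⟨Polynomial.C I⁻¹ * Q, lt_of_le_of_lt (Polynomial.natDegree_C_mul_le _ _) (by omega), fun τ hτ => ?_⟩
  rw [Polynomial.eval_mul, Polynomial.eval_C, ← eQ]
  -- bound of partial integral
  have hcc : Continuous (fun v => f (τ - v) + f (τ + v)) := by fun_prop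
  have key : ∀ a b, 0 ≤ a → a ≤ b → b ≤ Real.pi → (∀ v ∈ Icc a b, |τ - θ| ≤ |v - τ|) → 
      |I⁻¹ * SI f a b τ| ≤ 4 * K * Real.pi * dk N m (τ - θ) := by
    intro a b ha hab hb h
    have hs0 : 0 ≤ SI f a b τ := by
      unfold SI; exact intervalIntegral.integral_nonneg hab fun v _ => add_nonneg (hf0 _) (hf0 _)
    have hs1 : SI f a b τ ≤ 2 * K * dk N m (τ - θ) * (Real.pi / m) := by
      obtain ⟨i2, b2⟩ := integrable_dk2 hm0 τ
      calc SI f a b τ ≤ ∫ v in a..b, 2 * K * dk N m (τ - θ) * dk 2 m (v - τ) := by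
            unfold SI
            refine intervalIntegral.integral_mono_on hab (hcc.intervalIntegrable _ _) ((i2.const_mul _).intervalIntegrable) fun v hv => ?_
            have hb := Jk_bound M hm0.le (by positivity : (0:ℝ) ≤ M) hl3 hτ (⟨ha.trans hv.1, hv.2.trans hb⟩ : v ∈ Icc 0 Real.pi)
            rw [← hfa, ← hfa] at hb
            have hd : dk M m (τ - v) ≤ dk N m (τ - θ) * dk 2 m (v - τ) := by
              rw [dk_symm M]
              refine (dk_anti (by omega : N + 2 ≤ M) hm0).trans ?_
              unfold dk
              rw [pow_add, mul_inv]
              refine mul_le_mul_of_nonneg_right ?_ (by positivity)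
              refine inv_anti₀ (by positivity) (pow_le_pow_left₀ (by positivity) ?_ N)
              have := mul_le_mul_of_nonneg_left (h v hv) hm0.le
              linarith
            have := mul_le_mul_of_nonneg_left hd hK0.le
            linarith [hb.1, hb.2]
        _ ≤ 2 * K * dk N m (τ - θ) * ∫ v, dk 2 m (v - τ) := by
            rw [intervalIntegral.integral_const_mul, intervalIntegral.integral_of_le hab]
            have := dk_pos N (d := τ - θ) hm0
            gcongr 1
            exact setIntegral_le_integral i2 (Filter.Eventually.of_forall fun v => (dk_pos 2 hm0).le)
        _ ≤ _ := by
            have := dk_pos N (d := τ - θ) hm0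
            gcongr
    rw [abs_of_nonneg (by positivity), inv_mul_le_iff₀ hI0]
    refine hs1.trans ?_
    have hd := dk_pos N (d := τ - θ) hm0
    have e : 2 * K * dk N m (τ - θ) * (Real.pi / m) = 2 * K * dk N m (τ - θ) * Real.pi / m * 1 := by ring
    rw [e]
    calc _ ≤ 2 * K * dk N m (τ - θ) * Real.pi / m * (2 * m * I) := by gcongr
      _ = _ := by field_simp; ring
  split_ifs with hlt
  · have e : 1 - I⁻¹ * SI f θ Real.pi τ = I⁻¹ * SI f 0 θ τ := by
      have h1 : SI f 0 θ τ + SI f θ Real.pi τ = I := by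
        rw [hI, ← SI_const hfm τ]; unfold SI
        exact intervalIntegral.integral_add_adjacent_intervals (hcc.intervalIntegrable _ _) (hcc.intervalIntegrable _ _)
      rw [eq_sub_of_add_eq h1]; field_simp
    rw [e]
    refine key 0 θ le_rfl hθ.1 hθ.2 fun v hv => ?_
    rw [abs_of_pos (by linarith), abs_of_nonpos (by linarith [hv.2])]; linarith [hv.2]
  · rw [zero_sub, abs_neg]
    push Not at hlt
    refine key θ Real.pi hθ.1 hθ.2 le_rfl fun v hv => ?_
    rw [abs_of_nonpos (by linarith), abs_of_nonneg (by linarith [hv.1])]; linarith [hv.1]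

lemma wt_refl (α β τ : ℝ) : wt α β (Real.pi - τ) = wt β α τ := by
  unfold wt w
  rw [Real.cos_pi_sub, Real.sin_pi_sub]
  rw [show 1 - -Real.cos τ = 1 + Real.cos τ by ring, show 1 + -Real.cos τ = 1 - Real.cos τ by ring]
  ring

lemma nu_refl (α β : ℝ) (F : ℝ → ℝ) : ∫ τ, F τ ∂(nu α β) = ∫ τ, F (Real.pi - τ) ∂(nu β α) := by
  rw [nu_integral, nu_integral, ← integral_Ioc_eq_integral_Ioo, ← integral_Ioc_eq_integral_Ioo,
    ← intervalIntegral.integral_of_le Real.pi_pos.le, ← intervalIntegral.integral_of_le Real.pi_pos.le]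
  have := intervalIntegral.integral_comp_sub_left (a := 0) (b := Real.pi) (fun τ => F τ * wt α β τ) Real.pi
  simp only [sub_self, sub_zero] at this
  rw [← this]
  simp only [wt_refl]

lemma ite_meas (θ : ℝ) : Measurable (fun τ : ℝ => if τ ≤ θ then (1:ℝ) else 0) :=
  Measurable.ite measurableSet_Iic measurable_const measurable_const
lemma ite_meas' (θ : ℝ) : Measurable (fun τ : ℝ => if θ < τ then (1:ℝ) else 0) :=
  Measurable.ite measurableSet_Ioi measurable_const measurable_const
lemma ite_int (α β : ℝ) (hα : -1 < α) (hβ : -1 < β) (θ : ℝ) : Integrable (fun τ : ℝ => if τ ≤ θ then (1:ℝ) else 0) (nu α β) :=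
  bdd_int α β hα hβ (ite_meas θ) (C := 1) fun τ _ => by split_ifs <;> simp
lemma ite_int' (α β : ℝ) (hα : -1 < α) (hβ : -1 < β) (θ : ℝ) : Integrable (fun τ : ℝ => if θ < τ then (1:ℝ) else 0) (nu α β) :=
  bdd_int α β hα hβ (ite_meas' θ) (C := 1) fun τ _ => by split_ifs <;> simp

lemma wt_left (α β : ℝ) (hα : -1 < α) (hβ : -1 < β) : ∃ C, 0 < C ∧ ∀ θ, 0 < θ → θ ≤ Real.pi / 2 →
    ∫ τ, (if τ ≤ θ then (1:ℝ) else 0) ∂(nu α β) ≤ C * θ * wt α β θ := by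
  have hpi := Real.pi_pos
  obtain ⟨C0, hC0, H0⟩ := wt_comp α β
  obtain ⟨C1, hC1, H1⟩ := rpow_comp (2 * β + 1) (m := 1/2) (M := 1) (by norm_num) (by norm_num)
  refine ⟨C0 * C1 * C1 * C0 / (2 * α + 2), by have : 0 < 2 * α + 2 := by linarith
                                              positivity, fun θ h0 h1 => ?_⟩
  have ha : 0 < 2 * α + 2 := by linarith
  have hθ : θ ∈ Ioo 0 Real.pi := ⟨h0, by linarith⟩
  have hpb := Real.rpow_pos_of_pos hpi (2 * β + 1)
  have key : ∀ τ ∈ Ioc 0 θ, wt α β τ ≤ C0 * C1 * Real.pi ^ (2 * β + 1) * τ ^ (2 * α + 1) := by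
    intro τ hτ
    have ht := H1 (Real.pi - τ) Real.pi (by linarith [hτ.2]) hpi (by linarith [hτ.2]) (by linarith [hτ.1])
    have := (H0 τ ⟨hτ.1, by linarith [hτ.2]⟩).1
    have hp := Real.rpow_pos_of_pos hτ.1 (2 * α + 1)
    unfold mw at this
    calc _ ≤ _ := this
      _ ≤ C0 * (τ ^ (2 * α + 1) * (C1 * Real.pi ^ (2 * β + 1))) := by gcongr; exact ht.1
      _ = _ := by ring
  have hii : IntegrableOn (fun τ : ℝ => C0 * C1 * Real.pi ^ (2 * β + 1) * τ ^ (2 * α + 1)) (Ioc 0 θ) := by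
    rw [integrableOn_Ioc_iff_integrableOn_Ioo]
    exact (rpow_intOn _ (by linarith) _ h0.le).const_mul _
  have hsub : Ioc 0 θ ⊆ Ioo 0 Real.pi := fun x hx => ⟨hx.1, by linarith [hx.2]⟩
  calc _ = ∫ τ in Ioc 0 θ, wt α β τ := by
        rw [nu_integral]
        have : ∀ τ ∈ Ioo 0 Real.pi, (if τ ≤ θ then (1:ℝ) else 0) * wt α β τ = (Ioc 0 θ).indicator (wt α β) τ := by
          intro τ hτ
          by_cases h : τ ≤ θ
          · have hh : τ ∈ Ioc 0 θ := ⟨hτ.1, h⟩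
            rw [if_pos h, indicator_of_mem hh, one_mul]
          · rw [if_neg h, indicator_of_notMem (fun hh => h hh.2), zero_mul]
        rw [setIntegral_congr_fun measurableSet_Ioo this, setIntegral_indicator measurableSet_Ioc, inter_eq_right.2 hsub]
    _ ≤ ∫ τ in Ioc 0 θ, C0 * C1 * Real.pi ^ (2 * β + 1) * τ ^ (2 * α + 1) := 
        setIntegral_mono_on ((wt_intOn α β hα hβ).mono_set hsub) hii measurableSet_Ioc key
    _ = C0 * C1 * Real.pi ^ (2 * β + 1) * (θ ^ (2 * α + 2) / (2 * α + 2)) := by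
        rw [integral_const_mul, ← intervalIntegral.integral_of_le h0.le, integral_rpow (Or.inl (by linarith))]
        rw [show 2 * α + 1 + 1 = 2 * α + 2 by ring, Real.zero_rpow ha.ne', sub_zero]
    _ = C0 * C1 / (2 * α + 2) * θ * (θ ^ (2 * α + 1) * Real.pi ^ (2 * β + 1)) := by
        rw [show 2 * α + 2 = 2 * α + 1 + 1 by ring, Real.rpow_add_one h0.ne']; ring
    _ ≤ C0 * C1 / (2 * α + 2) * θ * (C1 * (C0 * wt α β θ)) := by
        have h2 := (H1 (Real.pi - θ) Real.pi (by linarith) hpi (by linarith) (by linarith)).2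
        have h3 := (H0 θ hθ).2
        have h4 := Real.rpow_pos_of_pos h0 (2 * α + 1)
        have hk : 0 ≤ C0 * C1 / (2 * α + 2) * θ := by positivity
        refine mul_le_mul_of_nonneg_left ?_ hk
        unfold mw at h3
        calc _ ≤ θ ^ (2 * α + 1) * (C1 * (Real.pi - θ) ^ (2 * β + 1)) := by gcongr
          _ = C1 * (θ ^ (2 * α + 1) * (Real.pi - θ) ^ (2 * β + 1)) := by ring
          _ ≤ _ := by gcongr
    _ = _ := by ring

lemma wt_right (α β : ℝ) (hα : -1 < α) (hβ : -1 < β) : ∃ C, 0 < C ∧ ∀ θ, Real.pi / 2 ≤ θ → θ < Real.pi → 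
    ∫ τ, (if θ < τ then (1:ℝ) else 0) ∂(nu α β) ≤ C * (Real.pi - θ) * wt α β θ := by
  obtain ⟨C, hC, H⟩ := wt_left β α hβ hα
  refine ⟨C, hC, fun θ h0 h1 => ?_⟩
  have := H (Real.pi - θ) (by linarith) (by linarith)
  rw [wt_refl] at this
  refine le_trans ?_ this
  rw [nu_refl]
  have i1 : Integrable (fun τ => if θ < Real.pi - τ then (1:ℝ) else 0) (nu β α) :=
    bdd_int β α hβ hα ((ite_meas' θ).comp (by fun_prop : Measurable fun τ => Real.pi - τ)) (C := 1) fun τ _ => by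
      split_ifs <;> simp
  refine integral_mono i1 (ite_int β α hβ hα _) fun τ => ?_
  dsimp only
  split_ifs <;> first | linarith | norm_num

lemma lint_le {X : Type*} [MeasurableSpace X] {μ : Measure X} {B : X → ℝ} (hB : Integrable B μ) (h0 : 0 ≤ᵐ[μ] B) {c : ℝ} (h : ∫ x, B x ∂μ ≤ c) :
    ∫⁻ x, ENNReal.ofReal (B x) ∂μ ≤ ENNReal.ofReal c := by
  rw [← ofReal_integral_eq_lintegral_ofReal hB h0]
  exact ENNReal.ofReal_le_ofReal h

lemma nu_lintegral (α β : ℝ) {F : ℝ → ℝ≥0∞} (hF : Measurable F) :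
    ∫⁻ τ, F τ ∂(nu α β) = ∫⁻ τ in Ioo 0 Real.pi, ENNReal.ofReal (wt α β τ) * F τ := by
  unfold nu
  rw [lintegral_withDensity_eq_lintegral_mul _ (wt_ofReal_meas α β) hF]
  rfl

/-- tail integral -/
def FF (α β : ℝ) (e : ℝ → ℝ) (θ : ℝ) : ℝ := ∫ τ, (if θ < τ then (1:ℝ) else 0) * e (Real.cos τ) ∂(nu α β)

/-- kernel -/
def AA (C : ℝ) (N : ℕ) (m θ τ : ℝ) : ℝ := if m * θ < 1 then (if τ ≤ θ then 1 else 0) else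
  if m * (Real.pi - θ) < 1 then (if θ < τ then 1 else 0) else C * dk N m (τ - θ)

lemma AA_nonneg {C : ℝ} (hC : 0 ≤ C) (N : ℕ) {m : ℝ} (hm : 0 < m) (θ τ : ℝ) : 0 ≤ AA C N m θ τ := by
  unfold AA
  have := dk_pos N (d := τ - θ) hm
  split_ifs <;> first | positivity | norm_num

lemma AA_le {C : ℝ} (hC : 0 ≤ C) {N : ℕ} {m : ℝ} (hm : 0 < m) (θ τ : ℝ) : AA C N m θ τ ≤ 1 + C := by
  unfold AA
  have := dk_le_one N (d := τ - θ) hm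
  split_ifs <;> nlinarith

lemma AA_meas (C : ℝ) (N : ℕ) {m : ℝ} (hm : 0 < m) : Measurable (fun p : ℝ × ℝ => AA C N m p.1 p.2) := by
  unfold AA
  have h := (dk_cont N hm).measurable
  refine Measurable.ite (measurableSet_lt (by fun_prop) measurable_const) ?_ (Measurable.ite (measurableSet_lt (by fun_prop) measurable_const) ?_ ?_)
  · exact Measurable.ite (measurableSet_le measurable_snd measurable_fst) measurable_const measurable_const
  · exact Measurable.ite (measurableSet_lt measurable_fst measurable_snd) measurable_const measurable_const
  · exact (h.comp (by fun_prop)).const_mul C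

lemma FF_bound (α β : ℝ) (hα : -1 < α) (hβ : -1 < β) (N : ℕ) : ∃ C, 0 < C ∧ ∀ m : ℕ, 1 ≤ m → ∀ e : ℝ → ℝ, Continuous e →
    (∀ Q : Polynomial ℝ, Q.natDegree < m → ip α β e (fun x => Q.eval x) = 0) → ∀ θ ∈ Ioo 0 Real.pi,
    |FF α β e θ| ≤ ∫ τ, AA C N m θ τ * |e (Real.cos τ)| ∂(nu α β) := by
  obtain ⟨C, hC, H⟩ := step_approx N
  refine ⟨C, hC, fun m hm e he ho θ hθ => ?_⟩
  have hm0 : (0:ℝ) < m := by exact_mod_cast hm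
  have hec : Continuous (fun τ => e (Real.cos τ)) := he.comp Real.continuous_cos
  obtain ⟨B, hB⟩ := cont_bdd hec 0 Real.pi
  have hprod : ∀ {f : ℝ → ℝ}, Integrable f (nu α β) → Integrable (fun τ => f τ * e (Real.cos τ)) (nu α β) := by
    intro f hf
    refine hf.mul_bdd hec.aestronglyMeasurable (c := B) ?_
    filter_upwards [nu_ae_mem α β] with τ hτ using hB τ ⟨hτ.1.le, hτ.2.le⟩
  -- general: FF = ∫ (1_{θ<τ} - Q) e
  have gen : ∀ Q : Polynomial ℝ, Q.natDegree < m → FF α β e θ = ∫ τ, ((if θ < τ then (1:ℝ) else 0) - Q.eval (Real.cos τ)) * e (Real.cos τ) ∂(nu α β) := by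
    intro Q hQ
    have h1 := ho Q hQ
    rw [ip_eq] at h1
    have i1 := hprod (ite_int' α β hα hβ θ)
    have i2 : Integrable (fun τ => e (Real.cos τ) * Q.eval (Real.cos τ)) (nu α β) := cont_int α β hα hβ (hec.mul (pc_cont Q))
    have : (fun τ => ((if θ < τ then (1:ℝ) else 0) - Q.eval (Real.cos τ)) * e (Real.cos τ)) =
      fun τ => (if θ < τ then (1:ℝ) else 0) * e (Real.cos τ) - e (Real.cos τ) * Q.eval (Real.cos τ) := by ext τ; ring
    rw [this, integral_sub i1 i2, h1, sub_zero]; rfl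
  have hA : Integrable (fun τ => AA C N m θ τ * |e (Real.cos τ)|) (nu α β) := by
    refine bdd_int α β hα hβ (((AA_meas C N hm0).comp (measurable_prodMk_left (x := θ))).mul hec.abs.measurable) (C := (1 + C) * B) fun τ hτ => ?_
    rw [abs_mul, abs_abs, abs_of_nonneg (AA_nonneg hC.le N hm0 θ τ)]
    exact mul_le_mul (AA_le hC.le hm0 θ τ) (hB τ ⟨hτ.1.le, hτ.2.le⟩) (abs_nonneg _) (by positivity)
  have fin : ∀ Q : Polynomial ℝ, Q.natDegree < m → (∀ τ ∈ Icc 0 Real.pi, |(if θ < τ then (1:ℝ) else 0) - Q.eval (Real.cos τ)| ≤ AA C N m θ τ) →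
      |FF α β e θ| ≤ ∫ τ, AA C N m θ τ * |e (Real.cos τ)| ∂(nu α β) := by
    intro Q hQ hle
    rw [gen Q hQ, ← Real.norm_eq_abs]
    refine norm_integral_le_of_norm_le hA ?_
    filter_upwards [nu_ae_mem α β] with τ hτ
    rw [Real.norm_eq_abs, abs_mul]
    exact mul_le_mul_of_nonneg_right (hle τ ⟨hτ.1.le, hτ.2.le⟩) (abs_nonneg _)
  by_cases h1 : m * θ < 1
  · refine fin 1 (by simpa using (by omega : 0 < m)) fun τ _ => ?_
    unfold AA; rw [if_pos h1]
    by_cases h : θ < τ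
    · simp [h, not_le.2 h]
    · simp [h, not_lt.1 h]
  by_cases h2 : m * (Real.pi - θ) < 1
  · refine fin 0 (by simpa using (by omega : 0 < m)) fun τ _ => ?_
    unfold AA; rw [if_neg h1, if_pos h2]
    by_cases h : θ < τ <;> simp [h]
  · obtain ⟨Q, hQ, hq⟩ := H m hm θ ⟨hθ.1.le, hθ.2.le⟩
    refine fin Q hQ fun τ hτ => ?_
    unfold AA; rw [if_neg h1, if_neg h2]
    exact hq τ hτ

lemma AA_row (α β : ℝ) (hα : -1 < α) (hβ : -1 < β) (C : ℝ) (hC : 0 < C) (N : ℕ) (hN : 2 * DD α β + 2 ≤ N) : ∃ K, 0 < K ∧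
    ∀ m : ℕ, 1 ≤ m → ∀ θ ∈ Ioo 0 Real.pi, ∫ τ, AA C N m θ τ ∂(nu α β) ≤ K / m * wt α β θ := by
  have hpi := Real.pi_gt_three
  obtain ⟨C1, hC1, H1⟩ := wt_left α β hα hβ
  obtain ⟨C2, hC2, H2⟩ := wt_right α β hα hβ
  obtain ⟨C3, hC3, H3⟩ := wt_dk α β hα hβ
  obtain ⟨C4, hC4, H4⟩ := mwn_le_wt α β 1 one_pos
  refine ⟨C1 + C2 + C * (C3 * C4), by positivity, fun m hm θ hθ => ?_⟩
  have hm1 : (1:ℝ) ≤ m := by exact_mod_cast hm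
  have hm0 : (0:ℝ) < m := by linarith
  have hw := wt_pos α β hθ
  have hinv : 1 / (m:ℝ) ≤ 1 := by rw [div_le_one hm0]; exact hm1
  by_cases h1 : m * θ < 1
  · unfold AA; simp only [if_pos h1]
    have h : θ < 1 / m := by rw [lt_div_iff₀ hm0]; linarith
    refine (H1 θ hθ.1 (by linarith)).trans ?_
    have h5 : C1 * θ ≤ (C1 + C2 + C * (C3 * C4)) * (1 / m) := by
      have : 0 < C * (C3 * C4) := by positivity
      refine mul_le_mul (by linarith) h.le hθ.1.le (by positivity)
    rw [mul_one_div] at h5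
    exact mul_le_mul_of_nonneg_right h5 hw.le
  by_cases h2 : m * (Real.pi - θ) < 1
  · unfold AA; simp only [if_neg h1, if_pos h2]
    have h : Real.pi - θ < 1 / m := by rw [lt_div_iff₀ hm0]; linarith
    refine (H2 θ (by linarith) hθ.2).trans ?_
    have h5 : C2 * (Real.pi - θ) ≤ (C1 + C2 + C * (C3 * C4)) * (1 / m) := by
      have : 0 < C * (C3 * C4) := by positivity
      refine mul_le_mul (by linarith) h.le (by linarith [hθ.2]) (by positivity)
    rw [mul_one_div] at h5
    exact mul_le_mul_of_nonneg_right h5 hw.le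
  · unfold AA; simp only [if_neg h1, if_neg h2]
    push Not at h1 h2
    rw [integral_const_mul, nu_integral]
    have h5 := H3 N hN m hm1 θ ⟨hθ.1.le, hθ.2.le⟩
    have h6 := (H4 m hm0 θ (by rw [div_le_iff₀ hm0]; linarith) (by
      have : 1 / (m:ℝ) ≤ Real.pi - θ := by rw [div_le_iff₀ hm0]; linarith
      linarith)).1
    calc _ ≤ C * (C3 / m * (C4 * wt α β θ)) := by
          refine mul_le_mul_of_nonneg_left (h5.trans ?_) hC.le
          exact mul_le_mul_of_nonneg_left h6 (by positivity)
      _ = (C * (C3 * C4)) / m * wt α β θ := by ring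
      _ ≤ _ := by gcongr; linarith

lemma AA_col (C : ℝ) (hC : 0 < C) (N : ℕ) (hN : 2 ≤ N) : ∃ K, 0 < K ∧
    ∀ m : ℕ, 1 ≤ m → ∀ τ, ∫⁻ θ in Ioo 0 Real.pi, ENNReal.ofReal (AA C N m θ τ) ≤ ENNReal.ofReal (K / m) := by
  have hpi := Real.pi_gt_three
  refine ⟨2 + C * Real.pi, by positivity, fun m hm τ => ?_⟩
  have hm1 : (1:ℝ) ≤ m := by exact_mod_cast hm
  have hm0 : (0:ℝ) < m := by linarith
  obtain ⟨i2, b2⟩ := integrable_dk2 hm0 τ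
  set B : ℝ → ℝ := fun θ => (Ioo 0 (1/(m:ℝ))).indicator (fun _ => (1:ℝ)) θ + (Ioo (Real.pi - 1/m) Real.pi).indicator (fun _ => (1:ℝ)) θ + C * dk 2 m (θ - τ) with hB
  have j1 : Integrable ((Ioo 0 (1/(m:ℝ))).indicator (fun _ => (1:ℝ))) := 
    (integrable_indicator_iff measurableSet_Ioo).2 (by simp)
  have j2 : Integrable ((Ioo (Real.pi - 1/m) Real.pi).indicator (fun _ => (1:ℝ))) := 
    (integrable_indicator_iff measurableSet_Ioo).2 (by simp)
  have hBi : Integrable B := (j1.add j2).add (i2.const_mul C)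
  have hd : ∀ θ, 0 < dk 2 m (θ - τ) := fun θ => dk_pos 2 hm0
  have hi1 : ∀ θ, 0 ≤ (Ioo 0 (1/(m:ℝ))).indicator (fun _ => (1:ℝ)) θ := fun θ => indicator_nonneg (fun _ _ => zero_le_one) θ
  have hi2 : ∀ θ, 0 ≤ (Ioo (Real.pi - 1/m) Real.pi).indicator (fun _ => (1:ℝ)) θ := fun θ => indicator_nonneg (fun _ _ => zero_le_one) θ
  have hB0 : ∀ θ, 0 ≤ B θ := fun θ => by
    have := mul_pos hC (hd θ)
    have := hi1 θ
    have := hi2 θ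
    simp only [hB]; linarith
  have hle : ∀ θ ∈ Ioo 0 Real.pi, AA C N m θ τ ≤ B θ := by
    intro θ hθ
    have a1 := mul_pos hC (hd θ)
    have a2 := hi1 θ
    have a3 := hi2 θ
    unfold AA
    simp only [hB]
    split_ifs with h1 h2 h3 h4
    · have h : θ ∈ Ioo 0 (1/(m:ℝ)) := ⟨hθ.1, by rw [lt_div_iff₀ hm0]; linarith⟩
      rw [indicator_of_mem h]; linarith
    · linarith
    · have h : θ ∈ Ioo (Real.pi - 1/m) Real.pi := ⟨by
        have : Real.pi - θ < 1 / m := by rw [lt_div_iff₀ hm0]; linarith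
        linarith, hθ.2⟩
      rw [indicator_of_mem h]; linarith
    · linarith
    · have := mul_le_mul_of_nonneg_left (dk_anti hN (d := τ - θ) hm0) hC.le
      rw [dk_symm 2] at this
      linarith
  have hBint : ∫ θ, B θ ≤ (2 + C * Real.pi) / m := by
    have e1 : ∫ θ, B θ = (∫ θ, (Ioo 0 (1/(m:ℝ))).indicator (fun _ => (1:ℝ)) θ) + (∫ θ, (Ioo (Real.pi - 1/m) Real.pi).indicator (fun _ => (1:ℝ)) θ) + ∫ θ, C * dk 2 m (θ - τ) := by
      refine (integral_add (f := fun θ => (Ioo 0 (1/(m:ℝ))).indicator (fun _ => (1:ℝ)) θ + (Ioo (Real.pi - 1/m) Real.pi).indicator (fun _ => (1:ℝ)) θ) (j1.add j2) (i2.const_mul C)).trans ?_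
      rw [integral_add j1 j2]
    have hinv : 0 ≤ 1 / (m:ℝ) := by positivity
    rw [e1, integral_indicator measurableSet_Ioo, integral_indicator measurableSet_Ioo, integral_const_mul]
    simp only [setIntegral_const, smul_eq_mul, mul_one, Real.volume_real_Ioo]
    rw [max_eq_left (by linarith), max_eq_left (by linarith)]
    have := mul_le_mul_of_nonneg_left b2 hC.le
    calc _ ≤ 1 / (m:ℝ) - 0 + (Real.pi - (Real.pi - 1 / m)) + C * (Real.pi / m) := by linarith
      _ = _ := by ring
  calc _ ≤ ∫⁻ θ in Ioo 0 Real.pi, ENNReal.ofReal (B θ) := by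
        refine setLIntegral_mono' measurableSet_Ioo fun θ hθ => ENNReal.ofReal_le_ofReal (hle θ hθ)
    _ ≤ ∫⁻ θ, ENNReal.ofReal (B θ) := setLIntegral_le_lintegral _ _
    _ ≤ _ := lint_le hBi (Filter.Eventually.of_forall hB0) hBint

lemma GG_bound (α β : ℝ) (hα : -1 < α) (hβ : -1 < β) : ∃ C, 0 < C ∧ ∀ m : ℕ, 1 ≤ m → ∀ e : ℝ → ℝ, Continuous e →
    (∀ Q : Polynomial ℝ, Q.natDegree < m → ip α β e (fun x => Q.eval x) = 0) → ∀ p : ℝ≥0∞, 1 ≤ p →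
    eLpNorm (fun θ => FF α β e θ / wt α β θ) p (nu α β) ≤ ENNReal.ofReal (C / m) * eLpNorm (fun τ => e (Real.cos τ)) p (nu α β) := by
  set N := 2 * DD α β + 2 with hN
  obtain ⟨C, hC, H⟩ := FF_bound α β hα hβ N
  obtain ⟨K1, hK1, H1⟩ := AA_row α β hα hβ C hC N le_rfl
  obtain ⟨K2, hK2, H2⟩ := AA_col C hC N (by omega)
  refine ⟨K1 + K2, by positivity, fun m hm e he ho p hp => ?_⟩
  have hm0 : (0:ℝ) < m := by exact_mod_cast hm
  have hfin := nu_finite α β hα hβ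
  have hec : Continuous (fun τ => e (Real.cos τ)) := he.comp Real.continuous_cos
  have hAm := AA_meas C N hm0
  have hA0 := AA_nonneg hC.le N hm0
  obtain ⟨Bd, hBd⟩ := cont_bdd hec 0 Real.pi
  have hAi : ∀ θ, Integrable (AA C N m θ) (nu α β) := fun θ => by
    refine bdd_int α β hα hβ (hAm.comp (measurable_prodMk_left (x := θ))) (C := 1 + C) fun τ _ => ?_
    rw [abs_of_nonneg (hA0 θ τ)]; exact AA_le hC.le hm0 θ τ
  have hmeas : Measurable (Function.uncurry fun θ τ : ℝ => ENNReal.ofReal (AA C N m θ τ / wt α β θ)) :=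
    (hAm.div ((wt_measurable α β).comp measurable_fst)).ennreal_ofReal
  refine schur (nu α β) (nu α β) (fun θ τ => ENNReal.ofReal (AA C N m θ τ / wt α β θ)) hmeas _ hec.measurable _ _ ?_ ?_ ?_ p hp
  · filter_upwards [nu_ae_mem α β] with θ hθ
    have hw := wt_pos α β hθ
    refine lint_le ((hAi θ).div_const _) (Filter.Eventually.of_forall fun τ => div_nonneg (hA0 θ τ) hw.le) ?_
    rw [integral_div, div_le_iff₀ hw]
    refine (H1 m hm θ hθ).trans ?_
    gcongr; linarith
  · refine Filter.Eventually.of_forall fun τ => ?_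
    rw [nu_lintegral α β (F := fun θ => ENNReal.ofReal (AA C N m θ τ / wt α β θ)) (hmeas.comp (measurable_prodMk_right (y := τ)))]
    refine le_trans (le_of_eq ?_) ((H2 m hm τ).trans (ENNReal.ofReal_le_ofReal (by gcongr; linarith)))
    refine setLIntegral_congr_fun measurableSet_Ioo fun θ hθ => ?_
    have hw := wt_pos α β hθ
    rw [← ENNReal.ofReal_mul hw.le, mul_div_cancel₀ _ hw.ne']
  · filter_upwards [nu_ae_mem α β] with θ hθ
    have hw := wt_pos α β hθ
    have h1 := H m hm e he ho θ hθ
    have i3 : Integrable (fun τ => AA C N m θ τ / wt α β θ * |e (Real.cos τ)|) (nu α β) := by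
      refine ((hAi θ).div_const _).mul_bdd hec.abs.aestronglyMeasurable (c := Bd) ?_
      filter_upwards [nu_ae_mem α β] with τ hτ
      rw [norm_abs_eq_norm]
      exact hBd τ ⟨hτ.1.le, hτ.2.le⟩
    rw [Real.enorm_eq_ofReal_abs, abs_div, abs_of_pos hw]
    have h2 : |FF α β e θ| / wt α β θ ≤ ∫ τ, AA C N m θ τ / wt α β θ * |e (Real.cos τ)| ∂(nu α β) := by
      rw [div_le_iff₀ hw, ← integral_mul_const]
      refine h1.trans (le_of_eq (integral_congr_ae (Filter.Eventually.of_forall fun τ => ?_)))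
      dsimp only
      field_simp
    refine (ENNReal.ofReal_le_ofReal h2).trans ?_
    rw [ofReal_integral_eq_lintegral_ofReal i3 (Filter.Eventually.of_forall fun τ => mul_nonneg (div_nonneg (hA0 θ τ) hw.le) (abs_nonneg _))]
    refine le_of_eq (lintegral_congr fun τ => ?_)
    rw [ENNReal.ofReal_mul (div_nonneg (hA0 θ τ) hw.le), Real.enorm_eq_ofReal_abs]

/-- antiderivative from -1 -/
def Iop (e : ℝ → ℝ) (x : ℝ) : ℝ := ∫ t in (-1:ℝ)..x, e t

def psi (α β v : ℝ) : ℝ := (1 - Real.cos v) ^ (-α) * (1 + Real.cos v) ^ (-β)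
def kap (α β v : ℝ) : ℝ := |α| * (1 + Real.cos v) + |β| * (1 - Real.cos v)

lemma psi_eq (α β : ℝ) {v : ℝ} (h : v ∈ Ioo 0 Real.pi) : psi α β v * wt α β v = Real.sin v := by
  unfold psi wt w
  have h1 := one_sub_cos_pos h
  have h2 := one_add_cos_pos h
  rw [Real.rpow_neg h1.le, Real.rpow_neg h2.le]
  have := (Real.rpow_pos_of_pos h1 α).ne'
  have := (Real.rpow_pos_of_pos h2 β).ne'
  field_simp

lemma psi_deriv (α β : ℝ) {v : ℝ} (h : v ∈ Ioo 0 Real.pi) :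
    HasDerivAt (psi α β) ((β * (1 - Real.cos v) - α * (1 + Real.cos v)) / wt α β v) v := by
  have h1 := one_sub_cos_pos h
  have h2 := one_add_cos_pos h
  have hs := Real.sin_pos_of_pos_of_lt_pi h.1 h.2
  have d1 : HasDerivAt (fun v => 1 - Real.cos v) (Real.sin v) v := by
    simpa using (Real.hasDerivAt_cos v).const_sub 1
  have d2 : HasDerivAt (fun v => 1 + Real.cos v) (- Real.sin v) v := by
    simpa using (Real.hasDerivAt_cos v).const_add 1
  have d3 := d1.rpow_const (p := -α) (Or.inl h1.ne')
  have d4 := d2.rpow_const (p := -β) (Or.inl h2.ne')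
  refine (d3.mul d4).congr_deriv ?_
  have hw := wt_pos α β h
  rw [eq_div_iff hw.ne']
  have e := psi_eq α β h
  have e2 : Real.sin v ^ 2 = (1 - Real.cos v) * (1 + Real.cos v) := by rw [Real.sin_sq]; ring
  unfold psi at e
  rw [Real.rpow_sub_one h1.ne', Real.rpow_sub_one h2.ne']
  set A := (1 - Real.cos v) ^ (-α)
  set B := (1 + Real.cos v) ^ (-β)
  have : (Real.sin v * -α * (A / (1 - Real.cos v)) * B + A * (-Real.sin v * -β * (B / (1 + Real.cos v)))) * wt α β v
     = Real.sin v * (A * B * wt α β v) * (-α / (1 - Real.cos v) + β / (1 + Real.cos v)) := by ring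
  rw [this, e, ← sq, e2]
  field_simp; ring

lemma FF_eq (α β : ℝ) (e : ℝ → ℝ) {θ : ℝ} (h : θ ∈ Ioo 0 Real.pi) :
    FF α β e θ = ∫ τ in θ..Real.pi, e (Real.cos τ) * wt α β τ := by
  unfold FF
  rw [nu_integral, intervalIntegral.integral_of_le h.2.le, integral_Ioc_eq_integral_Ioo]
  have : ∀ τ ∈ Ioo 0 Real.pi, (if θ < τ then (1:ℝ) else 0) * e (Real.cos τ) * wt α β τ = (Ioi θ).indicator (fun τ => e (Real.cos τ) * wt α β τ) τ := by
    intro τ hτ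
    by_cases hh : θ < τ
    · rw [if_pos hh, indicator_of_mem (mem_Ioi.2 hh), one_mul]
    · have hn : τ ∉ Ioi θ := fun h2 => hh h2
      rw [if_neg hh, indicator_of_notMem hn, zero_mul, zero_mul]
  rw [setIntegral_congr_fun measurableSet_Ioo this, setIntegral_indicator measurableSet_Ioi]
  congr 2
  ext x; simp only [mem_inter_iff, mem_Ioo, mem_Ioi]
  exact ⟨fun hx => ⟨hx.2, hx.1.2⟩, fun hx => ⟨⟨h.1.trans hx.1, hx.2⟩, hx.1⟩⟩

lemma wt_contAt (α β : ℝ) {v : ℝ} (h : v ∈ Ioo 0 Real.pi) : ContinuousAt (wt α β) v := by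
  unfold wt w
  have h1 := one_sub_cos_pos h
  have h2 := one_add_cos_pos h
  refine ContinuousAt.mul (ContinuousAt.mul ?_ ?_) Real.continuous_sin.continuousAt
  · exact ContinuousAt.rpow_const (by fun_prop) (Or.inl h1.ne')
  · exact ContinuousAt.rpow_const (by fun_prop) (Or.inl h2.ne')

lemma ewt_int (α β : ℝ) (hα : -1 < α) (hβ : -1 < β) {e : ℝ → ℝ} (he : Continuous e) : 
    IntegrableOn (fun τ => e (Real.cos τ) * wt α β τ) (Ioo 0 Real.pi) :=
  (nu_integrable_iff α β _).1 (cont_int α β hα hβ (he.comp Real.continuous_cos))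

lemma FF_deriv (α β : ℝ) (hα : -1 < α) (hβ : -1 < β) {e : ℝ → ℝ} (he : Continuous e) {v : ℝ} (h : v ∈ Ioo 0 Real.pi) :
    HasDerivAt (FF α β e) (-(e (Real.cos v) * wt α β v)) v := by
  have hec : Continuous (fun τ => e (Real.cos τ)) := he.comp Real.continuous_cos
  have hii : IntervalIntegrable (fun τ => e (Real.cos τ) * wt α β τ) volume v Real.pi := by
    rw [intervalIntegrable_iff_integrableOn_Ioo_of_le h.2.le]
    exact (ewt_int α β hα hβ he).mono_set (Ioo_subset_Ioo_left h.1.le)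
  have := intervalIntegral.integral_hasDerivAt_left hii
    ((hec.measurable.mul (wt_measurable α β)).stronglyMeasurable.stronglyMeasurableAtFilter) (hec.continuousAt.mul (wt_contAt α β h))
  refine this.congr_of_eventuallyEq ?_
  filter_upwards [Ioo_mem_nhds h.1 h.2] with u hu
  exact FF_eq α β e hu

lemma FF_abs (α β : ℝ) (hα : -1 < α) (hβ : -1 < β) {e : ℝ → ℝ} (he : Continuous e) : ∃ B, ∀ R, Real.pi/2 ≤ R → R < Real.pi →
    |FF α β e R * psi α β R| ≤ B * (Real.pi - R) := by
  have hpi := Real.pi_pos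
  have hec : Continuous (fun τ => e (Real.cos τ)) := he.comp Real.continuous_cos
  obtain ⟨B, hB⟩ := cont_bdd hec 0 Real.pi
  have hB0 : 0 ≤ B := (abs_nonneg _).trans (hB 0 ⟨le_rfl, hpi.le⟩)
  obtain ⟨C, hC, H⟩ := wt_right α β hα hβ
  refine ⟨B * C, fun R h1 h2 => ?_⟩
  have hR : R ∈ Ioo 0 Real.pi := ⟨by linarith, h2⟩
  have hw := wt_pos α β hR
  have hF : |FF α β e R| ≤ B * (C * (Real.pi - R) * wt α β R) := by
    refine le_trans ?_ (mul_le_mul_of_nonneg_left (H R h1 h2) hB0)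
    rw [← integral_const_mul, ← Real.norm_eq_abs]
    refine norm_integral_le_of_norm_le ((ite_int' α β hα hβ R).const_mul B) ?_
    filter_upwards [nu_ae_mem α β] with τ hτ
    rw [Real.norm_eq_abs, abs_mul, mul_comm]
    have := hB τ ⟨hτ.1.le, hτ.2.le⟩
    split_ifs
    · simpa using this
    · simp
  have hps : psi α β R = Real.sin R / wt α β R := by rw [eq_div_iff hw.ne', psi_eq α β hR]
  have hs := Real.sin_pos_of_pos_of_lt_pi hR.1 hR.2
  rw [abs_mul, hps, abs_div, abs_of_pos hw, abs_of_pos hs, mul_div_assoc', div_le_iff₀ hw]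
  have hs1 := Real.sin_le_one R
  have h0 : 0 ≤ B * (C * (Real.pi - R) * wt α β R) := (abs_nonneg _).trans hF
  calc _ ≤ B * (C * (Real.pi - R) * wt α β R) * 1 := mul_le_mul hF hs1 hs.le h0
    _ = _ := by ring

lemma Iop_eq (α β : ℝ) (hα : -1 < α) (hβ : -1 < β) {e : ℝ → ℝ} (he : Continuous e) {θ R : ℝ} (hθ : 0 < θ) (hR : θ < R) (hR2 : R < Real.pi) :
    Iop e (Real.cos θ) = (Iop e (Real.cos R) - FF α β e R * psi α β R) + (FF α β e θ * psi α β θ +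
      ∫ v in θ..R, FF α β e v * ((β * (1 - Real.cos v) - α * (1 + Real.cos v)) / wt α β v)) := by
  have hec : Continuous (fun τ => e (Real.cos τ)) := he.comp Real.continuous_cos
  have hsub : ∀ v ∈ uIcc θ R, v ∈ Ioo 0 Real.pi := by
    intro v hv; rw [uIcc_of_le hR.le] at hv; exact ⟨hθ.trans_le hv.1, hv.2.trans_lt hR2⟩
  have hwc : ContinuousOn (wt α β) (uIcc θ R) := fun v hv => (wt_contAt α β (hsub v hv)).continuousWithinAt
  have hw0 : ∀ v ∈ uIcc θ R, wt α β v ≠ 0 := fun v hv => (wt_pos α β (hsub v hv)).ne'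
  have ibp := intervalIntegral.integral_mul_deriv_eq_deriv_mul (a := θ) (b := R) (u := FF α β e) (v := psi α β)
    (u' := fun v => -(e (Real.cos v) * wt α β v)) (v' := fun v => (β * (1 - Real.cos v) - α * (1 + Real.cos v)) / wt α β v)
    (fun v hv => FF_deriv α β hα hβ he (hsub v hv)) (fun v hv => psi_deriv α β (hsub v hv))
    (ContinuousOn.intervalIntegrable (hec.continuousOn.mul hwc).neg)
    (ContinuousOn.intervalIntegrable (ContinuousOn.div (by fun_prop) hwc hw0))
  rw [ibp]
  have h1 : ∫ v in θ..R, -(e (Real.cos v) * wt α β v) * psi α β v = ∫ v in θ..R, (e ∘ Real.cos) v * (-Real.sin v) := by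
    refine intervalIntegral.integral_congr fun v hv => ?_
    dsimp only [Function.comp]
    rw [← psi_eq α β (hsub v hv)]; ring
  rw [h1, intervalIntegral.integral_comp_mul_deriv (fun v _ => Real.hasDerivAt_cos v) (by fun_prop) he]
  unfold Iop
  have := intervalIntegral.integral_add_adjacent_intervals (he.intervalIntegrable (μ := volume) (-1) (Real.cos θ)) (he.intervalIntegrable (Real.cos θ) (Real.cos R))
  rw [← this]; ring

lemma Iop_cont {e : ℝ → ℝ} (he : Continuous e) : Continuous (Iop e) := by
  unfold Iop
  exact intervalIntegral.continuous_primitive (fun a b => he.intervalIntegrable a b) _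

lemma FF_contOn (α β : ℝ) (hα : -1 < α) (hβ : -1 < β) {e : ℝ → ℝ} (he : Continuous e) : ContinuousOn (FF α β e) (Ioo 0 Real.pi) :=
  fun v hv => (FF_deriv α β hα hβ he hv).continuousAt.continuousWithinAt

lemma Iop_bound (α β : ℝ) (hα : -1 < α) (hβ : -1 < β) {e : ℝ → ℝ} (he : Continuous e) {θ : ℝ} (hθ : θ ∈ Ioo 0 Real.pi) :
    ‖Iop e (Real.cos θ)‖ₑ ≤ ‖FF α β e θ / wt α β θ‖ₑ + ∫⁻ v in Ioo θ Real.pi, ENNReal.ofReal (kap α β v) * ‖FF α β e v / wt α β v‖ₑ := by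
  have hpi := Real.pi_pos
  set X := ‖FF α β e θ / wt α β θ‖ₑ + ∫⁻ v in Ioo θ Real.pi, ENNReal.ofReal (kap α β v) * ‖FF α β e v / wt α β v‖ₑ with hX
  have hle : ∀ R, θ < R → R < Real.pi → ‖Iop e (Real.cos θ)‖ₑ ≤ ‖Iop e (Real.cos R) - FF α β e R * psi α β R‖ₑ + X := by
    intro R h1 h2
    rw [Iop_eq α β hα hβ he hθ.1 h1 h2, hX]
    refine (enorm_add_le _ _).trans (add_le_add le_rfl ((enorm_add_le _ _).trans (add_le_add ?_ ?_)))
    · have hw := wt_pos α β hθ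
      have hps : psi α β θ = Real.sin θ / wt α β θ := by rw [eq_div_iff hw.ne', psi_eq α β hθ]
      rw [hps, mul_div_assoc', mul_div_right_comm, enorm_mul]
      calc _ ≤ ‖FF α β e θ / wt α β θ‖ₑ * 1 := by
            gcongr
            rw [Real.enorm_eq_ofReal_abs]
            exact ENNReal.ofReal_le_one.2 (Real.abs_sin_le_one θ)
        _ = _ := mul_one _
    · rw [intervalIntegral.integral_of_le h1.le]
      refine (enorm_integral_le_lintegral_enorm _).trans ?_
      refine (lintegral_mono_set (fun x hx => ⟨hx.1, hx.2.trans_lt h2⟩ : Ioc θ R ⊆ Ioo θ Real.pi)).trans ?_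
      refine lintegral_mono fun v => ?_
      have : FF α β e v * ((β * (1 - Real.cos v) - α * (1 + Real.cos v)) / wt α β v) = (β * (1 - Real.cos v) - α * (1 + Real.cos v)) * (FF α β e v / wt α β v) := by ring
      dsimp only
      rw [this, enorm_mul]
      gcongr
      rw [Real.enorm_eq_ofReal_abs]
      refine ENNReal.ofReal_le_ofReal ?_
      unfold kap
      have c1 := Real.cos_le_one v
      have c2 := Real.neg_one_le_cos v
      refine (abs_sub _ _).trans ?_
      rw [abs_mul, abs_mul, abs_of_nonneg (by linarith : 0 ≤ 1 - Real.cos v), abs_of_nonneg (by linarith : 0 ≤ 1 + Real.cos v)]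
      linarith
  obtain ⟨B, hB⟩ := FF_abs α β hα hβ he
  have t1 : Filter.Tendsto (fun R => Iop e (Real.cos R)) (nhdsWithin Real.pi (Iio Real.pi)) (nhds 0) := by
    have h := ((Iop_cont he).comp Real.continuous_cos).tendsto Real.pi
    have h0 : (Iop e ∘ Real.cos) Real.pi = 0 := by simp [Iop]
    rw [h0] at h
    exact h.mono_left nhdsWithin_le_nhds
  have t2 : Filter.Tendsto (fun R => FF α β e R * psi α β R) (nhdsWithin Real.pi (Iio Real.pi)) (nhds 0) := by
    have h : Filter.Tendsto (fun R => B * (Real.pi - R)) (nhdsWithin Real.pi (Iio Real.pi)) (nhds 0) := by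
      have : Continuous (fun R => B * (Real.pi - R)) := by fun_prop
      have h := this.tendsto Real.pi
      rw [sub_self, mul_zero] at h
      exact h.mono_left nhdsWithin_le_nhds
    refine squeeze_zero_norm' ?_ h
    filter_upwards [Ioo_mem_nhdsLT (show Real.pi/2 < Real.pi by linarith)] with R hR
    exact hB R hR.1.le hR.2
  have t3 : Filter.Tendsto (fun R => ‖Iop e (Real.cos R) - FF α β e R * psi α β R‖ₑ + X) (nhdsWithin Real.pi (Iio Real.pi)) (nhds (0 + X)) := by
    refine Filter.Tendsto.add_const X ?_
    have := (t1.sub t2).enorm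
    simpa using this
  rw [zero_add] at t3
  refine ge_of_tendsto t3 ?_
  filter_upwards [Ioo_mem_nhdsLT hθ.2] with R hR
  exact hle R hR.1 hR.2

lemma schur' {X Y : Type*} [MeasurableSpace X] [MeasurableSpace Y] (μ : Measure X) (ν : Measure Y) [SFinite μ] [SFinite ν]
    (A : X → Y → ℝ≥0∞) (hA : Measurable (Function.uncurry A)) (F : Y → ℝ) (hF : Measurable F) (G : X → ℝ≥0∞) (C : ℝ≥0∞)
    (h1 : ∀ᵐ x ∂μ, ∫⁻ y, A x y ∂ν ≤ C) (h2 : ∀ᵐ y ∂ν, ∫⁻ x, A x y ∂μ ≤ C)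
    (hG : ∀ᵐ x ∂μ, G x ≤ ∫⁻ y, A x y * ‖F y‖ₑ ∂ν) (p : ℝ≥0∞) (hp : 1 ≤ p) :
    eLpNorm G p μ ≤ C * eLpNorm F p ν := by
  by_cases hpt : p = ⊤
  · subst hpt
    rw [eLpNorm_exponent_top, eLpNorm_exponent_top]
    refine eLpNormEssSup_le_of_ae_enorm_bound ?_
    filter_upwards [h1, hG] with x hx hg
    refine hg.trans ?_
    calc _ ≤ ∫⁻ y, A x y * eLpNormEssSup F ν ∂ν := by
          refine lintegral_mono_ae ?_
          filter_upwards [enorm_ae_le_eLpNormEssSup F ν] with y hy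
          gcongr
      _ = (∫⁻ y, A x y ∂ν) * eLpNormEssSup F ν := lintegral_mul_const _ (hA.comp measurable_prodMk_left)
      _ ≤ _ := by gcongr
  · have hp0 : p ≠ 0 := by rintro rfl; simp at hp
    have hr : 1 ≤ p.toReal := by
      rw [← ENNReal.toReal_one]; exact (ENNReal.toReal_le_toReal (by simp) hpt).2 hp
    have hr0 : 0 < p.toReal := by linarith
    rw [eLpNorm_eq_lintegral_rpow_enorm_toReal hp0 hpt, eLpNorm_eq_lintegral_rpow_enorm_toReal hp0 hpt]
    have := schur_lintegral μ ν A hA (fun y => ‖F y‖ₑ) hF.enorm C h1 h2 p.toReal hr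
    calc _ ≤ (∫⁻ x, (∫⁻ y, A x y * ‖F y‖ₑ ∂ν) ^ p.toReal ∂μ) ^ (1/p.toReal) := by
          refine ENNReal.rpow_le_rpow (lintegral_mono_ae ?_) (by positivity)
          filter_upwards [hG] with x hx
          exact ENNReal.rpow_le_rpow hx hr0.le
      _ ≤ (C ^ p.toReal * ∫⁻ y, ‖F y‖ₑ ^ p.toReal ∂ν) ^ (1/p.toReal) := ENNReal.rpow_le_rpow this (by positivity)
      _ = _ := by
        rw [ENNReal.mul_rpow_of_nonneg _ _ (by positivity), ← ENNReal.rpow_mul, mul_one_div_cancel hr0.ne', ENNReal.rpow_one]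

/-- kernel -/
def BB (α β : ℝ) (T : Set ℝ) (θ v : ℝ) : ℝ≥0∞ :=
  (Ioi θ ∩ T).indicator (fun v => ENNReal.ofReal (kap α β v / wt α β v)) v

lemma kap_cont (α β : ℝ) : Continuous (kap α β) := by unfold kap; fun_prop

lemma kap_nonneg (α β v : ℝ) : 0 ≤ kap α β v := by
  unfold kap
  have := Real.cos_le_one v
  have := Real.neg_one_le_cos v
  exact add_nonneg (mul_nonneg (abs_nonneg _) (by linarith)) (mul_nonneg (abs_nonneg _) (by linarith))

lemma kap_le (α β v : ℝ) : kap α β v ≤ 2 * (|α| + |β|) := by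
  unfold kap
  have := Real.cos_le_one v
  have := Real.neg_one_le_cos v
  nlinarith [abs_nonneg α, abs_nonneg β]

lemma BB_meas (α β : ℝ) {T : Set ℝ} (hT : MeasurableSet T) : Measurable (Function.uncurry (BB α β T)) := by
  have hs : MeasurableSet {z : ℝ × ℝ | z.2 ∈ Ioi z.1 ∩ T} :=
    (measurableSet_lt measurable_fst measurable_snd).inter (measurable_snd hT)
  have : Function.uncurry (BB α β T) = {z : ℝ × ℝ | z.2 ∈ Ioi z.1 ∩ T}.indicator (fun z => ENNReal.ofReal (kap α β z.2 / wt α β z.2)) := by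
    ext ⟨a, b⟩
    simp only [Function.uncurry, BB, indicator, mem_setOf_eq]
    rfl
  rw [this]
  exact (((kap_cont α β).measurable.div (wt_measurable α β)).ennreal_ofReal.comp measurable_snd).indicator hs

lemma BB_row (α β : ℝ) {T : Set ℝ} (hT : MeasurableSet T) (θ : ℝ) :
    ∫⁻ v, BB α β T θ v ∂(nu α β) ≤ ENNReal.ofReal (2 * (|α| + |β|) * Real.pi) := by
  rw [nu_lintegral α β (F := fun v => BB α β T θ v) ((BB_meas α β hT).comp (measurable_prodMk_left (x := θ)))]
  calc _ ≤ ∫⁻ v in Ioo 0 Real.pi, ENNReal.ofReal (2 * (|α| + |β|)) := by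
        refine setLIntegral_mono' measurableSet_Ioo fun v hv => ?_
        unfold BB
        by_cases h : v ∈ Ioi θ ∩ T
        · rw [indicator_of_mem h, ← ENNReal.ofReal_mul (wt_nonneg α β hv), mul_div_cancel₀ _ (wt_pos α β hv).ne']
          exact ENNReal.ofReal_le_ofReal (kap_le α β v)
        · rw [indicator_of_notMem h]; simp
    _ = _ := by
      rw [setLIntegral_const, Real.volume_Ioo, sub_zero, ← ENNReal.ofReal_mul (by positivity)]

lemma BB_schur (α β : ℝ) (hα : -1 < α) (hβ : -1 < β) {T : Set ℝ} (hT : MeasurableSet T) (C : ℝ)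
    (hC : ∀ v ∈ T ∩ Ioo 0 Real.pi, kap α β v / wt α β v * ∫ τ, (if τ ≤ v then (1:ℝ) else 0) ∂(nu α β) ≤ C)
    (G : ℝ → ℝ) (hG : Measurable G) (p : ℝ≥0∞) (hp : 1 ≤ p) :
    eLpNorm (fun θ => ∫⁻ v, BB α β T θ v * ‖G v‖ₑ ∂(nu α β)) p (nu α β) ≤
      ENNReal.ofReal (max (2 * (|α| + |β|) * Real.pi) C) * eLpNorm G p (nu α β) := by
  have hfin := nu_finite α β hα hβ
  refine schur' (nu α β) (nu α β) (BB α β T) (BB_meas α β hT) G hG _ _ ?_ ?_ (Filter.Eventually.of_forall fun x => le_rfl) p hp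
  · exact Filter.Eventually.of_forall fun θ => (BB_row α β hT θ).trans (ENNReal.ofReal_le_ofReal (le_max_left _ _))
  · filter_upwards [nu_ae_mem α β] with v hv
    by_cases h : v ∈ T
    · have hk : 0 ≤ kap α β v / wt α β v := div_nonneg (kap_nonneg α β v) (wt_nonneg α β hv)
      calc _ ≤ ∫⁻ θ, ENNReal.ofReal (kap α β v / wt α β v * (if θ ≤ v then (1:ℝ) else 0)) ∂(nu α β) := by
            refine lintegral_mono fun θ => ?_
            unfold BB
            by_cases h2 : v ∈ Ioi θ ∩ T
            · have : θ ≤ v := le_of_lt h2.1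
              rw [indicator_of_mem h2, if_pos this, mul_one]
            · rw [indicator_of_notMem h2]; exact zero_le
        _ ≤ ENNReal.ofReal C := by
            refine lint_le ((ite_int α β hα hβ v).const_mul _) (Filter.Eventually.of_forall fun θ => mul_nonneg hk (by split_ifs <;> norm_num)) ?_
            rw [integral_const_mul]
            exact hC v ⟨h, hv⟩
        _ ≤ _ := ENNReal.ofReal_le_ofReal (le_max_right _ _)
    · have : ∀ θ, BB α β T θ v = 0 := fun θ => indicator_of_notMem (fun h2 => h h2.2) _
      simp [this]

lemma BB_left (α β : ℝ) (hα : -1 < α) (hβ : -1 < β) : ∃ C, 0 < C ∧ ∀ (G : ℝ → ℝ), Measurable G → ∀ (p : ℝ≥0∞), 1 ≤ p →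
    eLpNorm (fun θ => ∫⁻ v, BB α β (Iic (Real.pi/2)) θ v * ‖G v‖ₑ ∂(nu α β)) p (nu α β) ≤
      ENNReal.ofReal C * eLpNorm G p (nu α β) := by
  obtain ⟨C, hC, H⟩ := wt_left α β hα hβ
  have hpi := Real.pi_pos
  refine ⟨max (2 * (|α| + |β|) * Real.pi) (2 * (|α| + |β|) * (C * Real.pi) + 1), lt_max_of_lt_right (by positivity), fun G hG p hp =>
    BB_schur α β hα hβ measurableSet_Iic _ (fun v hv => ?_) G hG p hp⟩
  have hw := wt_pos α β hv.2
  have hk := kap_le α β v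
  have hk0 := kap_nonneg α β v
  have h1 := H v hv.2.1 hv.1
  calc _ ≤ kap α β v / wt α β v * (C * v * wt α β v) := mul_le_mul_of_nonneg_left h1 (div_nonneg hk0 hw.le)
    _ = kap α β v * (C * v) := by field_simp
    _ ≤ 2 * (|α| + |β|) * (C * Real.pi) := by
      have := hv.2.1
      have := hv.2.2.le
      gcongr
    _ ≤ _ := by linarith

/-- admissible parameter at the endpoint -1 -/
def Good (β : ℝ) (p : ℝ≥0∞) : Prop := β = 0 ∨ β ≤ -(1/2) ∨ ∃ q : ℝ, 1 ≤ q ∧ ENNReal.HolderTriple (ENNReal.ofReal q) p 1 ∧ (β + 1/2) * (q - 1) < 1/2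

lemma rpow_bd (a : ℝ) {x : ℝ} (h1 : 1 ≤ x) (h2 : x ≤ 2) : x ^ a ≤ 2 ^ |a| :=
  (Real.rpow_le_rpow_of_exponent_le h1 (le_abs_self a)).trans (Real.rpow_le_rpow (by linarith) h2 (abs_nonneg a))

lemma half_cos {v : ℝ} (h : Real.pi / 2 < v) (h2 : v ∈ Ioo 0 Real.pi) : 0 < 1 + Real.cos v ∧ 1 + Real.cos v ≤ 1 ∧ 1 ≤ 1 - Real.cos v ∧ 1 - Real.cos v ≤ 2 := by
  have h3 := Real.cos_nonpos_of_pi_div_two_le_of_le h.le (by linarith [h2.2, Real.pi_pos])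
  have h4 := one_add_cos_pos h2
  refine ⟨h4, by linarith, by linarith, by linarith⟩

lemma wt_inv (α β : ℝ) {v : ℝ} (h : Real.pi / 2 < v) (h2 : v ∈ Ioo 0 Real.pi) : (wt α β v)⁻¹ ≤ 2 ^ |-(α+1/2)| * (1 + Real.cos v) ^ (-(β + 1/2)) := by
  obtain ⟨a, b, c, d⟩ := half_cos h h2
  rw [wt_eq α β h2, mul_inv, ← Real.rpow_neg (by linarith), ← Real.rpow_neg a.le]
  exact mul_le_mul_of_nonneg_right (rpow_bd _ c d) (Real.rpow_pos_of_pos a _).le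

lemma BB_right_bdd (α β : ℝ) (hα : -1 < α) (hβ : -1 < β) (K : ℝ) (hK : 0 ≤ K) (h : ∀ v ∈ Ioi (Real.pi/2) ∩ Ioo 0 Real.pi, kap α β v / wt α β v ≤ K) : ∃ C, 0 < C ∧ ∀ (G : ℝ → ℝ), Measurable G → ∀ (p : ℝ≥0∞), 1 ≤ p →
    eLpNorm (fun θ => ∫⁻ v, BB α β (Ioi (Real.pi/2)) θ v * ‖G v‖ₑ ∂(nu α β)) p (nu α β) ≤
      ENNReal.ofReal C * eLpNorm G p (nu α β) := by
  have hfin := nu_finite α β hα hβ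
  set I := ∫ τ, (1:ℝ) ∂(nu α β)
  have hI : 0 ≤ I := integral_nonneg fun _ => zero_le_one
  refine ⟨max (2 * (|α| + |β|) * Real.pi) (K * I + 1), lt_max_of_lt_right (by positivity), fun G hG p hp =>
    BB_schur α β hα hβ measurableSet_Ioi _ (fun v hv => ?_) G hG p hp⟩
  have h1 : ∫ τ, (if τ ≤ v then (1:ℝ) else 0) ∂(nu α β) ≤ I := by
    refine integral_mono (ite_int α β hα hβ v) (integrable_const _) fun τ => ?_
    dsimp only; split_ifs <;> norm_num
  have h0 : 0 ≤ ∫ τ, (if τ ≤ v then (1:ℝ) else 0) ∂(nu α β) := integral_nonneg fun τ => by dsimp only; split_ifs <;> norm_num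
  calc _ ≤ K * I := mul_le_mul (h v hv) h1 h0 hK
    _ ≤ _ := by linarith

lemma BB_right_hol (α β : ℝ) (hα : -1 < α) (hβ : -1 < β) (p : ℝ≥0∞) (hp : 1 ≤ p) (q : ℝ) (hq : 1 ≤ q) (hT : ENNReal.HolderTriple (ENNReal.ofReal q) p 1) (hb : (β + 1/2) * (q - 1) < 1/2) : ∃ C, 0 < C ∧ ∀ (G : ℝ → ℝ), Measurable G →
    eLpNorm (fun θ => ∫⁻ v, BB α β (Ioi (Real.pi/2)) θ v * ‖G v‖ₑ ∂(nu α β)) p (nu α β) ≤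
      ENNReal.ofReal C * eLpNorm G p (nu α β) := by
  have hfin := nu_finite α β hα hβ
  set φ : ℝ → ℝ := (Ioi (Real.pi/2)).indicator (fun v => kap α β v / wt α β v) with hφ
  have hφm : Measurable φ := ((kap_cont α β).measurable.div (wt_measurable α β)).indicator measurableSet_Ioi
  have hq0 : 0 < q := by linarith
  have hfinφ : eLpNorm φ (ENNReal.ofReal q) (nu α β) < ⊤ := by
    rw [eLpNorm_lt_top_iff_lintegral_rpow_enorm_lt_top (by simpa using hq0) (by simp), ENNReal.toReal_ofReal hq0.le]
    rw [nu_lintegral α β (hφm.enorm.pow_const q)]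
    set b := (β + 1/2) * (1 - q) - 1/2 with hbd
    have hb1 : -1 < b := by rw [hbd]; nlinarith
    set K := (2 * (|α| + |β|)) ^ q * 2 ^ |(α+1/2) * (1 - q)|
    have hK : 0 ≤ K := by positivity
    have hIntg := (wt_intOn (-(1/2)) b (by norm_num) hb1).const_mul K
    refine lt_of_le_of_lt ?_ (hIntg.lintegral_lt_top)
    refine setLIntegral_mono' measurableSet_Ioo fun v hv => ?_
    by_cases h : v ∈ Ioi (Real.pi / 2)
    · obtain ⟨a1, a2, a3, a4⟩ := half_cos h hv
      have hw := wt_pos α β hv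
      rw [hφ, indicator_of_mem h, Real.enorm_of_nonneg (div_nonneg (kap_nonneg α β v) hw.le), ENNReal.ofReal_rpow_of_nonneg (div_nonneg (kap_nonneg α β v) hw.le) hq0.le,
        ← ENNReal.ofReal_mul hw.le]
      refine ENNReal.ofReal_le_ofReal ?_
      rw [Real.div_rpow (kap_nonneg α β v) hw.le]
      have e1 : wt α β v * (kap α β v ^ q / wt α β v ^ q) = kap α β v ^ q * wt α β v ^ (1 - q) := by
        rw [Real.rpow_sub hw, Real.rpow_one]; ring
      have e2 : wt α β v ^ (1 - q) = (1 - Real.cos v) ^ ((α + 1/2) * (1 - q)) * (1 + Real.cos v) ^ ((β + 1/2) * (1 - q)) := by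
        rw [wt_eq α β hv, Real.mul_rpow (by positivity) (by positivity), ← Real.rpow_mul (by linarith), ← Real.rpow_mul a1.le]
      have e3 : wt (-(1/2)) b v = (1 + Real.cos v) ^ ((β + 1/2) * (1 - q)) := by
        rw [wt_eq _ _ hv, hbd]
        norm_num
      rw [e1, e2, e3]
      calc _ ≤ (2 * (|α| + |β|)) ^ q * (2 ^ |(α+1/2) * (1 - q)| * (1 + Real.cos v) ^ ((β + 1/2) * (1 - q))) := by
            refine mul_le_mul (Real.rpow_le_rpow (kap_nonneg α β v) (kap_le α β v) hq0.le) ?_ (by positivity) (by positivity)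
            exact mul_le_mul_of_nonneg_right (rpow_bd _ a3 a4) (Real.rpow_pos_of_pos a1 _).le
        _ = _ := by ring
    · rw [hφ, indicator_of_notMem h]
      simp [hq0]
  set M := eLpNorm φ (ENNReal.ofReal q) (nu α β) * (nu α β) univ ^ p.toReal⁻¹ with hM
  have hMt : M ≠ ⊤ := ENNReal.mul_ne_top hfinφ.ne (ENNReal.rpow_ne_top_of_nonneg (by positivity) (measure_ne_top _ _))
  refine ⟨M.toReal + 1, by positivity, fun G hG => ?_⟩
  have key : ∀ θ, ∫⁻ v, BB α β (Ioi (Real.pi/2)) θ v * ‖G v‖ₑ ∂(nu α β) ≤ eLpNorm φ (ENNReal.ofReal q) (nu α β) * eLpNorm G p (nu α β) := by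
    intro θ
    refine le_trans ?_ (eLpNorm_smul_le_mul_eLpNorm (r := 1) (p := ENNReal.ofReal q) (q := p) (hG.aestronglyMeasurable) (hφm.aestronglyMeasurable))
    rw [eLpNorm_one_eq_lintegral_enorm]
    refine lintegral_mono_ae ?_
    filter_upwards [nu_ae_mem α β] with v hv
    rw [Pi.smul_apply', smul_eq_mul, enorm_mul]
    gcongr
    unfold BB
    by_cases h2 : v ∈ Ioi θ ∩ Ioi (Real.pi/2)
    · rw [indicator_of_mem h2, hφ, indicator_of_mem h2.2, Real.enorm_of_nonneg (div_nonneg (kap_nonneg α β v) (wt_nonneg α β hv))]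
    · rw [indicator_of_notMem h2]; exact zero_le
  calc _ ≤ eLpNorm φ (ENNReal.ofReal q) (nu α β) * eLpNorm G p (nu α β) * (nu α β) univ ^ p.toReal⁻¹ := by
        refine eLpNorm_le_of_ae_enorm_bound (Filter.Eventually.of_forall fun θ => ?_)
        exact key θ
    _ = M * eLpNorm G p (nu α β) := by rw [hM]; ring
    _ ≤ _ := by
      gcongr
      rw [← ENNReal.ofReal_toReal hMt]
      exact ENNReal.ofReal_le_ofReal (by rw [ENNReal.toReal_ofReal (by positivity)]; linarith)

lemma BB_right (α β : ℝ) (hα : -1 < α) (hβ : -1 < β) (p : ℝ≥0∞) (hp : 1 ≤ p) (hg : Good β p) : ∃ C, 0 < C ∧ ∀ (G : ℝ → ℝ), Measurable G →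
    eLpNorm (fun θ => ∫⁻ v, BB α β (Ioi (Real.pi/2)) θ v * ‖G v‖ₑ ∂(nu α β)) p (nu α β) ≤
      ENNReal.ofReal C * eLpNorm G p (nu α β) := by
  rcases hg with h | h | ⟨q, hq, hT, hb⟩
  · suffices hs : ∀ v ∈ Ioi (Real.pi/2) ∩ Ioo 0 Real.pi, kap α β v / wt α β v ≤ (|α| * 2 ^ |-(α+1/2)|) by
      obtain ⟨C, hC, H⟩ := BB_right_bdd α β hα hβ _ (by positivity) hs
      exact ⟨C, hC, fun G hG => H G hG p hp⟩
    · intro v hv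
      obtain ⟨a1, a2, a3, a4⟩ := half_cos hv.1 hv.2
      have hw := wt_inv α β hv.1 hv.2
      rw [div_eq_mul_inv]
      have hk : kap α β v = |α| * (1 + Real.cos v) := by unfold kap; rw [h]; simp
      have : (1 + Real.cos v) * (1 + Real.cos v) ^ (-(β + 1/2)) ≤ 1 := by
        rw [h, ← Real.rpow_one_add' a1.le (by norm_num)]
        exact Real.rpow_le_one a1.le a2 (by norm_num)
      calc _ ≤ |α| * (1 + Real.cos v) * (2 ^ |-(α+1/2)| * (1 + Real.cos v) ^ (-(β + 1/2))) := by
            rw [hk]; gcongr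
        _ = |α| * 2 ^ |-(α+1/2)| * ((1 + Real.cos v) * (1 + Real.cos v) ^ (-(β + 1/2))) := by ring
        _ ≤ |α| * 2 ^ |-(α+1/2)| * 1 := by gcongr
        _ = _ := mul_one _
  · suffices hs : ∀ v ∈ Ioi (Real.pi/2) ∩ Ioo 0 Real.pi, kap α β v / wt α β v ≤ (2 * (|α| + |β|) * 2 ^ |-(α+1/2)|) by
      obtain ⟨C, hC, H⟩ := BB_right_bdd α β hα hβ _ (by positivity) hs
      exact ⟨C, hC, fun G hG => H G hG p hp⟩
    · intro v hv
      obtain ⟨a1, a2, a3, a4⟩ := half_cos hv.1 hv.2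
      have hw := wt_inv α β hv.1 hv.2
      rw [div_eq_mul_inv]
      have : (1 + Real.cos v) ^ (-(β + 1/2)) ≤ 1 := Real.rpow_le_one a1.le a2 (by linarith)
      have hwp := wt_pos α β hv.2
      calc _ ≤ 2 * (|α| + |β|) * (2 ^ |-(α+1/2)| * (1 + Real.cos v) ^ (-(β + 1/2))) :=
            mul_le_mul (kap_le α β v) hw (by positivity) (by positivity)
        _ ≤ 2 * (|α| + |β|) * (2 ^ |-(α+1/2)| * 1) := by gcongr
        _ = _ := by ring
  · exact BB_right_hol α β hα hβ p hp q hq hT hb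

lemma Iop_norm (α β : ℝ) (hα : -1 < α) (hβ : -1 < β) (p : ℝ≥0∞) (hp : 1 ≤ p) (hg : Good β p) : ∃ C, 0 < C ∧
    ∀ e : ℝ → ℝ, Continuous e → eLpNorm (fun τ => Iop e (Real.cos τ)) p (nu α β) ≤
      ENNReal.ofReal C * eLpNorm (fun θ => FF α β e θ / wt α β θ) p (nu α β) := by
  obtain ⟨C1, hC1, H1⟩ := BB_left α β hα hβ
  obtain ⟨C2, hC2, H2⟩ := BB_right α β hα hβ p hp hg
  have hfin := nu_finite α β hα hβ
  refine ⟨1 + C1 + C2, by positivity, fun e he => ?_⟩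
  set G : ℝ → ℝ := (Ioo 0 Real.pi).indicator (fun θ => FF α β e θ / wt α β θ) with hG
  have hGc : ContinuousOn (fun θ => FF α β e θ / wt α β θ) (Ioo 0 Real.pi) :=
    (FF_contOn α β hα hβ he).div (fun v hv => (wt_contAt α β hv).continuousWithinAt) (fun v hv => (wt_pos α β hv).ne')
  have hGm : Measurable G := by
    rw [hG, ← piecewise_eq_indicator]
    exact hGc.measurable_piecewise continuous_zero.continuousOn measurableSet_Ioo
  have hGe : eLpNorm G p (nu α β) = eLpNorm (fun θ => FF α β e θ / wt α β θ) p (nu α β) := by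
    refine eLpNorm_congr_ae ?_
    filter_upwards [nu_ae_mem α β] with θ hθ
    rw [hG, indicator_of_mem hθ]
  set S1 : ℝ → ℝ≥0∞ := fun θ => ∫⁻ v, BB α β (Iic (Real.pi/2)) θ v * ‖G v‖ₑ ∂(nu α β) with hS1
  set S2 : ℝ → ℝ≥0∞ := fun θ => ∫⁻ v, BB α β (Ioi (Real.pi/2)) θ v * ‖G v‖ₑ ∂(nu α β) with hS2
  have hm : ∀ T : Set ℝ, MeasurableSet T → Measurable (Function.uncurry fun θ v => BB α β T θ v * ‖G v‖ₑ) := fun T hT =>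
    (BB_meas α β hT).mul (hGm.enorm.comp measurable_snd)
  have hm1 : Measurable S1 := (hm _ measurableSet_Iic).lintegral_prod_right
  have hm2 : Measurable S2 := (hm _ measurableSet_Ioi).lintegral_prod_right
  have hpt : ∀ᵐ θ ∂(nu α β), ‖Iop e (Real.cos θ)‖ₑ ≤ ‖(((fun θ => ‖G θ‖ₑ) + S1) + S2) θ‖ₑ := by
    filter_upwards [nu_ae_mem α β] with θ hθ
    refine (Iop_bound α β hα hβ he hθ).trans ?_
    rw [enorm_eq_self, Pi.add_apply, Pi.add_apply, add_assoc]
    refine add_le_add (le_of_eq ?_) ?_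
    · rw [hG, indicator_of_mem hθ]
    · rw [hS1, hS2]
      dsimp only
      rw [nu_lintegral α β (F := fun v => BB α β (Iic (Real.pi/2)) θ v * ‖G v‖ₑ) ((hm _ measurableSet_Iic).comp (measurable_prodMk_left (x := θ))),
        nu_lintegral α β (F := fun v => BB α β (Ioi (Real.pi/2)) θ v * ‖G v‖ₑ) ((hm _ measurableSet_Ioi).comp (measurable_prodMk_left (x := θ))),
        ← lintegral_add_left (f := fun τ => ENNReal.ofReal (wt α β τ) * (BB α β (Iic (Real.pi / 2)) θ τ * ‖G τ‖ₑ)) ((wt_ofReal_meas α β).mul ((hm _ measurableSet_Iic).comp (measurable_prodMk_left (x := θ))))]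
      have hsub : Ioo θ Real.pi ⊆ Ioo 0 Real.pi := Ioo_subset_Ioo_left hθ.1.le
      refine le_trans ?_ (lintegral_mono_set hsub)
      refine setLIntegral_mono' measurableSet_Ioo fun v hv => ?_
      have hv2 := hsub hv
      have hw := wt_pos α β hv2
      have e0 : ENNReal.ofReal (wt α β v) * ENNReal.ofReal (kap α β v / wt α β v) = ENNReal.ofReal (kap α β v) := by
        rw [← ENNReal.ofReal_mul hw.le, mul_div_cancel₀ _ hw.ne']
      have e1 : ‖G v‖ₑ = ‖FF α β e v / wt α β v‖ₑ := by rw [hG, indicator_of_mem hv2]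
      rw [e1, ← e0]
      rcases le_or_gt v (Real.pi/2) with h | h
      · have hh : v ∈ Ioi θ ∩ Iic (Real.pi/2) := ⟨hv.1, h⟩
        refine le_trans (le_of_eq ?_) le_self_add
        simp only [BB]
        rw [indicator_of_mem hh, mul_assoc]
      · have hh : v ∈ Ioi θ ∩ Ioi (Real.pi/2) := ⟨hv.1, h⟩
        refine le_trans (le_of_eq ?_) le_add_self
        simp only [BB]
        rw [indicator_of_mem hh, mul_assoc]
  calc _ ≤ eLpNorm (((fun θ => ‖G θ‖ₑ) + S1) + S2) p (nu α β) := eLpNorm_mono_ae' hpt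
    _ ≤ eLpNorm (fun θ => ‖G θ‖ₑ) p (nu α β) + eLpNorm S1 p (nu α β) + eLpNorm S2 p (nu α β) := by
      refine (eLpNorm_add_le (hGm.enorm.add hm1).aestronglyMeasurable hm2.aestronglyMeasurable hp).trans ?_
      gcongr
      exact eLpNorm_add_le hGm.enorm.aestronglyMeasurable hm1.aestronglyMeasurable hp
    _ ≤ eLpNorm G p (nu α β) + ENNReal.ofReal C1 * eLpNorm G p (nu α β) + ENNReal.ofReal C2 * eLpNorm G p (nu α β) := by
      refine add_le_add (add_le_add (le_of_eq ?_) (H1 G hGm p hp)) (H2 G hGm)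
      exact eLpNorm_enorm G
    _ = _ := by
      rw [← hGe, ENNReal.ofReal_add (by positivity) hC2.le, ENNReal.ofReal_add (by positivity) hC1.le, ENNReal.ofReal_one]
      ring

/-- first form of the key lemma -/
lemma key_orth (α β : ℝ) (hα : -1 < α) (hβ : -1 < β) (p : ℝ≥0∞) (hp : 1 ≤ p) (hg : Good β p) : ∃ C, 0 < C ∧
    ∀ m : ℕ, 1 ≤ m → ∀ e : ℝ → ℝ, Continuous e → (∀ Q : Polynomial ℝ, Q.natDegree < m → ip α β e (fun x => Q.eval x) = 0) →
      LpW α β p (Iop e) ≤ C / m * LpW α β p e := by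
  obtain ⟨C1, hC1, H1⟩ := GG_bound α β hα hβ
  obtain ⟨C2, hC2, H2⟩ := Iop_norm α β hα hβ p hp hg
  refine ⟨C2 * C1, by positivity, fun m hm e he ho => ?_⟩
  rw [LpW_eq α β hα hβ p hp (Iop_cont he), LpW_eq α β hα hβ p hp he]
  have h := (H2 e he).trans (mul_le_mul_right (H1 m hm e he ho p hp) _)
  have hm0 : (0:ℝ) < m := by exact_mod_cast hm
  have hfe := cont_memLp α β hα hβ (he.comp Real.continuous_cos) p
  have h2 := ENNReal.toReal_mono (by
    refine ENNReal.mul_ne_top ENNReal.ofReal_ne_top (ENNReal.mul_ne_top ENNReal.ofReal_ne_top hfe.2.ne)) h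
  refine h2.trans (le_of_eq ?_)
  rw [ENNReal.toReal_mul, ENNReal.toReal_mul, ENNReal.toReal_ofReal hC2.le, ENNReal.toReal_ofReal (by positivity)]
  ring

lemma LpW_smul (α β : ℝ) (hα : -1 < α) (hβ : -1 < β) {p : ℝ≥0∞} (hp : 1 ≤ p) (c : ℝ) {f : ℝ → ℝ} (hf : Continuous f) :
    LpW α β p (fun x => c * f x) = |c| * LpW α β p f := by
  rw [LpW_eq α β hα hβ p hp (f := fun x => c * f x) (continuous_const.mul hf), LpW_eq α β hα hβ p hp hf]
  have := eLpNorm_const_smul c (fun τ => f (Real.cos τ)) p (nu α β)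
  rw [← Real.norm_eq_abs, ← toReal_enorm, ← ENNReal.toReal_mul, ← this]
  rfl

lemma mean_bound (α β : ℝ) (hα : -1 < α) (hβ : -1 < β) {p : ℝ≥0∞} (hp : 1 ≤ p) : ∃ C, 0 < C ∧ ∀ e : ℝ → ℝ, Continuous e →
    |∫ τ, e (Real.cos τ) ∂(nu α β)| ≤ C * LpW α β p e := by
  have hfin := nu_finite α β hα hβ
  set M := (nu α β) univ ^ (1 / (1:ℝ≥0∞).toReal - 1 / p.toReal) with hM
  have hMt : M ≠ ⊤ := by
    refine ENNReal.rpow_ne_top_of_nonneg ?_ (measure_ne_top _ _)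
    by_cases h : p = ⊤
    · subst h; simp
    · have : 1 ≤ p.toReal := by
        rw [← ENNReal.toReal_one]; exact (ENNReal.toReal_le_toReal (by simp) h).2 hp
      have : 1 / p.toReal ≤ 1 := by rw [div_le_one (by linarith)]; exact this
      simpa using this
  refine ⟨M.toReal + 1, by positivity, fun e he => ?_⟩
  have hec : Continuous (fun τ => e (Real.cos τ)) := he.comp Real.continuous_cos
  have hfe := cont_memLp α β hα hβ hec p
  have h1 : ‖∫ τ, e (Real.cos τ) ∂(nu α β)‖ₑ ≤ eLpNorm (fun τ => e (Real.cos τ)) p (nu α β) * M := by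
    refine (enorm_integral_le_lintegral_enorm _).trans ?_
    rw [← eLpNorm_one_eq_lintegral_enorm]
    exact eLpNorm_le_eLpNorm_mul_rpow_measure_univ hp hec.aestronglyMeasurable
  rw [LpW_eq α β hα hβ p hp he]
  have h2 := ENNReal.toReal_mono (ENNReal.mul_ne_top hfe.2.ne hMt) h1
  rw [toReal_enorm, ENNReal.toReal_mul, Real.norm_eq_abs] at h2
  have h3 : 0 ≤ (eLpNorm (fun τ => e (Real.cos τ)) p (nu α β)).toReal := by positivity
  linarith

lemma Iop_add {e g : ℝ → ℝ} (he : Continuous e) (hg : Continuous g) (x : ℝ) : Iop (fun t => e t + g t) x = Iop e x + Iop g x :=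
  intervalIntegral.integral_add (he.intervalIntegrable _ _) (hg.intervalIntegrable _ _)

lemma key_all (α β : ℝ) (hα : -1 < α) (hβ : -1 < β) (p : ℝ≥0∞) (hp : 1 ≤ p) (hg : Good β p) : ∃ C, 0 < C ∧
    ∀ m : ℕ, ∀ e : ℝ → ℝ, Continuous e → (∀ Q : Polynomial ℝ, Q.natDegree < m → ip α β e (fun x => Q.eval x) = 0) →
      LpW α β p (Iop e) ≤ C / (max m 1 : ℕ) * LpW α β p e := by
  obtain ⟨C, hC, H⟩ := key_orth α β hα hβ p hp hg
  obtain ⟨C1, hC1, H1⟩ := mean_bound α β hα hβ hp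
  have hfin := nu_finite α β hα hβ
  set I := ∫ _τ, (1:ℝ) ∂(nu α β) with hI
  have hIpos : 0 < I := by
    have h := nu_pos_open α β (U := univ) isOpen_univ ⟨Real.pi/2, mem_univ _, by constructor <;> linarith [Real.pi_pos]⟩
    rw [hI, integral_const, smul_eq_mul, mul_one]
    exact ENNReal.toReal_pos h (measure_ne_top _ _)
  set L1 := LpW α β p (fun _ => 1)
  set L2 := LpW α β p (fun x => x + 1)
  have hL1 : 0 ≤ L1 := LpW_nonneg _ _ _ _
  have hL2 : 0 ≤ L2 := LpW_nonneg _ _ _ _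
  refine ⟨C * (1 + C1 / I * L1) + C1 / I * L2, by positivity, fun m e he ho => ?_⟩
  have hLe := LpW_nonneg α β p e
  rcases Nat.eq_zero_or_pos m with rfl | hm
  · set c := (∫ τ, e (Real.cos τ) ∂(nu α β)) / I with hc
    have hcb : |c| ≤ C1 / I * LpW α β p e := by
      rw [hc, abs_div, abs_of_pos hIpos, div_le_iff₀ hIpos]
      refine (H1 e he).trans (le_of_eq ?_)
      field_simp
    have he1 : Continuous (fun x => e x + (-c)) := he.add continuous_const
    have horth : ∀ Q : Polynomial ℝ, Q.natDegree < 1 → ip α β (fun x => e x + (-c)) (fun x => Q.eval x) = 0 := by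
      intro Q hQ
      rw [Polynomial.eq_C_of_natDegree_eq_zero (by omega : Q.natDegree = 0)]
      simp only [Polynomial.eval_C]
      rw [ip_eq, integral_mul_const]
      refine mul_eq_zero_of_left ?_ _
      refine (integral_add (f := fun τ => e (Real.cos τ)) (g := fun _ => -c) (cont_int α β hα hβ (he.comp Real.continuous_cos)) (integrable_const _)).trans ?_
      have e2 : ∫ _τ, (-c) ∂(nu α β) = I * (-c) := by rw [hI, integral_const, integral_const, smul_eq_mul, smul_eq_mul, mul_one]
      rw [e2, hc]
      field_simp
      ring
    have h1 := H 1 le_rfl _ he1 horth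
    have h2 : LpW α β p (fun x => e x + (-c)) ≤ LpW α β p e + |c| * L1 := by
      refine (LpW_add α β hα hβ hp he continuous_const).trans ?_
      have := LpW_smul α β hα hβ hp (-c) (f := fun _ => 1) continuous_const
      simp only [mul_one, abs_neg] at this
      rw [this]
    have h3 : LpW α β p (Iop e) ≤ LpW α β p (Iop (fun x => e x + (-c))) + |c| * L2 := by
      have e1 : Iop e = fun x => Iop (fun x => e x + (-c)) x + c * (x + 1) := by
        ext x
        rw [Iop_add he continuous_const]
        unfold Iop
        rw [intervalIntegral.integral_const, smul_eq_mul]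
        ring
      conv_lhs => rw [e1]
      refine (LpW_add α β hα hβ hp (Iop_cont he1) (by fun_prop)).trans ?_
      rw [LpW_smul α β hα hβ hp c (f := fun x => x + 1) (by fun_prop)]
    simp only [Nat.cast_one, div_one, zero_le, sup_of_le_right] at h1 ⊢
    calc _ ≤ C * (LpW α β p e + |c| * L1) + |c| * L2 := h3.trans (add_le_add (h1.trans (mul_le_mul_of_nonneg_left h2 hC.le)) le_rfl)
      _ ≤ C * (LpW α β p e + (C1 / I * LpW α β p e) * L1) + (C1 / I * LpW α β p e) * L2 := by
        have a1 := mul_le_mul_of_nonneg_right hcb hL1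
        have a2 := mul_le_mul_of_nonneg_right hcb hL2
        have a3 := mul_le_mul_of_nonneg_left (add_le_add_right a1 (LpW α β p e)) hC.le
        linarith
      _ = _ := by ring
  · refine (H m hm e he ho).trans ?_
    rw [max_eq_left hm]
    refine mul_le_mul_of_nonneg_right ?_ hLe
    refine div_le_div_of_nonneg_right ?_ (by positivity)
    have : 0 ≤ C * (C1 / I * L1) + C1 / I * L2 := by positivity
    linarith

/-- antiderivative vanishing at θ -/
def Jop (θ : ℝ) (e : ℝ → ℝ) (x : ℝ) : ℝ := ∫ t in θ..x, e t

lemma Jop_cont (θ : ℝ) {e : ℝ → ℝ} (he : Continuous e) : Continuous (Jop θ e) := by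
  unfold Jop
  exact intervalIntegral.continuous_primitive (fun a b => he.intervalIntegrable a b) _

lemma Jop_deriv (θ : ℝ) {e : ℝ → ℝ} (he : Continuous e) (x : ℝ) : HasDerivAt (Jop θ e) (e x) x :=
  intervalIntegral.integral_hasDerivAt_right (he.intervalIntegrable _ _) he.stronglyMeasurable.stronglyMeasurableAtFilter he.continuousAt

lemma Jop_one (e : ℝ → ℝ) (x : ℝ) : Jop 1 e x = - Iop (fun t => e (-t)) (-x) := by
  unfold Jop Iop
  rw [intervalIntegral.integral_comp_neg, neg_neg, neg_neg, intervalIntegral.integral_symm]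

lemma w_refl (α β x : ℝ) : w α β (-x) = w β α x := by
  unfold w; rw [sub_neg_eq_add, ← sub_eq_add_neg, mul_comm]

lemma int_refl (F : ℝ → ℝ) : ∫ x in Ioo (-1:ℝ) 1, F (-x) = ∫ x in Ioo (-1:ℝ) 1, F x := by
  rw [← integral_Ioc_eq_integral_Ioo, ← integral_Ioc_eq_integral_Ioo, ← intervalIntegral.integral_of_le (by norm_num),
    ← intervalIntegral.integral_of_le (by norm_num), intervalIntegral.integral_comp_neg, neg_neg]

lemma ip_refl (α β : ℝ) (f g : ℝ → ℝ) : ip α β (fun x => f (-x)) (fun x => g (-x)) = ip β α f g := by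
  unfold ip
  rw [← int_refl]
  simp only [w_refl, neg_neg]

lemma LpW_refl (α β : ℝ) (p : ℝ≥0∞) (f : ℝ → ℝ) : LpW α β p (fun x => f (-x)) = LpW β α p f := by
  unfold LpW
  split_ifs with h
  · congr 1
    ext y
    constructor
    · rintro ⟨x, hx, rfl⟩
      exact ⟨-x, ⟨by linarith [hx.2], by linarith [hx.1]⟩, rfl⟩
    · rintro ⟨x, hx, rfl⟩
      exact ⟨-x, ⟨by linarith [hx.2], by linarith [hx.1]⟩, by simp⟩
  · rw [← int_refl]
    simp only [w_refl, neg_neg]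

lemma orth_refl {α β : ℝ} {e : ℝ → ℝ} {m : ℕ} (ho : ∀ Q : Polynomial ℝ, Q.natDegree < m → ip α β e (fun x => Q.eval x) = 0) :
    ∀ Q : Polynomial ℝ, Q.natDegree < m → ip β α (fun x => e (-x)) (fun x => Q.eval x) = 0 := by
  intro Q hQ
  have h := ho (Q.comp (-Polynomial.X)) (by
    rw [Polynomial.natDegree_comp, Polynomial.natDegree_neg, Polynomial.natDegree_X, mul_one]; exact hQ)
  rw [← ip_refl] at h
  simpa using h

/-- admissible endpoint -/
def GoodE (θ α β : ℝ) (p : ℝ≥0∞) : Prop := (θ = -1 ∧ Good β p) ∨ (θ = 1 ∧ Good α p)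

lemma key_end (α β : ℝ) (hα : -1 < α) (hβ : -1 < β) (p : ℝ≥0∞) (hp : 1 ≤ p) (θ : ℝ) (hg : GoodE θ α β p) : ∃ C, 0 < C ∧
    ∀ m : ℕ, ∀ e : ℝ → ℝ, Continuous e → (∀ Q : Polynomial ℝ, Q.natDegree < m → ip α β e (fun x => Q.eval x) = 0) →
      LpW α β p (Jop θ e) ≤ C / (max m 1 : ℕ) * LpW α β p e := by
  rcases hg with ⟨rfl, hg⟩ | ⟨rfl, hg⟩
  · exact key_all α β hα hβ p hp hg
  · obtain ⟨C, hC, H⟩ := key_all β α hβ hα p hp hg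
    refine ⟨C, hC, fun m e he ho => ?_⟩
    have h := H m (fun x => e (-x)) (he.comp continuous_neg) (orth_refl ho)
    rw [LpW_refl] at h
    refine le_trans (le_of_eq ?_) h
    rw [← LpW_neg, ← LpW_refl]
    congr 1
    ext x
    rw [Jop_one, neg_neg, neg_neg]

lemma Iop_ibp (α : ℝ) (hα : -1 < α) {e : ℝ → ℝ} (he : Continuous e) (i : ℕ) :
    ip α 0 (Iop e) (fun x => (1 - x) ^ i) = 1 / (i + α + 1) * ip α 0 e (fun x => (1 - x) ^ (i + 1)) := by
  have hi : (0:ℝ) ≤ i := Nat.cast_nonneg i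
  have hpos : 0 < i + α + 1 := by linarith
  have hz : ∀ (g : ℝ → ℝ) (j : ℕ), ip α 0 g (fun x => (1 - x) ^ j) = ∫ x in (-1:ℝ)..1, g x * (1 - x) ^ (j + α) := by
    intro g j
    unfold ip
    rw [intervalIntegral.integral_of_le (by norm_num), integral_Ioc_eq_integral_Ioo]
    refine setIntegral_congr_fun measurableSet_Ioo fun x hx => ?_
    have : 0 < 1 - x := by linarith [hx.2]
    simp only [w]
    rw [Real.rpow_zero, mul_one, Real.rpow_add this, Real.rpow_natCast, mul_assoc]
  rw [hz, hz]
  have hcv : Continuous (fun x : ℝ => -(1 - x) ^ (i + α + 1) / (i + α + 1)) := by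
    refine Continuous.div_const (Continuous.neg ?_) _
    exact (continuous_const.sub continuous_id).rpow_const fun x => Or.inr hpos.le
  have hii : IntervalIntegrable (fun x : ℝ => (1 - x) ^ (i + α)) volume (-1) 1 := by
    have h0 := intervalIntegral.intervalIntegrable_rpow' (a := 2) (b := 0) (r := i + α) (by linarith)
    have := h0.comp_sub_left 1
    norm_num at this
    exact this
  have := intervalIntegral.integral_mul_deriv_eq_deriv_mul_of_hasDerivAt (a := -1) (b := 1) (u := Iop e) (u' := e)
    (v := fun x => -(1 - x) ^ (i + α + 1) / (i + α + 1)) (v' := fun x => (1 - x) ^ (i + α)) (Iop_cont he).continuousOn hcv.continuousOn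
    (fun x _ => Jop_deriv (-1) he x) ?_ (he.intervalIntegrable _ _) hii
  · rw [this]
    have h1 : Iop e (-1) = 0 := intervalIntegral.integral_same
    rw [h1, sub_self, Real.zero_rpow hpos.ne', neg_zero, zero_div, mul_zero, zero_mul, sub_zero, zero_sub, ← intervalIntegral.integral_neg,
      ← intervalIntegral.integral_const_mul]
    refine intervalIntegral.integral_congr fun x _ => ?_
    rw [show ((i + 1 : ℕ):ℝ) + α = i + α + 1 by push_cast; ring]
    ring
  · intro x hx
    norm_num at hx
    have h1 : 1 - x ≠ 0 := by linarith [hx.2]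
    have h2 := ((((hasDerivAt_id x).const_sub 1).rpow_const (p := i + α + 1) (Or.inl h1)).neg).div_const (i + α + 1)
    refine h2.congr_deriv ?_
    rw [add_sub_cancel_right]
    simp only [id]
    field_simp

lemma Iop_orth (α : ℝ) (hα : -1 < α) {e : ℝ → ℝ} (he : Continuous e) {m : ℕ}
    (ho : ∀ Q : Polynomial ℝ, Q.natDegree < m → ip α 0 e (fun x => Q.eval x) = 0) :
    ∀ Q : Polynomial ℝ, Q.natDegree < m - 1 → ip α 0 (Iop e) (fun x => Q.eval x) = 0 := by
  intro Q hQ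
  set R := Q.comp (1 - Polynomial.X) with hR
  have hd1 : (1 - Polynomial.X : Polynomial ℝ).natDegree = 1 := by
    have : (1 - Polynomial.X : Polynomial ℝ) = -(Polynomial.X - Polynomial.C 1) := by simp
    rw [this, Polynomial.natDegree_neg, Polynomial.natDegree_X_sub_C]
  have hRd : R.natDegree < m - 1 := by
    rw [hR, Polynomial.natDegree_comp, hd1, mul_one]; exact hQ
  have hev : ∀ x, Q.eval x = ∑ i ∈ Finset.range (m - 1), R.coeff i * (1 - x) ^ i := by
    intro x
    rw [← Polynomial.eval_eq_sum_range' hRd (1 - x), hR]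
    simp
  simp only [hev]
  have hlin : ip α 0 (Iop e) (fun x => ∑ i ∈ Finset.range (m - 1), R.coeff i * (1 - x) ^ i) =
      ∑ i ∈ Finset.range (m - 1), R.coeff i * ip α 0 (Iop e) (fun x => (1 - x) ^ i) := by
    simp only [ip_eq]
    simp only [Finset.mul_sum, ← integral_const_mul]
    rw [integral_finsetSum]
    · refine Finset.sum_congr rfl fun i _ => integral_congr_ae (Filter.Eventually.of_forall fun τ => ?_)
      dsimp only; ring
    · intro i _
      exact ip_int α 0 hα (by norm_num) (Iop_cont he) (g := fun x => R.coeff i * (1 - x) ^ i) (by fun_prop)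
  rw [hlin]
  refine Finset.sum_eq_zero fun i hi => ?_
  rw [Finset.mem_range] at hi
  rw [Iop_ibp α hα he]
  have h := ho ((1 - Polynomial.X) ^ (i + 1)) (by
    refine lt_of_le_of_lt Polynomial.natDegree_pow_le ?_
    rw [hd1]; omega)
  simp only [Polynomial.eval_pow, Polynomial.eval_sub, Polynomial.eval_one, Polynomial.eval_X] at h
  rw [h]; simp

lemma Jop_orth (α β : ℝ) (hα : -1 < α) (hβ : -1 < β) (θ : ℝ) (hθ : (θ = -1 ∧ β = 0) ∨ (θ = 1 ∧ α = 0)) {e : ℝ → ℝ} (he : Continuous e) {m : ℕ}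
    (ho : ∀ Q : Polynomial ℝ, Q.natDegree < m → ip α β e (fun x => Q.eval x) = 0) :
    ∀ Q : Polynomial ℝ, Q.natDegree < m - 1 → ip α β (Jop θ e) (fun x => Q.eval x) = 0 := by
  rcases hθ with ⟨rfl, rfl⟩ | ⟨rfl, rfl⟩
  · exact Iop_orth α hα he ho
  · intro Q hQ
    have h := orth_refl (Iop_orth β hβ (he.comp continuous_neg) (orth_refl ho)) Q hQ
    have : Jop 1 e = fun x => (-1) * Iop (fun t => e (-t)) (-x) := by ext x; rw [Jop_one]; ring
    rw [this, ip_smul]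
    rw [mul_eq_zero]; right
    exact h

lemma Jit_cont (θ : ℝ) {e : ℝ → ℝ} (he : Continuous e) (s : ℕ) : Continuous ((Jop θ)^[s] e) := by
  induction s with
  | zero => exact he
  | succ s ih => rw [Function.iterate_succ_apply']; exact Jop_cont θ ih

lemma Jit_deriv (θ : ℝ) {e : ℝ → ℝ} (he : Continuous e) (s : ℕ) : deriv ((Jop θ)^[s+1] e) = (Jop θ)^[s] e := by
  rw [Function.iterate_succ_apply']
  ext x
  exact (Jop_deriv θ (Jit_cont θ he s) x).deriv

lemma Jit_contDiff (θ : ℝ) {e : ℝ → ℝ} (he : Continuous e) (s : ℕ) : ContDiff ℝ (s : ℕ∞) ((Jop θ)^[s] e) := by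
  induction s with
  | zero => exact contDiff_zero.2 he
  | succ s ih =>
    have : (((s + 1 : ℕ) : ℕ∞) : WithTop ℕ∞) = ((s : ℕ∞) : WithTop ℕ∞) + 1 := by norm_cast
    rw [this, contDiff_succ_iff_deriv]
    refine ⟨fun x => ?_, by intro h; simp at h, ?_⟩
    · rw [Function.iterate_succ_apply']
      exact (Jop_deriv θ (Jit_cont θ he s) x).differentiableAt
    · rw [Jit_deriv θ he]; exact ih

lemma Jit_iteratedDeriv (θ : ℝ) {e : ℝ → ℝ} (he : Continuous e) (s k : ℕ) (hk : k ≤ s) :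
    iteratedDeriv k ((Jop θ)^[s] e) = (Jop θ)^[s - k] e := by
  induction k generalizing s with
  | zero => simp
  | succ k ih =>
    obtain ⟨t, rfl⟩ : ∃ t, s = t + 1 := ⟨s - 1, by omega⟩
    rw [iteratedDeriv_succ', Jit_deriv θ he, ih t (by omega)]
    congr 1; omega

lemma taylor_int (θ x : ℝ) (s : ℕ) {F : ℝ → ℝ} (hF : ContDiff ℝ ((s + 1 : ℕ) : ℕ∞) F) :
    F x = (∑ k ∈ Finset.range (s + 1), iteratedDeriv k F θ * (x - θ) ^ k / k.factorial) +
      ∫ t in θ..x, (x - t) ^ s / s.factorial * iteratedDeriv (s + 1) F t := by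
  have hc : ∀ k ≤ s + 1, Continuous (iteratedDeriv k F) := fun k hk => hF.continuous_iteratedDeriv k (by exact_mod_cast hk)
  have hd : ∀ k ≤ s, ∀ y, HasDerivAt (iteratedDeriv k F) (iteratedDeriv (k + 1) F y) y := fun k hk y => by
    rw [iteratedDeriv_succ]
    exact ((hF.differentiable_iteratedDeriv k (by exact_mod_cast Nat.lt_succ_of_le hk)) y).hasDerivAt
  have key : ∀ j ≤ s, F x = (∑ k ∈ Finset.range (j + 1), iteratedDeriv k F θ * (x - θ) ^ k / k.factorial) +
      ∫ t in θ..x, (x - t) ^ j / j.factorial * iteratedDeriv (j + 1) F t := by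
    intro j
    induction j with
    | zero =>
      intro _
      simp only [pow_zero, Nat.factorial_zero, Nat.cast_one, div_one, one_mul]
      rw [intervalIntegral.integral_eq_sub_of_hasDerivAt (f := iteratedDeriv 0 F) (fun y _ => hd 0 (Nat.zero_le _) y) ((hc 1 (by omega)).intervalIntegrable _ _)]
      simp
    | succ j ih =>
      intro hj
      rw [ih (by omega), Finset.sum_range_succ (n := j + 1), add_assoc]
      congr 1
      have hv : ∀ y, HasDerivAt (fun t : ℝ => -(x - t) ^ (j + 1) / (j + 1).factorial) ((x - y) ^ j / j.factorial) y := by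
        intro y
        have h := ((((hasDerivAt_id y).const_sub x).pow (j + 1)).neg).div_const ((j+1).factorial : ℝ)
        refine h.congr_deriv ?_
        rw [Nat.factorial_succ]
        push_cast
        simp only [id, Nat.add_sub_cancel]
        have : (j.factorial : ℝ) ≠ 0 := by positivity
        field_simp
      have hvc : Continuous (fun y : ℝ => (x - y) ^ j / (j.factorial : ℝ)) := by fun_prop
      have h := intervalIntegral.integral_mul_deriv_eq_deriv_mul (a := θ) (b := x) (fun y _ => hd (j + 1) hj y) (fun y _ => hv y)
        ((hc (j + 2) (by omega)).intervalIntegrable _ _) (hvc.intervalIntegrable _ _)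
      have e1 : ∀ t, (x - t) ^ j / (j.factorial : ℝ) * iteratedDeriv (j + 1) F t = iteratedDeriv (j + 1) F t * ((x - t) ^ j / (j.factorial : ℝ)) := fun t => mul_comm _ _
      simp only [e1]
      rw [h, sub_self, zero_pow (by omega), neg_zero, zero_div, mul_zero, zero_sub, sub_eq_add_neg, ← intervalIntegral.integral_neg]
      congr 1
      · ring
      · refine intervalIntegral.integral_congr fun t _ => ?_
        ring
  exact key s le_rfl

lemma VS_eq (η : ℝ → ℝ) (α β : ℝ) (s : ℕ) (hs : 1 ≤ s) (θ : ℝ) (n : ℕ) {f : ℝ → ℝ} (hf : ContDiff ℝ (s : ℕ∞) f) :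
    VS η α β s θ n f = fun x => f x - (Jop θ)^[s] (fun x => iteratedDeriv s f x - V η α β n (iteratedDeriv s f) x) x := by
  obtain ⟨t, rfl⟩ : ∃ t, s = t + 1 := ⟨s - 1, by omega⟩
  have hg : Continuous (iteratedDeriv (t + 1) f) := hf.continuous_iteratedDeriv (t + 1) le_rfl
  have hV := V_cont η α β n (iteratedDeriv (t + 1) f)
  set e : ℝ → ℝ := fun x => iteratedDeriv (t + 1) f x - V η α β n (iteratedDeriv (t + 1) f) x with he
  have hec : Continuous e := hg.sub hV
  ext x
  have h1 := taylor_int θ x t hf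
  have h2 := taylor_int θ x t (Jit_contDiff θ hec (t + 1))
  rw [Jit_iteratedDeriv θ hec (t + 1) (t + 1) le_rfl, Nat.sub_self, Function.iterate_zero_apply] at h2
  have h3 : (∑ k ∈ Finset.range (t + 1), iteratedDeriv k ((Jop θ)^[t + 1] e) θ * (x - θ) ^ k / k.factorial) = 0 := by
    refine Finset.sum_eq_zero fun k hk => ?_
    rw [Finset.mem_range] at hk
    rw [Jit_iteratedDeriv θ hec (t + 1) k (by omega), show t + 1 - k = (t - k) + 1 by omega, Function.iterate_succ_apply']
    simp [Jop]
  rw [h3, zero_add] at h2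
  rw [h2]
  conv_rhs => rw [h1]
  unfold VS
  rw [Nat.add_sub_cancel, add_sub_assoc]
  congr 1
  have hp : Continuous (fun t' : ℝ => (x - t') ^ t / (t.factorial : ℝ)) := by fun_prop
  rw [← intervalIntegral.integral_sub (f := fun t' => (x - t') ^ t / (t.factorial:ℝ) * iteratedDeriv (t+1) f t') (g := fun t' => (x - t') ^ t / (t.factorial:ℝ) * e t') ((hp.mul hg).intervalIntegrable _ _) ((hp.mul hec).intervalIntegrable _ _)]
  refine intervalIntegral.integral_congr fun y _ => ?_
  simp only [he]
  ring

lemma VS_diff (η : ℝ → ℝ) (α β : ℝ) (s : ℕ) (hs : 1 ≤ s) (θ : ℝ) (n : ℕ) {f : ℝ → ℝ} (hf : ContDiff ℝ (s : ℕ∞) f) (k : ℕ) (hk : k ≤ s) :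
    (fun x => iteratedDeriv k f x - iteratedDeriv k (VS η α β s θ n f) x) =
      (Jop θ)^[s - k] (fun x => iteratedDeriv s f x - V η α β n (iteratedDeriv s f) x) := by
  have hg : Continuous (iteratedDeriv s f) := hf.continuous_iteratedDeriv s le_rfl
  have hec : Continuous (fun x => iteratedDeriv s f x - V η α β n (iteratedDeriv s f) x) := hg.sub (V_cont η α β n (iteratedDeriv s f))
  rw [VS_eq η α β s hs θ n hf]
  set e : ℝ → ℝ := fun x => iteratedDeriv s f x - V η α β n (iteratedDeriv s f) x
  have hc := Jit_contDiff θ hec s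
  have hk2 : ((k : ℕ) : WithTop ℕ∞) ≤ ((s : ℕ∞) : WithTop ℕ∞) := by exact_mod_cast hk
  ext x
  rw [iteratedDeriv_fun_sub (hf.of_le hk2).contDiffAt (hc.of_le hk2).contDiffAt, Jit_iteratedDeriv θ hec s k hk]
  ring

lemma good_of (b : ℝ) (p : ℝ≥0∞) (hp : 1 ≤ p) (h1 : 1 < p → p ≠ ⊤ → b < p.toReal / 2 - 1) (h2 : p = 1 → b ≤ p.toReal / 2 - 1) : Good b p := by
  right
  by_cases hpt : p = ⊤
  · subst hpt
    right
    refine ⟨1, le_rfl, ?_, by norm_num⟩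
    rw [ENNReal.ofReal_one]
    infer_instance
  · rcases eq_or_lt_of_le hp with h | h
    · left
      have := h2 h.symm
      rw [← h] at this
      norm_num at this
      linarith
    · right
      have hb := h1 h hpt
      have hr : 1 < p.toReal := by
        rw [← ENNReal.toReal_one]; exact (ENNReal.toReal_lt_toReal (by simp) hpt).2 h
      have hr1 : 0 < p.toReal - 1 := by linarith
      refine ⟨p.toReal / (p.toReal - 1), ?_, ?_, ?_⟩
      · rw [le_div_iff₀ hr1]; linarith
      · have := (Real.HolderConjugate.conjExponent hr).symm.ennrealOfReal
        rw [ENNReal.ofReal_toReal hpt] at this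
        exact this
      · have : p.toReal / (p.toReal - 1) - 1 = 1 / (p.toReal - 1) := by field_simp; ring
        rw [this, mul_one_div, div_lt_iff₀ hr1]
        linarith

lemma Jit_bound (α β : ℝ) (hα : -1 < α) (hβ : -1 < β) (p : ℝ≥0∞) (θ : ℝ) (s : ℕ) (C : ℝ) (hC : 0 < C)
    (hz : s = 1 ∨ ((θ = -1 ∧ β = 0) ∨ (θ = 1 ∧ α = 0)))
    (H : ∀ m : ℕ, ∀ e : ℝ → ℝ, Continuous e → (∀ Q : Polynomial ℝ, Q.natDegree < m → ip α β e (fun x => Q.eval x) = 0) →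
      LpW α β p (Jop θ e) ≤ C / (max m 1 : ℕ) * LpW α β p e)
    (n : ℕ) (hn : 1 ≤ n) {e : ℝ → ℝ} (he : Continuous e)
    (ho : ∀ Q : Polynomial ℝ, Q.natDegree < n + 1 → ip α β e (fun x => Q.eval x) = 0) :
    ∀ j ≤ s, LpW α β p ((Jop θ)^[j] e) ≤ (C * (s + 1) / n) ^ j * LpW α β p e ∧
      ((s = 1 ∧ 1 ≤ j) ∨ ∀ Q : Polynomial ℝ, Q.natDegree < n + 1 - j → ip α β ((Jop θ)^[j] e) (fun x => Q.eval x) = 0) := by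
  intro j
  induction j with
  | zero => intro _; exact ⟨by simp, Or.inr (by simpa using ho)⟩
  | succ j ih =>
    intro hj
    obtain ⟨h1, h2⟩ := ih (by omega)
    have hcj := Jit_cont θ he j
    have h2' : ∀ Q : Polynomial ℝ, Q.natDegree < n + 1 - j → ip α β ((Jop θ)^[j] e) (fun x => Q.eval x) = 0 := by
      rcases h2 with ⟨a, b⟩ | h
      · omega
      · exact h
    have hn0 : (0:ℝ) < n := by exact_mod_cast hn
    rw [Function.iterate_succ_apply']
    constructor
    · refine (H _ _ hcj h2').trans ?_
      have hnat : n ≤ (s + 1) * max (n + 1 - j) 1 := by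
        rcases le_or_gt j n with h | h
        · obtain ⟨d, rfl⟩ : ∃ d, n = j + d := ⟨n - j, by omega⟩
          have : (j + 1) * (d + 1) ≤ (s + 1) * max (j + d + 1 - j) 1 :=
            Nat.mul_le_mul (by omega) (le_trans (by omega) (le_max_left _ _))
          nlinarith
        · have : (s + 1) * 1 ≤ (s + 1) * max (n + 1 - j) 1 := Nat.mul_le_mul le_rfl (le_max_right _ _)
          omega
      have hr : (n:ℝ) ≤ (s + 1) * (max (n + 1 - j) 1 : ℕ) := by exact_mod_cast hnat
      have hM : (0:ℝ) < (max (n + 1 - j) 1 : ℕ) := by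
        have : 0 < max (n + 1 - j) 1 := lt_of_lt_of_le one_pos (le_max_right _ _)
        exact_mod_cast this
      have hCC : C / (max (n + 1 - j) 1 : ℕ) ≤ C * (s + 1) / n := by
        rw [div_le_div_iff₀ hM hn0]
        calc C * n ≤ C * ((s + 1) * (max (n + 1 - j) 1 : ℕ)) := mul_le_mul_of_nonneg_left hr hC.le
          _ = _ := by ring
      calc _ ≤ (C * (s + 1) / n) * ((C * (s + 1) / n) ^ j * LpW α β p e) :=
            mul_le_mul hCC h1 (LpW_nonneg _ _ _ _) (by positivity)
        _ = _ := by ring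
    · rcases hz with h | h
      · left; omega
      · right
        have := Jop_orth α β hα hβ θ h hcj h2'
        intro Q hQ
        exact this Q (by omega)

lemma E_nonneg (α β : ℝ) (p : ℝ≥0∞) (n : ℕ) (f : ℝ → ℝ) : 0 ≤ E α β p n f := by
  unfold E
  refine Real.sInf_nonneg ?_
  rintro r ⟨q, _, rfl⟩
  exact LpW_nonneg _ _ _ _

theorem statement19 (α β : ℝ) (hα : -1 < α) (hβ : -1 < β) (s : ℕ) (hs : 1 ≤ s)
    (p : ℝ≥0∞) (hp : 1 ≤ p) (η : ℝ → ℝ) (hη : Admissible η) (θ : ℝ)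
    (hθ : (θ = -1 ∧ (β = 0 ∨ (s = 1 ∧ (1 < p → p ≠ ⊤ → β < p.toReal / 2 - 1)
            ∧ (p = 1 → β ≤ p.toReal / 2 - 1)))) ∨
          (θ = 1 ∧ (α = 0 ∨ (s = 1 ∧ (1 < p → p ≠ ⊤ → α < p.toReal / 2 - 1)
            ∧ (p = 1 → α ≤ p.toReal / 2 - 1))))) :
    ∃ c : ℝ, 0 < c ∧ ∀ f : ℝ → ℝ, MemW α β p s f → ∀ n : ℕ, 1 ≤ n → ∀ k : ℕ, k ≤ s →
      LpW α β p (fun x => iteratedDeriv k f x - iteratedDeriv k (VS η α β s θ n f) x)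
        ≤ c * (n : ℝ) ^ ((k : ℝ) - (s : ℝ)) * E α β p n (iteratedDeriv s f) := by
  have hgood : GoodE θ α β p := by
    rcases hθ with ⟨a, h | ⟨_, h1, h2⟩⟩ | ⟨a, h | ⟨_, h1, h2⟩⟩
    · exact Or.inl ⟨a, Or.inl h⟩
    · exact Or.inl ⟨a, good_of β p hp h1 h2⟩
    · exact Or.inr ⟨a, Or.inl h⟩
    · exact Or.inr ⟨a, good_of α p hp h1 h2⟩
  have hz : s = 1 ∨ ((θ = -1 ∧ β = 0) ∨ (θ = 1 ∧ α = 0)) := by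
    rcases hθ with ⟨a, h | ⟨h, _, _⟩⟩ | ⟨a, h | ⟨h, _, _⟩⟩
    · exact Or.inr (Or.inl ⟨a, h⟩)
    · exact Or.inl h
    · exact Or.inr (Or.inr ⟨a, h⟩)
    · exact Or.inl h
  obtain ⟨C, hC, H⟩ := key_end α β hα hβ p hp θ hgood
  obtain ⟨D, hD, HD⟩ := V_near η hη α β hα hβ
  refine ⟨(1 + C * (s + 1)) ^ s * D, by positivity, fun f hf n hn k hk => ?_⟩
  have hn0 : (0:ℝ) < n := by exact_mod_cast hn
  have hg : Continuous (iteratedDeriv s f) := hf.1.continuous_iteratedDeriv s le_rfl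
  have hec : Continuous (fun x => iteratedDeriv s f x - V η α β n (iteratedDeriv s f) x) := hg.sub (V_cont η α β n (iteratedDeriv s f))
  rw [VS_diff η α β s hs θ n hf.1 k hk]
  have h1 := (Jit_bound α β hα hβ p θ s C hC hz H n hn hec
    (fun Q hQ => V_orth η hη α β hα hβ n hn hg Q (by omega)) (s - k) (by omega)).1
  have h2 := HD n hn p hp _ hg
  have hE := E_nonneg α β p n (iteratedDeriv s f)
  have e1 : (n:ℝ) ^ ((k:ℝ) - (s:ℝ)) = ((n:ℝ) ^ (s - k))⁻¹ := by
    rw [← Real.rpow_natCast, ← Real.rpow_neg hn0.le, Nat.cast_sub hk]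
    congr 1; ring
  have e2 : (C * (s + 1) / n) ^ (s - k) ≤ (1 + C * (s + 1)) ^ s * ((n:ℝ) ^ (s - k))⁻¹ := by
    rw [div_pow, div_eq_mul_inv]
    refine mul_le_mul_of_nonneg_right ?_ (by positivity)
    have hpos : 0 ≤ C * ((s:ℝ) + 1) := by positivity
    calc (C * ((s:ℝ) + 1)) ^ (s - k) ≤ (1 + C * (s + 1)) ^ (s - k) := pow_le_pow_left₀ hpos (by linarith) _
      _ ≤ _ := pow_le_pow_right₀ (by linarith) (by omega)
  rw [e1]
  calc _ ≤ (C * (s + 1) / n) ^ (s - k) * (D * E α β p n (iteratedDeriv s f)) :=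
        h1.trans (mul_le_mul_of_nonneg_left h2 (by positivity))
    _ ≤ ((1 + C * (s + 1)) ^ s * ((n:ℝ) ^ (s - k))⁻¹) * (D * E α β p n (iteratedDeriv s f)) :=
        mul_le_mul_of_nonneg_right e2 (by positivity)
    _ = _ := by ring

end JacobiApprox
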